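/- arXiv:2510.15008 — 2 statements merged into one kernel-verified Lean document; each statement's English description precedes it below -/
import Mathlib

section
/- The Apéry-like series of weight 5 evaluates as: ∑_{k=1}^∞ 4^k H_k^3 / (k^2 · C(2k,k)) = −(155/8)ζ(5) + 18ζ(2)ζ(3) + 80 Li_5(1/2) + (455/2) ln(2) ζ(4) + (32/3) ln^3(2) ζ(2) − (2/3) ln^5(2). -/
open Real

/-- Riemann zeta value at a positive integer `m > 1`, as the series `∑ 1/n^m`. -/
noncomputable def zetaVal (m : ℕ) : ℝ := ∑' n : ℕ, 1 / (n + 1 : ℝ) ^ m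

/-- Polylogarithm `Li_m(z) = ∑_{k≥1} z^k / k^m`. -/
noncomputable def polyLog (m : ℕ) (z : ℝ) : ℝ := ∑' k : ℕ, z ^ (k + 1) / (k + 1 : ℝ) ^ m

/-- Generalized harmonic number `H_k^{(m)} = ∑_{n=1}^k 1/n^m`. -/
noncomputable def genHarmonic (k m : ℕ) : ℝ := ∑ n ∈ Finset.range k, 1 / (n + 1 : ℝ) ^ m

/-- Letters of the alphabet: they stand for the differential forms
`dx/x`, `dx/(1-x)`, `dx/(1+x)` and `2 dx/(1-x^2)`. -/
inductive Ltr
  | a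
  | b
  | c
  | B
  deriving DecidableEq

namespace Apery

open Ltr Filter Topology

/-- coefficient of `1/x` in the form -/
def kap : Ltr → ℝ
  | a => 1
  | _ => 0

/-- Taylor coefficients of the regular part of the form -/
def tay : Ltr → ℕ → ℝ
  | a, _ => 0
  | b, _ => 1
  | c, j => (-1) ^ j
  | B, j => 1 + (-1) ^ j

/-- The forms. -/
noncomputable def form : Ltr → ℝ → ℝ
  | a, x => 1 / x
  | b, x => 1 / (1 - x)
  | c, x => 1 / (1 + x)
  | B, x => 2 / (1 - x ^ 2)

/-- Taylor coefficients of iterated integrals. -/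
noncomputable def coef : List Ltr → ℕ → ℝ
  | [], n => if n = 0 then 1 else 0
  | l :: w, n => (kap l * coef w n + ∑ m ∈ Finset.range n, coef w m * tay l (n - 1 - m)) / n

/-- Iterated integrals as power series. -/
noncomputable def H (w : List Ltr) (x : ℝ) : ℝ := ∑' n : ℕ, coef w n * x ^ n

/-- Words whose iterated integrals converge at zero. -/
def good : List Ltr → Bool
  | [] => true
  | [l] => decide (l ≠ a)
  | _ :: m :: w => good (m :: w)

/-- Words whose iterated integrals also converge at one. -/
def conv : List Ltr → Bool
  | [] => false
  | l :: w => (decide (l = a) || decide (l = c)) && good (l :: w)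

theorem coef_cons_zero (l : Ltr) (w : List Ltr) : coef (l :: w) 0 = 0 := by
  simp [coef]

theorem abs_tay_le (l : Ltr) (j : ℕ) : |tay l j| ≤ 2 := by
  cases l
  · simp [tay]
  · simp [tay]
  · simp [tay]
  · simp only [tay]
    refine (abs_add_le _ _).trans ?_
    simp; norm_num

theorem abs_kap_tay (l : Ltr) (j : ℕ) : (l = a ∧ kap l = 1 ∧ tay l j = 0) ∨ kap l = 0 := by
  cases l <;> simp [kap, tay]

theorem abs_coef_le (w : List Ltr) (n : ℕ) : |coef w n| ≤ 2 ^ w.length := by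
  induction w generalizing n with
  | nil => simp only [coef]; split_ifs <;> simp
  | cons l w ih =>
    rcases Nat.eq_zero_or_pos n with rfl | hn
    · rw [coef_cons_zero]; simp
    have hn' : (0 : ℝ) < n := by exact_mod_cast hn
    have hn1 : (1 : ℝ) ≤ n := by exact_mod_cast hn
    simp only [coef]
    rw [abs_div, abs_of_pos hn', div_le_iff₀ hn']
    have hP : (0 : ℝ) ≤ 2 ^ w.length := by positivity
    by_cases hl : l = a
    · subst hl
      simp only [kap, tay, one_mul, mul_zero, Finset.sum_const_zero, add_zero]
      refine (ih n).trans ?_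
      rw [List.length_cons, pow_succ]
      nlinarith
    · have hk : kap l = 0 := by cases l <;> simp_all [kap]
      rw [hk, zero_mul, zero_add]
      refine (Finset.abs_sum_le_sum_abs _ _).trans ?_
      have : ∀ m ∈ Finset.range n, |coef w m * tay l (n - 1 - m)| ≤ 2 ^ w.length * 2 := by
        intro m _
        rw [abs_mul]
        exact mul_le_mul (ih m) (abs_tay_le _ _) (abs_nonneg _) hP
      refine (Finset.sum_le_sum this).trans ?_
      rw [Finset.sum_const, Finset.card_range, nsmul_eq_mul, List.length_cons, pow_succ]
      linarith

theorem summable_bdd {u : ℕ → ℝ} {C : ℝ} (hu : ∀ n, |u n| ≤ C) {x : ℝ} (hx : |x| < 1) :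
    Summable fun n => u n * x ^ n := by
  refine Summable.of_norm_bounded (g := fun n => C * |x| ^ n)
    ((summable_geometric_of_lt_one (abs_nonneg _) hx).mul_left C) ?_
  intro n
  rw [Real.norm_eq_abs, abs_mul, abs_pow]
  exact mul_le_mul_of_nonneg_right (hu n) (by positivity)

theorem summable_bdd_norm {u : ℕ → ℝ} {C : ℝ} (hu : ∀ n, |u n| ≤ C) {x : ℝ} (hx : |x| < 1) :
    Summable fun n => ‖u n * x ^ n‖ := (summable_bdd hu hx).norm

theorem hasDerivAt_power {u : ℕ → ℝ} {C : ℝ} (hu : ∀ n, |u n| ≤ C) {x : ℝ} (hx : |x| < 1) :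
    HasDerivAt (fun y => ∑' n, u n * y ^ n) (∑' n, u n * (n * x ^ (n - 1))) x := by
  obtain ⟨r, hr1, hr2⟩ := exists_between hx
  have hr0 : 0 < r := (abs_nonneg x).trans_lt hr1
  have hrn : ‖r‖ < 1 := by rwa [Real.norm_eq_abs, abs_of_pos hr0]
  have hs : Summable fun n : ℕ => C * (n * r ^ (n - 1)) := by
    refine Summable.mul_left C ?_
    have := (summable_pow_mul_geometric_of_norm_lt_one 1 hrn).mul_right r⁻¹
    refine this.congr ?_
    intro n
    rcases n with _ | n
    · simp
    · simp only [Nat.add_sub_cancel, pow_succ]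
      field_simp
  refine hasDerivAt_tsum_of_isPreconnected (𝕜 := ℝ)
    (g := fun n y => u n * y ^ n) (g' := fun n y => u n * (n * y ^ (n - 1))) (t := Metric.ball (0 : ℝ) r) hs Metric.isOpen_ball
    (convex_ball (0 : ℝ) r).isPreconnected (y₀ := (0 : ℝ)) ?_ ?_ (by simpa using hr0) ?_ (by simpa using hr1)
  · intro n y _
    exact (hasDerivAt_pow n y).const_mul (u n)
  · intro n y hy
    have hy' : |y| ≤ r := by
      have := Metric.mem_ball.1 hy
      rw [Real.dist_eq, sub_zero] at this
      exact this.le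
    rw [Real.norm_eq_abs, abs_mul, abs_mul, abs_pow, Nat.abs_cast]
    have hC : 0 ≤ C := (abs_nonneg _).trans (hu 0)
    gcongr
    exact hu n
  · exact summable_bdd hu (by simp)

theorem H_nil (x : ℝ) : H [] x = 1 := by
  unfold H
  rw [tsum_eq_single 0]
  · simp [coef]
  · intro n hn; simp [coef, hn]

theorem H_cons_zero (l : Ltr) (w : List Ltr) : H (l :: w) 0 = 0 := by
  unfold H
  rw [tsum_eq_single 0]
  · simp [coef_cons_zero]
  · intro n hn; simp [hn]

theorem hasSum_H (w : List Ltr) {x : ℝ} (hx : |x| < 1) :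
    HasSum (fun n => coef w n * x ^ n) (H w x) :=
  (summable_bdd (abs_coef_le w) hx).hasSum

theorem form_series (l : Ltr) {x : ℝ} (hx : |x| < 1) (hx0 : x ≠ 0) :
    form l x = kap l / x + ∑' j, tay l j * x ^ j := by
  have h1 : HasSum (fun j : ℕ => x ^ j) (1 - x)⁻¹ := hasSum_geometric_of_abs_lt_one hx
  have h2 : HasSum (fun j : ℕ => (-x) ^ j) (1 - (-x))⁻¹ :=
    hasSum_geometric_of_abs_lt_one (by rwa [abs_neg])
  have h2' : HasSum (fun j : ℕ => (-1) ^ j * x ^ j) (1 + x)⁻¹ := by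
    have e : (1 - (-x))⁻¹ = (1 + x)⁻¹ := by ring
    rw [e] at h2
    refine h2.congr_fun ?_
    intro j
    rw [← mul_pow]; ring
  have hm : 1 - x ≠ 0 := by have := (abs_lt.1 hx).2; linarith
  have hp : 1 + x ≠ 0 := by have := (abs_lt.1 hx).1; linarith
  cases l
  · simp [form, kap, tay]
  · simp [form, kap, tay, h1.tsum_eq]
  · simp [form, kap, tay, h2'.tsum_eq]
  · simp only [form, kap, tay, add_mul, one_mul, (h1.add h2').tsum_eq]
    have : 1 - x ^ 2 ≠ 0 := by
      have : (1 - x) * (1 + x) ≠ 0 := mul_ne_zero hm hp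
      intro h; apply this; linarith
    field_simp
    ring

theorem hasDerivAt_H {l : Ltr} {w : List Ltr} (hg : good (l :: w) = true) {x : ℝ} (hx : |x| < 1)
    (hx0 : x ≠ 0) : HasDerivAt (H (l :: w)) (form l x * H w x) x := by
  have h := hasDerivAt_power (abs_coef_le (l :: w)) hx
  refine h.congr_deriv ?_
  have hs := summable_bdd (abs_coef_le (l :: w)) hx
  -- shift index
  have hder : Summable fun n : ℕ => coef (l :: w) n * (n * x ^ (n - 1)) := by
    obtain ⟨r, hr1, hr2⟩ := exists_between hx
    have hxn : ‖x‖ < 1 := hx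
    have h1 := (summable_pow_mul_geometric_of_norm_lt_one 1 hxn).mul_right x⁻¹
    refine Summable.of_norm_bounded (g := fun n => 2 ^ (l :: w).length * ‖(n : ℝ) ^ 1 * x ^ n * x⁻¹‖)
      (h1.norm.mul_left _) ?_
    intro n
    rw [norm_mul]
    have : (n : ℝ) * x ^ (n - 1) = (n : ℝ) ^ 1 * x ^ n * x⁻¹ := by
      rcases n with _ | n
      · simp
      · simp only [Nat.add_sub_cancel, pow_succ]
        field_simp
    rw [this]
    exact mul_le_mul_of_nonneg_right (abs_coef_le _ _) (norm_nonneg _)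
  rw [hder.tsum_eq_zero_add]
  simp only [Nat.cast_zero, zero_mul, mul_zero, zero_add, Nat.add_sub_cancel]
  have hterm : ∀ n : ℕ, coef (l :: w) (n + 1) * (((n + 1 : ℕ) : ℝ) * x ^ n) =
      kap l * (coef w (n + 1) * x ^ n) +
      ∑ k ∈ Finset.range (n + 1), (coef w k * x ^ k) * (tay l (n - k) * x ^ (n - k)) := by
    intro n
    have hn : ((n + 1 : ℕ) : ℝ) ≠ 0 := by positivity
    simp only [coef]
    rw [← mul_assoc, div_mul_cancel₀ _ hn, add_mul, Finset.sum_mul]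
    congr 1
    · ring
    · refine Finset.sum_congr rfl ?_
      intro k hk
      have hk' : k ≤ n := Nat.lt_succ_iff.1 (Finset.mem_range.1 hk)
      have : x ^ n = x ^ k * x ^ (n - k) := by rw [← pow_add]; congr 1; omega
      rw [this, show n + 1 - 1 - k = n - k by omega]
      ring
  simp only [hterm]
  have s1 := summable_bdd_norm (abs_coef_le w) hx
  have s2 := summable_bdd_norm (abs_tay_le l) hx
  have hprod := tsum_mul_tsum_eq_tsum_sum_range_of_summable_norm s1 s2
  have hsum2 := summable_sum_mul_range_of_summable_norm' s1 s1.of_norm s2 s2.of_norm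
  have hsum1 : Summable fun n : ℕ => kap l * (coef w (n + 1) * x ^ n) := by
    refine Summable.mul_left _ ?_
    exact summable_bdd (u := fun n => coef w (n + 1)) (fun n => abs_coef_le w (n + 1)) hx
  rw [hsum1.tsum_add hsum2, ← hprod, tsum_mul_left, form_series l hx hx0]
  have hH : H w x = coef w 0 + x * ∑' n : ℕ, coef w (n + 1) * x ^ n := by
    unfold H
    rw [s1.of_norm.tsum_eq_zero_add]
    simp only [pow_zero, mul_one, ← tsum_mul_left]
    congr 1
    refine tsum_congr ?_
    intro n; ring
  have hk : kap l * coef w 0 = 0 := by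
    rcases w with _ | ⟨m, w⟩
    · have : l ≠ a := by simpa [good] using hg
      cases l <;> simp_all [kap]
    · rw [coef_cons_zero, mul_zero]
  have hHw : (∑' n, coef w n * x ^ n) = H w x := rfl
  rw [hHw, add_mul, mul_comm (H w x)]
  congr 1
  rw [hH, mul_add, div_mul_eq_mul_div, hk]
  field_simp
  ring

theorem continuousAt_H (w : List Ltr) {x : ℝ} (hx : |x| < 1) : ContinuousAt (H w) x :=
  (hasDerivAt_power (abs_coef_le w) hx).continuousAt

theorem abs_lt_of_mem {x : ℝ} (hx : x ∈ Set.Ioo (0 : ℝ) 1) : |x| < 1 := by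
  rw [abs_of_pos hx.1]; exact hx.2

theorem hasDerivAt_H' {l : Ltr} {w : List Ltr} (hg : good (l :: w) = true) {x : ℝ}
    (hx : x ∈ Set.Ioo (0 : ℝ) 1) : HasDerivAt (H (l :: w)) (form l x * H w x) x :=
  hasDerivAt_H hg (abs_lt_of_mem hx) hx.1.ne'

theorem tendsto_H_zero (l : Ltr) (w : List Ltr) : Tendsto (H (l :: w)) (𝓝[>] 0) (𝓝 0) := by
  have h := (continuousAt_H (l :: w) (x := 0) (by simp)).tendsto
  rw [H_cons_zero] at h
  exact h.mono_left nhdsWithin_le_nhds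

/-- Two functions on `(0,1)` with the same derivative and the same limit at zero agree. -/
theorem eq_of_deriv {f g d : ℝ → ℝ} (hf : ∀ x ∈ Set.Ioo (0 : ℝ) 1, HasDerivAt f (d x) x)
    (hg : ∀ x ∈ Set.Ioo (0 : ℝ) 1, HasDerivAt g (d x) x) {y : ℝ}
    (hf0 : Tendsto f (𝓝[>] 0) (𝓝 y)) (hg0 : Tendsto g (𝓝[>] 0) (𝓝 y))
    {x : ℝ} (hx : x ∈ Set.Ioo (0 : ℝ) 1) : f x = g x := by
  have hd : ∀ z ∈ Set.Ioo (0 : ℝ) 1, HasDerivAt (fun z => f z - g z) 0 z := by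
    intro z hz
    have h := (hf z hz).sub (hg z hz)
    rw [sub_self] at h
    exact h
  have hconst : ∀ z ∈ Set.Ioo (0 : ℝ) 1, f z - g z = f x - g x := by
    intro z hz
    refine isOpen_Ioo.is_const_of_deriv_eq_zero (convex_Ioo (0 : ℝ) 1).isPreconnected
      (f := fun z => f z - g z) ?_ ?_ hz hx
    · intro z hz; exact (hd z hz).differentiableAt.differentiableWithinAt
    · intro z hz; exact (hd z hz).deriv
  have hlim : Tendsto (fun z => f z - g z) (𝓝[>] 0) (𝓝 (y - y)) := hf0.sub hg0
  have hlim2 : Tendsto (fun z => f z - g z) (𝓝[>] 0) (𝓝 (f x - g x)) := by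
    refine tendsto_const_nhds.congr' ?_
    have : Set.Ioo (0 : ℝ) 1 ∈ 𝓝[>] (0 : ℝ) := Ioo_mem_nhdsGT (by norm_num)
    filter_upwards [this] with z hz using (hconst z hz).symm
  have := tendsto_nhds_unique hlim hlim2
  linarith

end Apery
namespace Apery

open Ltr Filter Topology

theorem good_cons (l m : Ltr) (w : List Ltr) : good (l :: m :: w) = good (m :: w) := rfl

theorem good_tail {l : Ltr} {w : List Ltr} (h : good (l :: w) = true) : good w = true := by
  rcases w with _ | ⟨m, w⟩
  · rfl
  · exact h

theorem good_cons_of_ne {l : Ltr} {w : List Ltr} (h : good w = true) (hw : w ≠ []) :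
    good (l :: w) = true := by
  rcases w with _ | ⟨m, w⟩
  · exact absurd rfl hw
  · exact h

/-- Auxiliary structural recursion for the shuffle product. -/
def shAux (l : Ltr) (u : List Ltr) (f : List Ltr → List (List Ltr)) : List Ltr → List (List Ltr)
  | [] => [l :: u]
  | m :: v => ((f (m :: v)).map fun w => l :: w) ++ ((shAux l u f v).map fun w => m :: w)

/-- The shuffle product of two words. -/
def sh : List Ltr → List Ltr → List (List Ltr)
  | [] => fun v => [v]
  | l :: u => shAux l u (sh u)

theorem sh_good (u v : List Ltr) (hu : good u = true) (hv : good v = true) :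
    ∀ w ∈ sh u v, good w = true ∧ (w = [] → u = [] ∧ v = []) := by
  induction u generalizing v with
  | nil => intro w hw; simp only [sh, List.mem_singleton] at hw; subst hw; exact ⟨hv, by simp⟩
  | cons l u ihu =>
    induction v with
    | nil =>
      intro w hw
      simp only [sh, shAux, List.mem_singleton] at hw
      subst hw
      exact ⟨hu, by simp⟩
    | cons m v ihv =>
      intro w hw
      simp only [sh, shAux, List.mem_append, List.mem_map] at hw
      rcases hw with ⟨w', hw', rfl⟩ | ⟨w', hw', rfl⟩
      · obtain ⟨h1, h2⟩ := ihu (m :: v) (good_tail hu) hv w' hw'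
        refine ⟨good_cons_of_ne h1 ?_, by simp⟩
        intro h; have := (h2 h).2; simp at this
      · obtain ⟨h1, h2⟩ := ihv (good_tail hv) w' hw'
        refine ⟨good_cons_of_ne h1 ?_, by simp⟩
        intro h; have := (h2 h).1; simp at this

theorem hasDerivAt_listSum {ws : List (List Ltr)} {l : Ltr}
    (h : ∀ w ∈ ws, good (l :: w) = true) {x : ℝ} (hx : x ∈ Set.Ioo (0 : ℝ) 1) :
    HasDerivAt (fun y => (ws.map fun w => H (l :: w) y).sum)
      (form l x * (ws.map fun w => H w x).sum) x := by
  induction ws with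
  | nil => simpa using hasDerivAt_const x (0 : ℝ)
  | cons w ws ih =>
    have h1 := hasDerivAt_H' (h w (by simp)) hx
    have h2 := ih (fun w' hw' => h w' (by simp [hw']))
    have := h1.add h2
    simp only [List.map_cons, List.sum_cons, mul_add]
    exact this

theorem tendsto_listSum_zero (ws : List (List Ltr)) (l : Ltr) :
    Tendsto (fun y => (ws.map fun w => H (l :: w) y).sum) (𝓝[>] 0) (𝓝 0) := by
  induction ws with
  | nil => simp
  | cons w ws ih =>
    have := (tendsto_H_zero l w).add ih
    simpa using this

/-- The shuffle product formula. -/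
theorem H_shuffle (u v : List Ltr) (hu : good u = true) (hv : good v = true) {x : ℝ}
    (hx : x ∈ Set.Ioo (0 : ℝ) 1) :
    H u x * H v x = ((sh u v).map fun w => H w x).sum := by
  induction u generalizing v x with
  | nil => simp [sh, H_nil]
  | cons l u ihu =>
    induction v generalizing x with
    | nil => simp [sh, shAux, H_nil]
    | cons m v ihv =>
      have e : ∀ y, (((sh (l :: u) (m :: v)).map fun w => H w y).sum) =
          ((sh u (m :: v)).map fun w => H (l :: w) y).sum +
          ((sh (l :: u) v).map fun w => H (m :: w) y).sum := by
        intro y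
        simp [sh, shAux, Function.comp_def]
      have g1 : ∀ w ∈ sh u (m :: v), good (l :: w) = true := by
        intro w hw
        obtain ⟨h1, h2⟩ := sh_good u (m :: v) (good_tail hu) hv w hw
        refine good_cons_of_ne h1 ?_
        intro h; have := (h2 h).2; simp at this
      have g2 : ∀ w ∈ sh (l :: u) v, good (m :: w) = true := by
        intro w hw
        obtain ⟨h1, h2⟩ := sh_good (l :: u) v hu (good_tail hv) w hw
        refine good_cons_of_ne h1 ?_
        intro h; have := (h2 h).1; simp at this
      rw [e]
      refine eq_of_deriv (f := fun x => H (l :: u) x * H (m :: v) x)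
        (g := fun y => ((sh u (m :: v)).map fun w => H (l :: w) y).sum +
          ((sh (l :: u) v).map fun w => H (m :: w) y).sum)
        (d := fun x => form l x * H u x * H (m :: v) x + H (l :: u) x * (form m x * H v x))
        ?_ ?_ (y := 0) ?_ ?_ hx
      · intro x hx
        exact (hasDerivAt_H' hu hx).mul (hasDerivAt_H' hv hx)
      · intro x hx
        refine ((hasDerivAt_listSum g1 hx).add (hasDerivAt_listSum g2 hx)).congr_deriv ?_
        rw [← ihu (m :: v) (good_tail hu) hv hx, ← ihv (good_tail hv) hx]
        ring
      · simpa using (tendsto_H_zero l u).mul (tendsto_H_zero m v)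
      · simpa using (tendsto_listSum_zero (sh u (m :: v)) l).add
          (tendsto_listSum_zero (sh (l :: u) v) m)

theorem le_of_deriv_le {f g f' g' : ℝ → ℝ} (hf : ∀ x ∈ Set.Ioo (0 : ℝ) 1, HasDerivAt f (f' x) x)
    (hg : ∀ x ∈ Set.Ioo (0 : ℝ) 1, HasDerivAt g (g' x) x)
    (hle : ∀ x ∈ Set.Ioo (0 : ℝ) 1, f' x ≤ g' x)
    (hf0 : Tendsto f (𝓝[>] 0) (𝓝 0)) (hg0 : Tendsto g (𝓝[>] 0) (𝓝 0))
    {x : ℝ} (hx : x ∈ Set.Ioo (0 : ℝ) 1) : f x ≤ g x := by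
  have hd : ∀ z ∈ Set.Ioo (0 : ℝ) 1, HasDerivAt (fun z => g z - f z) (g' z - f' z) z :=
    fun z hz => (hg z hz).sub (hf z hz)
  have hmono : MonotoneOn (fun z => g z - f z) (Set.Ioo (0 : ℝ) 1) := by
    refine monotoneOn_of_deriv_nonneg (convex_Ioo 0 1) ?_ ?_ ?_
    · intro z hz; exact (hd z hz).continuousAt.continuousWithinAt
    · rw [interior_Ioo]; intro z hz; exact (hd z hz).differentiableAt.differentiableWithinAt
    · rw [interior_Ioo]; intro z hz; rw [(hd z hz).deriv]; linarith [hle z hz]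
  have hlim : Tendsto (fun z => g z - f z) (𝓝[>] 0) (𝓝 (0 - 0)) := hg0.sub hf0
  have : (0 : ℝ) - 0 ≤ g x - f x := by
    refine le_of_tendsto hlim ?_
    have : Set.Ioo (0 : ℝ) x ∈ 𝓝[>] (0 : ℝ) := Ioo_mem_nhdsGT hx.1
    filter_upwards [this] with z hz
    exact hmono ⟨hz.1, hz.2.trans hx.2⟩ hx hz.2.le
  linarith

theorem abs_le_of_deriv_le {f g f' g' : ℝ → ℝ}
    (hf : ∀ x ∈ Set.Ioo (0 : ℝ) 1, HasDerivAt f (f' x) x)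
    (hg : ∀ x ∈ Set.Ioo (0 : ℝ) 1, HasDerivAt g (g' x) x)
    (hle : ∀ x ∈ Set.Ioo (0 : ℝ) 1, |f' x| ≤ g' x)
    (hf0 : Tendsto f (𝓝[>] 0) (𝓝 0)) (hg0 : Tendsto g (𝓝[>] 0) (𝓝 0))
    {x : ℝ} (hx : x ∈ Set.Ioo (0 : ℝ) 1) : |f x| ≤ g x := by
  rw [abs_le']
  constructor
  · exact le_of_deriv_le hf hg (fun z hz => (le_abs_self _).trans (hle z hz)) hf0 hg0 hx
  · refine le_of_deriv_le (f := fun x => - f x) (f' := fun x => - f' x) (fun z hz => (hf z hz).neg) hg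
      (fun z hz => (neg_le_abs _).trans (hle z hz)) (by simpa using hf0.neg) hg0 hx

theorem form_bound (l : Ltr) {x : ℝ} (hx : x ∈ Set.Ioo (0 : ℝ) 1) :
    |form l x| * x ≤ 2 / (1 - x) ∧ (l ≠ a → |form l x| ≤ 2 / (1 - x)) := by
  obtain ⟨h0, h1⟩ := hx
  have hm : 0 < 1 - x := by linarith
  have hb : l ≠ a → |form l x| ≤ 2 / (1 - x) := by
    intro hl
    cases l
    · exact absurd rfl hl
    · simp only [form]
      rw [abs_of_pos (by positivity)]
      gcongr; norm_num
    · simp only [form]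
      rw [abs_of_pos (by positivity), div_le_div_iff₀ (by positivity) hm]
      linarith
    · simp only [form]
      have : 0 < 1 - x ^ 2 := by nlinarith
      rw [abs_of_pos (by positivity), div_le_div_iff₀ this hm]
      nlinarith
  refine ⟨?_, hb⟩
  by_cases hl : l = a
  · subst hl
    simp only [form]
    rw [abs_of_pos (by positivity), one_div, inv_mul_cancel₀ h0.ne', le_div_iff₀ hm]
    linarith
  · refine le_trans ?_ (hb hl)
    exact mul_le_of_le_one_right (abs_nonneg _) h1.le

theorem hasDerivAt_sqrt_one_sub {x : ℝ} (hx : x ∈ Set.Ioo (0 : ℝ) 1) :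
    HasDerivAt (fun y => √(1 - y)) (-(1 / (2 * √(1 - x)))) x := by
  have h1 : HasDerivAt (fun y : ℝ => 1 - y) (-1) x := by
    simpa using (hasDerivAt_id x).const_sub 1
  have h2 := h1.sqrt (by linarith [hx.2])
  refine h2.congr_deriv ?_
  ring

theorem H_bound (w : List Ltr) (hw : good w = true) (hne : w ≠ []) {x : ℝ}
    (hx : x ∈ Set.Ioo (0 : ℝ) 1) : |H w x| ≤ 4 ^ w.length * (x / √(1 - x)) := by
  induction w generalizing x with
  | nil => exact absurd rfl hne
  | cons l w ih =>
    set D : ℝ := 2 * 4 ^ w.length with hD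
    have hDpos : 0 < D := by positivity
    have hder : ∀ y ∈ Set.Ioo (0 : ℝ) 1, |form l y * H w y| ≤ D * (1 / ((1 - y) * √(1 - y))) := by
      intro y hy
      have hm : 0 < 1 - y := by linarith [hy.2]
      have hs : 0 < √(1 - y) := Real.sqrt_pos.2 hm
      have hs1 : √(1 - y) ≤ 1 := by
        exact Real.sqrt_le_iff.2 ⟨by norm_num, by linarith [hy.1]⟩
      obtain ⟨hb1, hb2⟩ := form_bound l hy
      rw [abs_mul]
      rcases w with _ | ⟨m, w⟩
      · have hl : l ≠ a := by simpa [good] using hw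
        rw [H_nil, abs_one, mul_one]
        refine (hb2 hl).trans ?_
        rw [hD]
        simp only [List.length_nil, pow_zero, mul_one]
        rw [div_eq_mul_one_div]
        gcongr
        exact mul_le_of_le_one_right hm.le hs1
      · have h1 := ih hw (by simp) hy
        have hlen : (0 : ℝ) < 4 ^ (m :: w).length := by positivity
        calc |form l y| * |H (m :: w) y|
            ≤ |form l y| * (4 ^ (m :: w).length * (y / √(1 - y))) :=
              mul_le_mul_of_nonneg_left h1 (abs_nonneg _)
          _ = (|form l y| * y) * (4 ^ (m :: w).length / √(1 - y)) := by ring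
          _ ≤ 2 / (1 - y) * (4 ^ (m :: w).length / √(1 - y)) :=
              mul_le_mul_of_nonneg_right hb1 (by positivity)
          _ = D * (1 / ((1 - y) * √(1 - y))) := by
              rw [hD]; field_simp
    have hg : ∀ y ∈ Set.Ioo (0 : ℝ) 1, HasDerivAt (fun y => 2 * D * ((√(1 - y))⁻¹ - 1))
        (D * (1 / ((1 - y) * √(1 - y)))) y := by
      intro y hy
      have hm : 0 < 1 - y := by linarith [hy.2]
      have hs : 0 < √(1 - y) := Real.sqrt_pos.2 hm
      have h := (((hasDerivAt_sqrt_one_sub hy).inv hs.ne').sub_const 1).const_mul (2 * D)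
      refine h.congr_deriv ?_
      rw [Real.sq_sqrt hm.le]
      field_simp
    have hg0 : Tendsto (fun y => 2 * D * ((√(1 - y))⁻¹ - 1)) (𝓝[>] 0) (𝓝 0) := by
      have : ContinuousAt (fun y : ℝ => 2 * D * ((√(1 - y))⁻¹ - 1)) 0 := by
        refine ContinuousAt.mul continuousAt_const (ContinuousAt.sub (ContinuousAt.inv₀ ?_ (by simp)) continuousAt_const)
        fun_prop
      have h2 := this.tendsto
      simp only [sub_zero, Real.sqrt_one, inv_one, sub_self, mul_zero] at h2
      exact h2.mono_left nhdsWithin_le_nhds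
    have h := abs_le_of_deriv_le (fun y hy => hasDerivAt_H' hw hy) hg hder (tendsto_H_zero l w) hg0 hx
    refine h.trans ?_
    have hm : 0 < 1 - x := by linarith [hx.2]
    have hs : 0 < √(1 - x) := Real.sqrt_pos.2 hm
    have hs1 : √(1 - x) ≤ 1 := by
      exact Real.sqrt_le_iff.2 ⟨by norm_num, by linarith [hx.1]⟩
    have hsq := Real.sq_sqrt hm.le
    have e : 2 * D = 4 ^ (l :: w).length := by rw [hD, List.length_cons, pow_succ]; ring
    rw [e]
    refine mul_le_mul_of_nonneg_left ?_ (by positivity)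
    rw [le_div_iff₀ hs, sub_mul, inv_mul_cancel₀ hs.ne']
    nlinarith

/-- value at one -/
noncomputable def Z (w : List Ltr) : ℝ := limUnder (𝓝[<] (1 : ℝ)) (H w)

theorem tendsto_Z {w : List Ltr} (hw : conv w = true) : Tendsto (H w) (𝓝[<] 1) (𝓝 (Z w)) := by
  rcases w with _ | ⟨l, w⟩
  · simp [conv] at hw
  simp only [conv, Bool.and_eq_true, Bool.or_eq_true, decide_eq_true_eq] at hw
  obtain ⟨hl, hg⟩ := hw
  set C : ℝ := 4 ^ w.length with hC
  have hCpos : 0 < C := by positivity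
  have hder : ∀ y ∈ Set.Ioo (0 : ℝ) 1, |form l y * H w y| ≤ C * (1 / √(1 - y)) := by
    intro y hy
    have hm : 0 < 1 - y := by linarith [hy.2]
    have hs : 0 < √(1 - y) := Real.sqrt_pos.2 hm
    have hs1 : √(1 - y) ≤ 1 := by
      exact Real.sqrt_le_iff.2 ⟨by norm_num, by linarith [hy.1]⟩
    have h0 := hy.1
    rw [abs_mul]
    rcases w with _ | ⟨m, w⟩
    · have hla : l ≠ a := by simpa [good] using hg
      have hlc : l = c := by tauto
      subst hlc
      rw [H_nil, abs_one, mul_one, hC]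
      simp only [form, List.length_nil, pow_zero, one_mul]
      rw [abs_of_pos (by positivity)]
      gcongr
      linarith
    · have h1 := H_bound (m :: w) hg (by simp) hy
      have hf : |form l y| * y ≤ 1 := by
        rcases hl with rfl | rfl
        · simp only [form]; rw [abs_of_pos (by positivity)]; field_simp; norm_num
        · simp only [form]; rw [abs_of_pos (by positivity)]
          rw [one_div, inv_mul_le_iff₀ (by positivity)]; linarith
      calc |form l y| * |H (m :: w) y|
          ≤ |form l y| * (4 ^ (m :: w).length * (y / √(1 - y))) :=
            mul_le_mul_of_nonneg_left h1 (abs_nonneg _)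
        _ = (|form l y| * y) * (4 ^ (m :: w).length / √(1 - y)) := by ring
        _ ≤ 1 * (4 ^ (m :: w).length / √(1 - y)) :=
            mul_le_mul_of_nonneg_right hf (by positivity)
        _ = C * (1 / √(1 - y)) := by rw [hC]; ring
  have hg' : ∀ y ∈ Set.Ioo (0 : ℝ) 1, HasDerivAt (fun y => 2 * C * (1 - √(1 - y)))
      (C * (1 / √(1 - y))) y := by
    intro y hy
    have hm : 0 < 1 - y := by linarith [hy.2]
    have hs : 0 < √(1 - y) := Real.sqrt_pos.2 hm
    have h := ((hasDerivAt_sqrt_one_sub hy).const_sub 1).const_mul (2 * C)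
    refine h.congr_deriv ?_
    field_simp
  have hg0 : Tendsto (fun y => 2 * C * (1 - √(1 - y))) (𝓝[>] 0) (𝓝 0) := by
    have : ContinuousAt (fun y : ℝ => 2 * C * (1 - √(1 - y))) 0 := by fun_prop
    have h2 := this.tendsto
    simp only [sub_zero, Real.sqrt_one, sub_self, mul_zero] at h2
    exact h2.mono_left nhdsWithin_le_nhds
  have hbd : ∀ y ∈ Set.Ioo (0 : ℝ) 1, |H (l :: w) y| ≤ 2 * C := by
    intro y hy
    refine (abs_le_of_deriv_le (fun y hy => hasDerivAt_H' hg hy) hg' hder (tendsto_H_zero l w) hg0 hy).trans ?_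
    have := Real.sqrt_nonneg (1 - y)
    nlinarith
  have hd : ∀ z ∈ Set.Ioo (0 : ℝ) 1, HasDerivAt (fun z => H (l :: w) z + 2 * C * (1 - √(1 - z)))
      (form l z * H w z + C * (1 / √(1 - z))) z :=
    fun z hz => (hasDerivAt_H' hg hz).add (hg' z hz)
  have hmono : MonotoneOn (fun z => H (l :: w) z + 2 * C * (1 - √(1 - z))) (Set.Ioo (0 : ℝ) 1) := by
    refine monotoneOn_of_deriv_nonneg (convex_Ioo 0 1) ?_ ?_ ?_
    · intro z hz; exact (hd z hz).continuousAt.continuousWithinAt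
    · rw [interior_Ioo]; intro z hz; exact (hd z hz).differentiableAt.differentiableWithinAt
    · rw [interior_Ioo]; intro z hz; rw [(hd z hz).deriv]; linarith [(abs_le.1 (hder z hz)).1]
  have hlim := hmono.tendsto_nhdsWithin_Ioo_left (Set.nonempty_Ioo.2 one_pos) (by
    refine ⟨4 * C, ?_⟩
    rintro _ ⟨y, hy, rfl⟩
    have h1 := (abs_le.1 (hbd y hy)).2
    have := Real.sqrt_nonneg (1 - y)
    simp only
    nlinarith)
  have hlim2 : Tendsto (fun y => 2 * C * (1 - √(1 - y))) (𝓝[<] (1 : ℝ)) (𝓝 (2 * C * (1 - √(1 - 1)))) := by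
    have : ContinuousAt (fun y : ℝ => 2 * C * (1 - √(1 - y))) 1 := by fun_prop
    exact this.tendsto.mono_left nhdsWithin_le_nhds
  have h3 := hlim.sub hlim2
  refine tendsto_nhds_limUnder ⟨_, h3.congr ?_⟩
  intro y; ring

theorem Ioo_mem_left : Set.Ioo (0 : ℝ) 1 ∈ 𝓝[<] (1 : ℝ) := Ioo_mem_nhdsLT (by norm_num)

theorem Ioo_mem_right : Set.Ioo (0 : ℝ) 1 ∈ 𝓝[>] (0 : ℝ) := Ioo_mem_nhdsGT (by norm_num)

theorem Z_eq {w : List Ltr} (hw : conv w = true) {y : ℝ} (h : Tendsto (H w) (𝓝[<] 1) (𝓝 y)) :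
    Z w = y := tendsto_nhds_unique (tendsto_Z hw) h

theorem good_of_conv {w : List Ltr} (hw : conv w = true) : good w = true := by
  rcases w with _ | ⟨l, w⟩
  · rfl
  · simp only [conv, Bool.and_eq_true] at hw
    exact hw.2

theorem Z_shuffle (u v : List Ltr) (hu : conv u = true) (hv : conv v = true)
    (hs : ∀ w ∈ sh u v, conv w = true) :
    Z u * Z v = ((sh u v).map Z).sum := by
  have h1 := (tendsto_Z hu).mul (tendsto_Z hv)
  have h2 : ∀ ws : List (List Ltr), (∀ w ∈ ws, conv w = true) →
      Tendsto (fun x => (ws.map fun w => H w x).sum) (𝓝[<] 1) (𝓝 ((ws.map Z).sum)) := by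
    intro ws hws
    induction ws with
    | nil => simp
    | cons w ws ih =>
      have := (tendsto_Z (hws w (by simp))).add (ih (fun w' hw' => hws w' (by simp [hw'])))
      simpa using this
  refine tendsto_nhds_unique h1 ((h2 _ hs).congr' ?_)
  filter_upwards [Ioo_mem_left] with x hx
  exact (H_shuffle u v (good_of_conv hu) (good_of_conv hv) hx).symm

end Apery
namespace Apery

open Ltr Filter Topology

/-- Linear combinations of words. -/
abbrev LC := List (ℤ × List Ltr)

/-- Evaluation of a linear combination as a function. -/
noncomputable def evH (L : LC) (x : ℝ) : ℝ := (L.map fun p => (p.1 : ℝ) * H p.2 x).sum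

/-- Evaluation of a linear combination at one. -/
noncomputable def evZ (L : LC) : ℝ := (L.map fun p => (p.1 : ℝ) * Z p.2).sum

theorem evH_cons (p : ℤ × List Ltr) (M : LC) (x : ℝ) :
    evH (p :: M) x = p.1 * H p.2 x + evH M x := by
  simp [evH]

theorem tendsto_evZ (L : LC) (h : ∀ p ∈ L, conv p.2 = true) :
    Tendsto (evH L) (𝓝[<] 1) (𝓝 (evZ L)) := by
  induction L with
  | nil =>
    have e : evH [] = fun _ => 0 := by funext y; simp [evH]
    rw [e]; simp [evZ]
  | cons p L ih =>
    have := ((tendsto_Z (h p (by simp))).const_mul (p.1 : ℝ)).add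
      (ih (fun w' hw' => h w' (by simp [hw'])))
    have e : evH (p :: L) = fun y => (p.1 : ℝ) * H p.2 y + evH L y := by funext y; exact evH_cons p L y
    rw [e]; simpa [evZ] using this

/-- Prepend a letter combination to a linear combination. -/
def pre (f : List (ℤ × Ltr)) (L : LC) : LC :=
  f.flatMap fun p => L.map fun q => (p.1 * q.1, p.2 :: q.2)

/-- Letterwise substitution in a word. -/
def subst (φ : Ltr → List (ℤ × Ltr)) : List Ltr → LC
  | [] => [(1, [])]
  | l :: w => pre (φ l) (subst φ w)

/-- Evaluate combination of forms. -/
noncomputable def evF (f : List (ℤ × Ltr)) (x : ℝ) : ℝ := (f.map fun p => (p.1 : ℝ) * form p.2 x).sum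

theorem evH_append (L M : LC) (x : ℝ) : evH (L ++ M) x = evH L x + evH M x := by
  simp [evH]

theorem hasDerivAt_pre (f : List (ℤ × Ltr)) (L : LC)
    (h : ∀ p ∈ f, ∀ q ∈ L, good (p.2 :: q.2) = true) {x : ℝ} (hx : x ∈ Set.Ioo (0 : ℝ) 1) :
    HasDerivAt (evH (pre f L)) (evF f x * evH L x) x := by
  induction f with
  | nil => 
    have : evH (pre [] L) = fun _ => 0 := by funext y; simp [pre, evH]
    rw [this]
    simpa [evF] using hasDerivAt_const x (0 : ℝ)
  | cons p f ih =>
    have ih' := ih (fun p' hp' => h p' (by simp [hp']))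
    have h1 : ∀ M : LC, (∀ q ∈ M, good (p.2 :: q.2) = true) →
        HasDerivAt (evH (M.map fun q => (p.1 * q.1, p.2 :: q.2))) ((p.1 * form p.2 x) * evH M x) x := by
      intro M hM
      induction M with
      | nil =>
        have : evH (([] : LC).map fun q => (p.1 * q.1, p.2 :: q.2)) = fun _ => 0 := by
          funext y; simp [evH]
        rw [this]
        simpa [evH] using hasDerivAt_const x (0 : ℝ)
      | cons q M ihM =>
        have e : evH ((q :: M).map fun q => (p.1 * q.1, p.2 :: q.2)) = fun y =>
            ((p.1 * q.1 : ℤ) : ℝ) * H (p.2 :: q.2) y + evH (M.map fun q => (p.1 * q.1, p.2 :: q.2)) y := by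
          funext y; simp [evH]
        rw [e]
        refine (((hasDerivAt_H' (hM q (by simp)) hx).const_mul _).add
          (ihM (fun q' hq' => hM q' (by simp [hq'])))).congr_deriv ?_
        rw [evH_cons]; push_cast; ring
    have e : evH (pre (p :: f) L) = fun y =>
        evH (L.map fun q => (p.1 * q.1, p.2 :: q.2)) y + evH (pre f L) y := by
      funext y; simp [pre, evH]
    rw [e]
    refine ((h1 L (h p (by simp))).add ih').congr_deriv ?_
    simp [evF]; ring

theorem tendsto_evH_zero (L : LC) (h : ∀ p ∈ L, p.2 ≠ []) :
    Tendsto (evH L) (𝓝[>] 0) (𝓝 0) := by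
  induction L with
  | nil =>
    have e : evH [] = fun _ => 0 := by funext y; simp [evH]
    rw [e]; simp
  | cons p L ih =>
    have ih' := ih (fun p' hp' => h p' (by simp [hp']))
    have hp := h p (by simp)
    obtain ⟨k, w⟩ := p
    rcases w with _ | ⟨l, w⟩
    · exact absurd rfl hp
    have := ((tendsto_H_zero l w).const_mul (k : ℝ)).add ih'
    have e : evH ((k, l :: w) :: L) = fun y => (k : ℝ) * H (l :: w) y + evH L y := by
      funext y; exact evH_cons _ L y
    rw [e]; simpa using this

theorem pre_ne (f : List (ℤ × Ltr)) (L : LC) : ∀ p ∈ pre f L, p.2 ≠ [] := by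
  intro p hp
  simp only [pre, List.mem_flatMap, List.mem_map] at hp
  obtain ⟨_, _, _, _, rfl⟩ := hp
  simp

theorem subst_good {φ : Ltr → List (ℤ × Ltr)} (hφ : ∀ l, l ≠ a → ∀ p ∈ φ l, p.2 ≠ a)
    (w : List Ltr) (hw : good w = true) : ∀ p ∈ subst φ w, good p.2 = true ∧ (p.2 = [] → w = []) := by
  induction w with
  | nil => intro p hp; simp only [subst, List.mem_singleton] at hp; subst hp; simp [good]
  | cons l w ih =>
    intro p hp
    simp only [subst, pre, List.mem_flatMap, List.mem_map] at hp
    obtain ⟨q, hq, r, hr, rfl⟩ := hp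
    refine ⟨?_, by simp⟩
    obtain ⟨h1, h2⟩ := ih (good_tail hw) r hr
    rcases w with _ | ⟨m, w⟩
    · simp only [subst, List.mem_singleton] at hr
      subst hr
      have hl : l ≠ a := by simpa [good] using hw
      simpa [good] using hφ l hl q hq
    · refine good_cons_of_ne h1 ?_
      intro h; simpa using h2 h

/-- The substitution theorem. -/
theorem H_subst {φ : Ltr → List (ℤ × Ltr)} (hφ : ∀ l, l ≠ a → ∀ p ∈ φ l, p.2 ≠ a)
    {g g' : ℝ → ℝ} (hg : ∀ x ∈ Set.Ioo (0 : ℝ) 1, HasDerivAt g (g' x) x)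
    (hmaps : ∀ x ∈ Set.Ioo (0 : ℝ) 1, g x ∈ Set.Ioo (0 : ℝ) 1)
    (hg0 : Tendsto g (𝓝[>] 0) (𝓝 0)) (w : List Ltr) (hw : good w = true)
    (hf : ∀ l ∈ w, ∀ x ∈ Set.Ioo (0 : ℝ) 1, form l (g x) * g' x = evF (φ l) x)
    {x : ℝ} (hx : x ∈ Set.Ioo (0 : ℝ) 1) : H w (g x) = evH (subst φ w) x := by
  induction w generalizing x with
  | nil => simp [subst, evH, H_nil]
  | cons l w ih =>
    have hg0' : Tendsto g (𝓝[>] 0) (𝓝[>] 0) := by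
      refine tendsto_nhdsWithin_iff.2 ⟨hg0, ?_⟩
      filter_upwards [Ioo_mem_right] with x hx using (hmaps x hx).1
    have ih' : ∀ x ∈ Set.Ioo (0 : ℝ) 1, H w (g x) = evH (subst φ w) x := fun x hx =>
      ih (good_tail hw) (fun l' hl' => hf l' (by simp [hl'])) hx
    refine eq_of_deriv (f := fun x => H (l :: w) (g x)) (g := evH (subst φ (l :: w)))
      (d := fun x => evF (φ l) x * evH (subst φ w) x) ?_ ?_ (y := 0) ?_ ?_ hx
    · intro y hy
      have h1 := (hasDerivAt_H' hw (hmaps y hy)).comp y (hg y hy)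
      refine h1.congr_deriv ?_
      rw [← hf l (by simp) y hy, ← ih' y hy]; ring
    · intro y hy
      refine hasDerivAt_pre _ _ ?_ hy
      intro p hp q hq
      have := (subst_good hφ (l :: w) hw (p.1 * q.1, p.2 :: q.2) ?_).1
      · exact this
      · simp only [subst, pre, List.mem_flatMap, List.mem_map]
        exact ⟨p, hp, q, hq, rfl⟩
    · exact (tendsto_H_zero l w).comp hg0'
    · exact tendsto_evH_zero _ (pre_ne _ _)

theorem Z_subst {φ : Ltr → List (ℤ × Ltr)} (hφ : ∀ l, l ≠ a → ∀ p ∈ φ l, p.2 ≠ a)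
    {g g' : ℝ → ℝ} (hg : ∀ x ∈ Set.Ioo (0 : ℝ) 1, HasDerivAt g (g' x) x)
    (hmaps : ∀ x ∈ Set.Ioo (0 : ℝ) 1, g x ∈ Set.Ioo (0 : ℝ) 1)
    (hg0 : Tendsto g (𝓝[>] 0) (𝓝 0)) (hg1 : Tendsto g (𝓝[<] 1) (𝓝 1))
    (w : List Ltr) (hw : conv w = true)
    (hf : ∀ l ∈ w, ∀ x ∈ Set.Ioo (0 : ℝ) 1, form l (g x) * g' x = evF (φ l) x)
    (hc : ∀ p ∈ subst φ w, conv p.2 = true) : Z w = evZ (subst φ w) := by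
  have hg1' : Tendsto g (𝓝[<] 1) (𝓝[<] 1) := by
    refine tendsto_nhdsWithin_iff.2 ⟨hg1, ?_⟩
    filter_upwards [Ioo_mem_left] with x hx using (hmaps x hx).2
  refine tendsto_nhds_unique ((tendsto_Z hw).comp hg1') ((tendsto_evZ _ hc).congr' ?_)
  filter_upwards [Ioo_mem_left] with x hx
  exact (H_subst hφ hg hmaps hg0 w (good_of_conv hw) hf hx).symm

/-- identity substitution, expressing `b` as `B - c` -/
def φid : Ltr → List (ℤ × Ltr)
  | a => [(1, a)]
  | b => [(1, B), (-1, c)]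
  | c => [(1, c)]
  | B => [(1, B)]

/-- substitution `x ↦ x^2`  -/
def φsq : Ltr → List (ℤ × Ltr)
  | a => [(2, a)]
  | b => [(1, B), (-2, c)]
  | _ => []

/-- substitution `x ↦ x/(1+x)`  -/
def φhalf : Ltr → List (ℤ × Ltr)
  | a => [(1, a), (-1, c)]
  | b => [(1, c)]
  | _ => []

/-- substitution `x ↦ 4 x/(1+x)^2`  -/
def φap : Ltr → List (ℤ × Ltr)
  | a => [(1, a), (-2, c)]
  | b => [(2, B)]
  | _ => []

theorem sub_ne {x : ℝ} (hx : x ∈ Set.Ioo (0 : ℝ) 1) : 1 - x ≠ 0 ∧ 1 + x ≠ 0 ∧ 1 - x ^ 2 ≠ 0 ∧ x ≠ 0 := by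
  obtain ⟨h0, h1⟩ := hx
  refine ⟨by linarith, by linarith, by nlinarith, h0.ne'⟩

theorem H_id (w : List Ltr) (hw : good w = true) {x : ℝ} (hx : x ∈ Set.Ioo (0 : ℝ) 1) :
    H w x = evH (subst φid w) x := by
  refine H_subst (φ := φid) (g := fun x => x) (g' := fun _ => 1) ?_ (fun x _ => hasDerivAt_id x)
    (fun x hx => hx) (tendsto_id.mono_left nhdsWithin_le_nhds) w hw ?_ hx
  · intro l hl; cases l <;> simp_all [φid]
  · intro l _ x hx
    obtain ⟨h1, h2, h3, h4⟩ := sub_ne hx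
    cases l <;> simp [φid, evF, form]
    have : 1 - x ^ 2 = (1 - x) * (1 + x) := by ring
    rw [this]; field_simp; ring

theorem Z_id (w : List Ltr) (hw : conv w = true) (hc : ∀ p ∈ subst φid w, conv p.2 = true) :
    Z w = evZ (subst φid w) := by
  refine tendsto_nhds_unique (tendsto_Z hw) ((tendsto_evZ _ hc).congr' ?_)
  filter_upwards [Ioo_mem_left] with x hx
  exact (H_id w (good_of_conv hw) hx).symm

/-- letters `a`, `b` only -/
def isab (w : List Ltr) : Bool := w.all fun l => decide (l = a) || decide (l = b)

theorem Z_sq (w : List Ltr) (hw : conv w = true) (hab : isab w = true)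
    (hc : ∀ p ∈ subst φsq w, conv p.2 = true) :
    Z w = evZ (subst φsq w) := by
  refine Z_subst (φ := φsq) (g := fun x => x ^ 2) (g' := fun x => 2 * x) ?_ ?_ ?_ ?_ ?_ w hw ?_ hc
  · intro l hl; cases l <;> simp_all [φsq]
  · intro x _; simpa using hasDerivAt_pow 2 x
  · intro x hx; exact ⟨by nlinarith [hx.1], by nlinarith [hx.1, hx.2]⟩
  · have : ContinuousAt (fun x : ℝ => x ^ 2) 0 := by fun_prop
    simpa using this.tendsto.mono_left nhdsWithin_le_nhds
  · have : ContinuousAt (fun x : ℝ => x ^ 2) 1 := by fun_prop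
    simpa using this.tendsto.mono_left nhdsWithin_le_nhds
  · intro l hl x hx
    obtain ⟨h1, h2, h3, h4⟩ := sub_ne hx
    have hl' := List.all_eq_true.1 hab l hl
    cases l
    · simp [φsq, evF, form]; field_simp
    · simp [φsq, evF, form]
      have : 1 - x ^ 2 = (1 - x) * (1 + x) := by ring
      rw [this]; field_simp; ring
    · simp at hl'
    · simp at hl'

theorem H_half (w : List Ltr) (hw : good w = true) (hab : isab w = true)
    {x : ℝ} (hx : x ∈ Set.Ioo (0 : ℝ) 1) : H w (x / (1 + x)) = evH (subst φhalf w) x := by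
  refine H_subst (φ := φhalf) (g := fun x => x / (1 + x)) (g' := fun x => 1 / (1 + x) ^ 2)
    ?_ ?_ ?_ ?_ w hw ?_ hx
  · intro l hl; cases l <;> simp_all [φhalf]
  · intro x hx
    obtain ⟨h1, h2, h3, h4⟩ := sub_ne hx
    refine ((hasDerivAt_id x).div ((hasDerivAt_id x).const_add 1) h2).congr_deriv ?_
    simp
  · intro x hx
    have := hx.1
    refine ⟨by positivity, ?_⟩
    rw [div_lt_one (by positivity)]; linarith
  · have : ContinuousAt (fun x : ℝ => x / (1 + x)) 0 := by
      refine ContinuousAt.div (by fun_prop) (by fun_prop) (by norm_num)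
    simpa using this.tendsto.mono_left nhdsWithin_le_nhds
  · intro l hl x hx
    obtain ⟨h1, h2, h3, h4⟩ := sub_ne hx
    have hl' := List.all_eq_true.1 hab l hl
    cases l
    · simp [φhalf, evF, form]; field_simp; ring
    · simp [φhalf, evF, form]
      have : 1 - x / (1 + x) = 1 / (1 + x) := by field_simp; ring
      rw [this]; field_simp
    · simp at hl'
    · simp at hl'

noncomputable def gap (x : ℝ) : ℝ := 4 * x / (1 + x) ^ 2

theorem gap_mem {x : ℝ} (hx : x ∈ Set.Ioo (0 : ℝ) 1) : gap x ∈ Set.Ioo (0 : ℝ) 1 := by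
  have := hx.1
  unfold gap
  refine ⟨by positivity, ?_⟩
  rw [div_lt_one (by positivity)]
  nlinarith [hx.2, mul_pos (sub_pos.2 hx.2) (sub_pos.2 hx.2)]

theorem hasDerivAt_gap {x : ℝ} (hx : x ∈ Set.Ioo (0 : ℝ) 1) :
    HasDerivAt gap (4 * (1 - x) / (1 + x) ^ 3) x := by
  obtain ⟨h1, h2, h3, h4⟩ := sub_ne hx
  have h := ((hasDerivAt_id x).const_mul 4).div (((hasDerivAt_id x).const_add 1).pow 2) (pow_ne_zero 2 h2)
  refine h.congr_deriv ?_
  simp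
  field_simp
  ring

theorem tendsto_gap_zero : Tendsto gap (𝓝[>] 0) (𝓝 0) := by
  have : ContinuousAt gap 0 := by
    unfold gap
    refine ContinuousAt.div (by fun_prop) (by fun_prop) (by norm_num)
  simpa [gap] using this.tendsto.mono_left nhdsWithin_le_nhds

theorem H_ap (w : List Ltr) (hw : good w = true) (hab : isab w = true)
    {x : ℝ} (hx : x ∈ Set.Ioo (0 : ℝ) 1) : H w (gap x) = evH (subst φap w) x := by
  refine H_subst (φ := φap) (g := gap) (g' := fun x => 4 * (1 - x) / (1 + x) ^ 3)
    ?_ (fun x hx => hasDerivAt_gap hx) (fun x hx => gap_mem hx) tendsto_gap_zero w hw ?_ hx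
  · intro l hl; cases l <;> simp_all [φap]
  · intro l hl x hx
    obtain ⟨h1, h2, h3, h4⟩ := sub_ne hx
    have hl' := List.all_eq_true.1 hab l hl
    cases l
    · simp [φap, evF, form, gap]; field_simp; ring
    · simp [φap, evF, form, gap]
      have e : 1 - x ^ 2 = (1 - x) * (1 + x) := by ring
      have : 1 - 4 * x / (1 + x) ^ 2 = (1 - x) ^ 2 / (1 + x) ^ 2 := by field_simp; ring
      rw [this, e]; field_simp; norm_num
    · simp at hl'
    · simp at hl'

end Apery
namespace Apery

open Ltr Filter Topology

/-- the duality involution -/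
noncomputable def sg (x : ℝ) : ℝ := (1 - x) / (1 + x)

theorem sg_mem {x : ℝ} (hx : x ∈ Set.Ioo (0 : ℝ) 1) : sg x ∈ Set.Ioo (0 : ℝ) 1 := by
  obtain ⟨h0, h1⟩ := hx
  have : 0 < 1 - x := by linarith
  unfold sg
  refine ⟨by positivity, ?_⟩
  rw [div_lt_one (by positivity)]; linarith

theorem sg_sg {x : ℝ} (hx : x ∈ Set.Ioo (0 : ℝ) 1) : sg (sg x) = x := by
  obtain ⟨h1, h2, h3, h4⟩ := sub_ne hx
  have h5 : (1 + x) + (1 - x) ≠ 0 := by ring_nf; norm_num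
  have h6 : 1 + (1 - x) / (1 + x) ≠ 0 := by
    have : 1 + (1 - x) / (1 + x) = 2 / (1 + x) := by field_simp; ring
    rw [this]; positivity
  unfold sg
  rw [div_eq_iff h6]
  field_simp
  ring

theorem hasDerivAt_sg {x : ℝ} (hx : x ∈ Set.Ioo (0 : ℝ) 1) :
    HasDerivAt sg (-2 / (1 + x) ^ 2) x := by
  obtain ⟨h1, h2, h3, h4⟩ := sub_ne hx
  refine (((hasDerivAt_id x).const_sub 1).div ((hasDerivAt_id x).const_add 1) h2).congr_deriv ?_
  simp
  ring

theorem tendsto_sg_zero : Tendsto sg (𝓝[>] 0) (𝓝[<] 1) := by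
  refine tendsto_nhdsWithin_iff.2 ⟨?_, ?_⟩
  · have : ContinuousAt sg 0 := by
      unfold sg
      refine ContinuousAt.div (by fun_prop) (by fun_prop) (by norm_num)
    simpa [sg] using this.tendsto.mono_left nhdsWithin_le_nhds
  · filter_upwards [Ioo_mem_right] with x hx using (sg_mem hx).2

/-- dual letter -/
def dl : Ltr → Ltr
  | a => B
  | B => a
  | c => c
  | b => b

theorem form_sg {l : Ltr} (hl : l ≠ b) {x : ℝ} (hx : x ∈ Set.Ioo (0 : ℝ) 1) :
    form (dl l) (sg x) * (-2 / (1 + x) ^ 2) = - form l x := by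
  obtain ⟨h1, h2, h3, h4⟩ := sub_ne hx
  have e : 1 - x ^ 2 = (1 - x) * (1 + x) := by ring
  cases l
  · simp only [dl, form, sg]
    have : 1 - ((1 - x) / (1 + x)) ^ 2 = 4 * x / (1 + x) ^ 2 := by field_simp; ring
    rw [this]; field_simp; norm_num
  · exact absurd rfl hl
  · simp only [dl, form, sg]
    have : 1 + (1 - x) / (1 + x) = 2 / (1 + x) := by field_simp; ring
    rw [this]; field_simp
  · simp only [dl, form, sg]
    rw [e]; field_simp

theorem hasDerivAt_H_sg {l : Ltr} (hl : l ≠ b) {u : List Ltr} (hu : good (dl l :: u) = true) {x : ℝ}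
    (hx : x ∈ Set.Ioo (0 : ℝ) 1) :
    HasDerivAt (fun y => H (dl l :: u) (sg y)) (-(form l x * H u (sg x))) x := by
  refine ((hasDerivAt_H' hu (sg_mem hx)).comp x (hasDerivAt_sg hx)).congr_deriv ?_
  rw [mul_assoc, mul_comm (H u (sg x)), ← mul_assoc, form_sg hl hx]
  ring

/-- path composition function -/
noncomputable def T (u : List Ltr) : List Ltr → ℝ → ℝ
  | [], x => H u (sg x)
  | l :: v, x => H u (sg x) * H (l :: v) x + T (dl l :: u) v x

theorem good_dl {l : Ltr} {u : List Ltr} (hu : good u = true) (h : u ≠ [] ∨ l ≠ B) (hlb : l ≠ b) :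
    good (dl l :: u) = true := by
  rcases u with _ | ⟨m, u⟩
  · have : l ≠ B := by simpa using h
    cases l <;> simp_all [good, dl]
  · exact hu

theorem hasDerivAt_T (v : List Ltr) (u : List Ltr) (hu : good u = true) (hv : good v = true)
    (huv : u ≠ [] ∨ v.head? ≠ some B) (hb : ∀ l ∈ v, l ≠ b) {x d : ℝ}
    (hx : x ∈ Set.Ioo (0 : ℝ) 1) (hd : HasDerivAt (fun y => H u (sg y)) d x) :
    HasDerivAt (T u v) (d * H v x) x := by
  induction v generalizing u d with
  | nil =>
    have : T u [] = fun y => H u (sg y) := by funext y; rfl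
    rw [this, H_nil, mul_one]; exact hd
  | cons l v ih =>
    have e : T u (l :: v) = fun x => H u (sg x) * H (l :: v) x + T (dl l :: u) v x := by
      funext y; rfl
    have hlb := hb l (by simp)
    have hg : good (dl l :: u) = true := good_dl hu (by simpa using huv) hlb
    have h1 := ih (dl l :: u) hg (good_tail hv) (by simp) (fun l' hl' => hb l' (by simp [hl']))
      (hasDerivAt_H_sg hlb hg hx)
    rw [e]
    refine ((hd.mul (hasDerivAt_H' hv hx)).add h1).congr_deriv ?_
    ring

theorem tendsto_term {u v : List Ltr} (hu : good u = true) (hne : u ≠ []) (hv : good v = true) :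
    Tendsto (fun x => H u (sg x) * H v x) (𝓝[<] 1) (𝓝 0) := by
  set C : ℝ := 4 ^ u.length * 4 ^ v.length with hC
  have hlim : Tendsto (fun x => C * 2 * √(1 - x)) (𝓝[<] (1 : ℝ)) (𝓝 0) := by
    have : ContinuousAt (fun x : ℝ => C * 2 * √(1 - x)) 1 := by fun_prop
    simpa using this.tendsto.mono_left nhdsWithin_le_nhds
  refine squeeze_zero_norm' ?_ hlim
  have : Set.Ioo (1 / 2 : ℝ) 1 ∈ 𝓝[<] (1 : ℝ) := Ioo_mem_nhdsLT (by norm_num)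
  filter_upwards [this] with x hx
  have hx' : x ∈ Set.Ioo (0 : ℝ) 1 := ⟨by linarith [hx.1], hx.2⟩
  have hm : 0 < 1 - x := by linarith [hx.2]
  have hp : 0 < 1 + x := by linarith [hx.1]
  have hs : 0 < √(1 - x) := Real.sqrt_pos.2 hm
  have hs1 : √(1 - x) ≤ 1 := Real.sqrt_le_iff.2 ⟨by norm_num, by linarith [hx'.1]⟩
  have hss := Real.mul_self_sqrt hm.le
  have b1 := H_bound u hu hne (sg_mem hx')
  have b2 : |H v x| ≤ 4 ^ v.length * (1 / √(1 - x)) := by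
    rcases v with _ | ⟨l, v⟩
    · rw [H_nil]; simp; exact (one_le_inv₀ hs).2 hs1
    · refine (H_bound _ hv (by simp) hx').trans ?_
      gcongr
      exact hx.2.le
  have hs2 : 1 / 2 ≤ √(1 - sg x) := by
    refine Real.le_sqrt_of_sq_le ?_
    have : 1 - sg x = 2 * x / (1 + x) := by unfold sg; field_simp; ring
    rw [this, le_div_iff₀ hp]
    linarith [hx.1]
  have hsg : sg x ≤ 1 - x := by
    unfold sg; rw [div_le_iff₀ hp]; nlinarith [hx.1]
  have hsg0 := (sg_mem hx').1
  have b3 : sg x / √(1 - sg x) ≤ 2 * (1 - x) := by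
    rw [div_le_iff₀ (by linarith)]
    nlinarith
  rw [Real.norm_eq_abs, abs_mul]
  calc |H u (sg x)| * |H v x| ≤ (4 ^ u.length * (2 * (1 - x))) * (4 ^ v.length * (1 / √(1 - x))) := by
        refine mul_le_mul (b1.trans ?_) b2 (abs_nonneg _) (by positivity)
        gcongr
    _ = C * 2 * √(1 - x) := by
        rw [hC]
        field_simp
        nlinarith

theorem tendsto_term_zero {u v : List Ltr} (hu : good u = true) (hne : v ≠ []) (hv : good v = true) :
    Tendsto (fun x => H u (sg x) * H v x) (𝓝[>] 0) (𝓝 0) := by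
  refine ((tendsto_term hv hne hu).comp tendsto_sg_zero).congr' ?_
  filter_upwards [Ioo_mem_right] with x hx
  simp only [Function.comp, sg_sg hx]
  ring

/-- reversal with dual letters -/
def dualAux (u : List Ltr) : List Ltr → List Ltr
  | [] => u
  | l :: v => dualAux (dl l :: u) v

/-- dual word -/
def dual (w : List Ltr) : List Ltr := dualAux [] w

theorem tendsto_T_one (v u : List Ltr) (hu : good u = true) (hne : u ≠ []) (hv : good v = true)
    (hb : ∀ l ∈ v, l ≠ b) : Tendsto (T u v) (𝓝[<] 1) (𝓝 0) := by
  induction v generalizing u with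
  | nil =>
    refine (tendsto_term hu hne (v := []) rfl).congr ?_
    intro x; rw [H_nil, mul_one]; rfl
  | cons l v ih =>
    have h1 := tendsto_term hu hne hv
    have h2 := ih (dl l :: u) (good_dl hu (Or.inl hne) (hb l (by simp))) (by simp) (good_tail hv)
      (fun l' hl' => hb l' (by simp [hl']))
    have := h1.add h2
    rw [zero_add] at this
    exact this

theorem tendsto_T_zero (v u : List Ltr) (hu : good u = true) (hv : good v = true)
    (huv : u ≠ [] ∨ v.head? ≠ some B)
    (hb : ∀ l ∈ v, l ≠ b) (hc : conv (dualAux u v) = true) :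
    Tendsto (T u v) (𝓝[>] 0) (𝓝 (Z (dualAux u v))) := by
  induction v generalizing u with
  | nil =>
    exact (tendsto_Z hc).comp tendsto_sg_zero
  | cons l v ih =>
    have h1 := tendsto_term_zero hu (by simp) hv
    have h2 := ih (dl l :: u) (good_dl hu (by simpa using huv) (hb l (by simp))) (good_tail hv) (by simp)
      (fun l' hl' => hb l' (by simp [hl'])) hc
    have := h1.add h2
    rw [zero_add] at this
    exact this

/-- no letter `b` -/
def nob (w : List Ltr) : Bool := w.all fun l => decide (l ≠ b)

theorem Z_dual (w : List Ltr) (hw : conv w = true) (hb : nob w = true) (hc : conv (dual w) = true) :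
    Z (dual w) = Z w := by
  have hb' : ∀ l ∈ w, l ≠ b := by
    intro l hl
    have := List.all_eq_true.1 hb l hl
    simpa using this
  have hg := good_of_conv hw
  rcases w with _ | ⟨l, w⟩
  · simp [conv] at hw
  have hlB : l ≠ B := by
    rintro rfl; simp [conv] at hw
  have hd : ∀ x ∈ Set.Ioo (0 : ℝ) 1, HasDerivAt (T [] (l :: w)) 0 x := by
    intro x hx
    have h0 : HasDerivAt (fun y => H [] (sg y)) 0 x := by
      simp only [H_nil]; exact hasDerivAt_const x 1
    refine (hasDerivAt_T (l :: w) [] rfl hg (Or.inr (by simpa using hlB)) hb' hx h0).congr_deriv ?_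
    ring
  have hconst : ∀ z ∈ Set.Ioo (0 : ℝ) 1, T [] (l :: w) z = T [] (l :: w) (1 / 2) := by
    intro z hz
    refine isOpen_Ioo.is_const_of_deriv_eq_zero (convex_Ioo (0 : ℝ) 1).isPreconnected
      (f := T [] (l :: w)) ?_ ?_ hz (by norm_num)
    · intro z hz; exact (hd z hz).differentiableAt.differentiableWithinAt
    · intro z hz; exact (hd z hz).deriv
  have hl0 := tendsto_T_zero (l :: w) [] rfl hg (Or.inr (by simpa using hlB)) hb' hc
  have hl1 : Tendsto (T [] (l :: w)) (𝓝[<] 1) (𝓝 (Z (l :: w))) := by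
    have h2 := tendsto_T_one w [dl l] (good_dl rfl (Or.inr hlB) (hb' l (by simp))) (by simp) (good_tail hg)
      (fun l' hl' => hb' l' (by simp [hl']))
    have := (tendsto_Z hw).add h2
    rw [add_zero] at this
    refine this.congr ?_
    intro x; simp [T, H_nil]
  have e0 : Z (dual (l :: w)) = T [] (l :: w) (1 / 2) := by
    refine tendsto_nhds_unique hl0 (tendsto_const_nhds.congr' ?_)
    filter_upwards [Ioo_mem_right] with x hx using (hconst x hx).symm
  have e1 : Z (l :: w) = T [] (l :: w) (1 / 2) := by
    refine tendsto_nhds_unique hl1 (tendsto_const_nhds.congr' ?_)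
    filter_upwards [Ioo_mem_left] with x hx using (hconst x hx).symm
  rw [e0, e1]

end Apery
namespace Apery

open Ltr Filter Topology

/-- sign of a Boolean -/
def zs (e : Bool) : ℤ := if e then -1 else 1

/-- Index lists: the entry `(k, e)` stands for exponent `k+1` and sign `zs e`. -/
abbrev Idx := List (ℕ × Bool)

/-- Terms of the nested sums. -/
noncomputable def tc : Idx → ℕ → ℝ
  | [], n => if n = 0 then 1 else 0
  | p :: v, n => (zs p.2 : ℝ) ^ n / (n : ℝ) ^ (p.1 + 1) * ∑ m ∈ Finset.range n, tc v m

/-- Partial sums. -/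
noncomputable def PS (v : Idx) (N : ℕ) : ℝ := ∑ m ∈ Finset.range N, tc v m

theorem tc_cons (p : ℕ × Bool) (v : Idx) (n : ℕ) :
    tc (p :: v) n = (zs p.2 : ℝ) ^ n / (n : ℝ) ^ (p.1 + 1) * PS v n := rfl

theorem PS_succ (v : Idx) (n : ℕ) : PS v (n + 1) = PS v n + tc v n := by
  unfold PS; rw [Finset.sum_range_succ]

theorem PS_zero (v : Idx) : PS v 0 = 0 := by simp [PS]

theorem PS_nil (n : ℕ) : PS [] (n + 1) = 1 := by
  induction n with
  | zero => rw [PS_succ, PS_zero]; simp [tc]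
  | succ n ih => rw [PS_succ, ih]; simp [tc]

/-- letter attached to a sign -/
def yl (e : Bool) : Ltr := if e then c else b

/-- The word of an index list. -/
def word (η : Bool) : Idx → List Ltr
  | [] => []
  | p :: v => List.replicate p.1 a ++ (yl (xor η p.2) :: word (xor η p.2) v)

/-- The sign of an index list. -/
def sgn (η : Bool) : Idx → ℤ
  | [] => 1
  | p :: v => zs (xor η p.2) * sgn (xor η p.2) v

theorem coef_replicate (k : ℕ) (w : List Ltr) (n : ℕ) :
    coef (List.replicate k a ++ w) n = coef w n / (n : ℝ) ^ k := by
  induction k with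
  | zero => simp
  | succ k ih =>
    rw [List.replicate_succ, List.cons_append, coef]
    simp only [kap, tay, mul_zero, Finset.sum_const_zero, add_zero, one_mul, ih]
    rw [pow_succ, div_div]

theorem zs_xor (e f : Bool) : (zs (xor e f) : ℝ) = zs e * zs f := by
  cases e <;> cases f <;> simp [zs]

theorem kap_yl (e : Bool) : kap (yl e) = 0 := by cases e <;> simp [yl, kap]

theorem tay_yl (e : Bool) (j : ℕ) : tay (yl e) j = (zs e : ℝ) ^ j := by
  cases e <;> simp [yl, tay, zs]

theorem coef_word (v : Idx) (η : Bool) (n : ℕ) :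
    (sgn η v : ℝ) * coef (word η v) n = (zs η : ℝ) ^ n * tc v n := by
  induction v generalizing η n with
  | nil =>
    simp only [sgn, word, coef, tc]
    split_ifs with h
    · subst h; simp
    · simp
  | cons p v ih =>
    simp only [sgn, word]
    rw [coef_replicate, coef, kap_yl, zero_mul, zero_add, tc_cons]
    set z := xor η p.2 with hz
    have key : ((zs z : ℝ) * sgn z v) * ∑ m ∈ Finset.range n, coef (word z v) m * tay (yl z) (n - 1 - m)
        = (zs z : ℝ) ^ n * PS v n := by
      unfold PS
      rw [Finset.mul_sum, Finset.mul_sum]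
      refine Finset.sum_congr rfl ?_
      intro m hm
      have hm' := Finset.mem_range.1 hm
      rw [tay_yl]
      have e : (zs z : ℝ) ^ n = (zs z : ℝ) ^ m * (zs z : ℝ) ^ (n - 1 - m) * zs z := by
        rw [← pow_add, ← pow_succ]; congr 1; omega
      calc (zs z : ℝ) * sgn z v * (coef (word z v) m * (zs z : ℝ) ^ (n - 1 - m))
          = (sgn z v * coef (word z v) m) * ((zs z : ℝ) ^ (n - 1 - m) * zs z) := by ring
        _ = (zs z : ℝ) ^ n * tc v m := by
            rw [ih, e]
            have h2 : ((zs z : ℝ) ^ m) * (zs z : ℝ) ^ m = 1 := by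
              rw [← mul_pow]
              cases z <;> simp [zs]
            ring
    push_cast
    rw [div_div, mul_div_assoc', key]
    have e2 : (zs z : ℝ) ^ n = (zs η : ℝ) ^ n * (zs p.2 : ℝ) ^ n := by rw [hz, zs_xor, mul_pow]
    rw [e2, pow_succ]
    ring

theorem sgn_sq (v : Idx) (η : Bool) : (sgn η v : ℝ) * sgn η v = 1 := by
  induction v generalizing η with
  | nil => simp [sgn]
  | cons p v ih =>
    simp only [sgn]
    push_cast
    have h := ih (xor η p.2)
    have h2 : (zs (xor η p.2) : ℝ) * zs (xor η p.2) = 1 := by cases (xor η p.2) <;> simp [zs]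
    calc (zs (xor η p.2) : ℝ) * sgn (xor η p.2) v * (zs (xor η p.2) * sgn (xor η p.2) v)
        = ((zs (xor η p.2) : ℝ) * zs (xor η p.2)) * (sgn (xor η p.2) v * sgn (xor η p.2) v) := by ring
      _ = 1 := by rw [h, h2, one_mul]

theorem Z_of_partial {w : List Ltr} {L : ℝ}
    (h : Tendsto (fun n => ∑ i ∈ Finset.range n, coef w i) atTop (𝓝 L)) : Z w = L :=
  (Real.tendsto_tsum_powerSeries_nhdsWithin_lt h).limUnder_eq

theorem Z_word {v : Idx} {L : ℝ} (h : Tendsto (PS v) atTop (𝓝 L)) :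
    (sgn false v : ℝ) * Z (word false v) = L := by
  have h2 : Tendsto (fun n => ∑ i ∈ Finset.range n, coef (word false v) i) atTop
      (𝓝 ((sgn false v : ℝ) * L)) := by
    refine (h.const_mul _).congr ?_
    intro n
    unfold PS
    rw [Finset.mul_sum]
    refine Finset.sum_congr rfl ?_
    intro i _
    have h3 := coef_word v false i
    have h4 := sgn_sq v false
    have e : tc v i = (sgn false v : ℝ) * coef (word false v) i := by rw [h3]; simp [zs]
    rw [e, ← mul_assoc, h4, one_mul]
  rw [Z_of_partial h2, ← mul_assoc, sgn_sq, one_mul]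

/-- quasi-shuffle of an index list with the alternating index `(1,-)`  -/
def ins : Idx → List Idx
  | [] => [[(0, true)]]
  | p :: v => ((0, true) :: p :: v) :: ((p.1 + 1, !p.2) :: v) :: (ins v).map (fun t => p :: t)

theorem sum_tc_cons (p : ℕ × Bool) (ts : List Idx) (n : ℕ) :
    (ts.map fun t => tc (p :: t) n).sum =
      (zs p.2 : ℝ) ^ n / (n : ℝ) ^ (p.1 + 1) * (ts.map fun t => PS t n).sum := by
  rw [← List.sum_map_mul_left]
  rfl

theorem sum_PS_succ (ts : List Idx) (n : ℕ) :
    (ts.map fun t => PS t (n + 1)).sum = (ts.map fun t => PS t n).sum + (ts.map fun t => tc t n).sum := by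
  induction ts with
  | nil => simp
  | cons t ts ih => rw [List.map_cons, List.sum_cons, ih, PS_succ]; simp only [List.map_cons, List.sum_cons]; ring

theorem sum_PS_zero (ts : List Idx) : (ts.map fun t => PS t 0).sum = 0 := by
  induction ts with
  | nil => simp
  | cons t ts ih => rw [List.map_cons, List.sum_cons, ih, PS_zero, zero_add]

theorem ins_identity (v : Idx) (N : ℕ) :
    PS [(0, true)] N * PS v N = ((ins v).map fun t => PS t N).sum := by
  induction v generalizing N with
  | nil =>
    rcases N with _ | N
    · simp [PS_zero, ins]
    · rw [PS_nil]; simp [ins]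
  | cons p v ih =>
    induction N with
    | zero => rw [sum_PS_zero, PS_zero, zero_mul]
    | succ N ihN =>
      rw [sum_PS_succ, ← ihN, PS_succ, PS_succ]
      simp only [ins, List.map_cons, List.sum_cons, List.map_map, Function.comp_def]
      rw [sum_tc_cons, ← ih N]
      rcases N with _ | N
      · simp [PS_zero, tc]
      have hN : ((N + 1 : ℕ) : ℝ) ≠ 0 := by positivity
      simp only [tc_cons, PS_nil]
      have hz : (zs (!p.2) : ℝ) = - zs p.2 := by cases p.2 <;> simp [zs]
      have hz2 : (zs true : ℝ) = -1 := by simp [zs]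
      rw [hz, hz2, neg_pow (zs p.2 : ℝ)]
      field_simp
      ring

theorem abs_PS_le (v : Idx) (n : ℕ) : |PS v n| ≤ 4 ^ v.length * √n := by
  induction v generalizing n with
  | nil =>
    rcases n with _ | n
    · simp [PS_zero]
    · rw [PS_nil]; simp
  | cons p v ih =>
    induction n with
    | zero => simp [PS_zero]
    | succ n ihn =>
      rw [PS_succ]
      refine (abs_add_le _ _).trans ?_
      rcases n with _ | n
      · simp [PS_zero, tc]
      set m : ℕ := n + 1 with hm
      have hm0 : (1 : ℝ) ≤ m := by rw [hm]; push_cast; linarith [Nat.cast_nonneg (α := ℝ) n]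
      have hs : 1 ≤ √(m : ℝ) := Real.one_le_sqrt.2 hm0
      have hss := Real.mul_self_sqrt (show (0 : ℝ) ≤ m by linarith)
      have h1 : |tc (p :: v) m| ≤ 4 ^ v.length * (1 / √(m : ℝ)) := by
        rw [tc_cons, abs_mul, abs_div, abs_pow, abs_of_nonneg (show (0 : ℝ) ≤ (m : ℝ) ^ (p.1 + 1) by positivity)]
        have hz : |(zs p.2 : ℝ)| = 1 := by cases p.2 <;> simp [zs]
        rw [hz, one_pow]
        calc 1 / (m : ℝ) ^ (p.1 + 1) * |PS v m| ≤ 1 / (m : ℝ) * (4 ^ v.length * √m) := by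
              refine mul_le_mul ?_ (ih m) (abs_nonneg _) (by positivity)
              refine one_div_le_one_div_of_le (by linarith) ?_
              rw [pow_succ]
              have := one_le_pow₀ hm0 (n := p.1)
              nlinarith
          _ = 4 ^ v.length * (1 / √(m : ℝ)) := by
              field_simp
              nlinarith
      have hs2 : √((m + 1 : ℕ) : ℝ) * √((m + 1 : ℕ) : ℝ) = m + 1 := by
        rw [Real.mul_self_sqrt (by positivity)]; push_cast; ring
      have hs0 : 0 ≤ √((m + 1 : ℕ) : ℝ) := Real.sqrt_nonneg _
      set A := √(m : ℝ)
      set D := √((m + 1 : ℕ) : ℝ)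
      have h3 : 1 / A ≤ 4 * (D - A) := by
        have hA : 0 < A := by linarith
        rw [div_le_iff₀ hA]
        have hDA : D ≤ 2 * A := by nlinarith
        have hDA2 : A ≤ D := by nlinarith
        have : (D - A) * (D + A) = 1 := by nlinarith
        nlinarith
      rw [List.length_cons, pow_succ] at ihn ⊢
      have hP : (0 : ℝ) < 4 ^ v.length := by positivity
      nlinarith [mul_le_mul_of_nonneg_left h3 hP.le]

theorem summable_tc (k : ℕ) (e : Bool) (v : Idx) : Summable (tc ((k + 1, e) :: v)) := by
  have hs : Summable fun n : ℕ => 4 ^ v.length * (1 / (n : ℝ) ^ (3 / 2 : ℝ)) :=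
    (Real.summable_one_div_nat_rpow.2 (by norm_num)).mul_left _
  refine Summable.of_norm_bounded hs ?_
  intro n
  rcases n with _ | n
  · simp [tc]
  set m : ℕ := n + 1 with hm
  have hm0 : (1 : ℝ) ≤ m := by rw [hm]; push_cast; linarith [Nat.cast_nonneg (α := ℝ) n]
  rw [tc_cons, Real.norm_eq_abs, abs_mul, abs_div, abs_pow,
    abs_of_nonneg (show (0 : ℝ) ≤ (m : ℝ) ^ (k + 1 + 1) by positivity)]
  have hz : |(zs e : ℝ)| = 1 := by cases e <;> simp [zs]
  simp only [hz, one_pow]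
  calc 1 / (m : ℝ) ^ (k + 1 + 1) * |PS v m| ≤ 1 / (m : ℝ) ^ 2 * (4 ^ v.length * √m) := by
        refine mul_le_mul ?_ (abs_PS_le v m) (abs_nonneg _) (by positivity)
        refine one_div_le_one_div_of_le (by positivity) ?_
        exact pow_le_pow_right₀ hm0 (by omega)
    _ = 4 ^ v.length * (1 / (m : ℝ) ^ (3 / 2 : ℝ)) := by
        have hmp : (0 : ℝ) < m := by linarith
        have : (m : ℝ) ^ 2 = (m : ℝ) ^ (3 / 2 : ℝ) * √m := by
          rw [Real.sqrt_eq_rpow, ← Real.rpow_add hmp, ← Real.rpow_natCast]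
          norm_num
        rw [this]
        have h2 : √(m : ℝ) ≠ 0 := (Real.sqrt_pos.2 hmp).ne'
        have h3 : (m : ℝ) ^ (3 / 2 : ℝ) ≠ 0 := (Real.rpow_pos_of_pos hmp _).ne'
        field_simp

theorem tendsto_PS (k : ℕ) (e : Bool) (v : Idx) :
    Tendsto (PS ((k + 1, e) :: v)) atTop
      (𝓝 ((sgn false ((k + 1, e) :: v) : ℝ) * Z (word false ((k + 1, e) :: v)))) := by
  have h := (summable_tc k e v).hasSum.tendsto_sum_nat
  have h2 : Tendsto (PS ((k + 1, e) :: v)) atTop (𝓝 (∑' n, tc ((k + 1, e) :: v) n)) := h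
  rw [Z_word h2]
  exact h2

theorem tendsto_E : Tendsto (PS [(0, true)]) atTop (𝓝 (-Z [c])) := by
  obtain ⟨L, hL⟩ : ∃ L, Tendsto (PS [(0, true)]) atTop (𝓝 L) := by
    have hanti : Antitone fun n : ℕ => 1 / ((n : ℝ) + 1) := by
      intro m n hmn
      simp only
      gcongr
    obtain ⟨l, hl⟩ := hanti.tendsto_alternating_series_of_tendsto_zero tendsto_one_div_add_atTop_nhds_zero_nat
    refine ⟨-l, ?_⟩
    rw [← tendsto_add_atTop_iff_nat 1]
    refine hl.neg.congr ?_
    intro n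
    induction n with
    | zero => simp [PS_succ, PS_zero, tc]
    | succ n ih =>
      rw [PS_succ, ← ih, Finset.sum_range_succ, tc_cons, PS_nil]
      simp only [zs, if_true]
      push_cast
      rw [pow_succ]; ring
  have := Z_word hL
  simp [sgn, word, zs, yl] at this
  rw [this]; exact hL

/-- The value of a list of index lists. -/
noncomputable def evI (ts : List Idx) : ℝ :=
  (ts.map fun t => (sgn false t : ℝ) * Z (word false t)).sum

theorem Z_stuffle (k : ℕ) (e : Bool) (v : Idx) :
    -Z [c] * ((sgn false ((k + 1, e) :: v) : ℝ) * Z (word false ((k + 1, e) :: v))) =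
      evI (ins ((k + 1, e) :: v)) := by
  have hP := tendsto_E.mul (tendsto_PS k e v)
  have hrest : ∀ ts : List Idx,
      Tendsto (fun N => ((ts.map (fun t => (k + 1, e) :: t)).map fun t => PS t N).sum) atTop
        (𝓝 (evI (ts.map (fun t => (k + 1, e) :: t)))) := by
    intro ts
    induction ts with
    | nil => simp [evI]
    | cons t ts ih =>
      have := (tendsto_PS k e t).add ih
      simpa [evI] using this
  have h2 := tendsto_PS (k + 1) (!e) v
  have h3 := hrest (ins v)
  have hhead : Tendsto (PS ((0, true) :: (k + 1, e) :: v)) atTop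
      (𝓝 (-Z [c] * ((sgn false ((k + 1, e) :: v) : ℝ) * Z (word false ((k + 1, e) :: v)))
        - (sgn false ((k + 1 + 1, !e) :: v) : ℝ) * Z (word false ((k + 1 + 1, !e) :: v))
        - evI ((ins v).map (fun t => (k + 1, e) :: t)))) := by
    refine ((hP.sub h2).sub h3).congr ?_
    intro N
    rw [ins_identity]
    simp only [ins, List.map_cons, List.sum_cons]
    ring
  have h4 := Z_word hhead
  have e1 : evI (ins ((k + 1, e) :: v)) =
      (sgn false ((0, true) :: (k + 1, e) :: v) : ℝ) * Z (word false ((0, true) :: (k + 1, e) :: v)) +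
      ((sgn false ((k + 1 + 1, !e) :: v) : ℝ) * Z (word false ((k + 1 + 1, !e) :: v)) +
      evI ((ins v).map (fun t => (k + 1, e) :: t))) := by
    simp only [evI, ins, List.map_cons, List.sum_cons]
  rw [e1, h4]
  ring

end Apery
namespace Apery

open Ltr Filter Topology

theorem tc_single (k : ℕ) (n : ℕ) : tc [(k, false)] (n + 1) = 1 / ((n : ℝ) + 1) ^ (k + 1) := by
  rw [tc_cons, PS_nil]; simp [zs]

theorem tc_single_zero (k : ℕ) : tc [(k, false)] 0 = 0 := by
  rw [tc_cons, PS_zero, mul_zero]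

theorem zetaVal_eq (k : ℕ) : zetaVal (k + 2) = Z (List.replicate (k + 1) a ++ [b]) := by
  have hs := summable_tc k false []
  have h := hs.hasSum.tendsto_sum_nat
  have h2 := Z_word (v := [(k + 1, false)]) h
  simp [sgn, word, zs, yl] at h2
  rw [hs.tsum_eq_zero_add, tc_single_zero, zero_add] at h2
  simp only [tc_single] at h2
  rw [h2]; rfl

theorem coef_single (k n : ℕ) : coef (List.replicate k a ++ [b]) n = tc [(k, false)] n := by
  have := coef_word [(k, false)] false n
  simpa [sgn, word, zs, yl] using this

theorem polyLog_eq : polyLog 5 (1 / 2) = evZ (subst φhalf [a, a, a, a, b]) := by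
  have h1 : polyLog 5 (1 / 2) = H [a, a, a, a, b] (1 / 2) := by
    have hs := hasSum_H [a, a, a, a, b] (x := 1 / 2) (by rw [abs_of_pos] <;> norm_num)
    have e := hs.summable.tsum_eq_zero_add
    rw [coef_cons_zero, zero_mul, zero_add] at e
    unfold H polyLog
    rw [e]
    refine tsum_congr ?_
    intro n
    have := coef_single 4 (n + 1)
    rw [tc_single] at this
    have e2 : List.replicate 4 a ++ [b] = [a, a, a, a, b] := rfl
    rw [e2] at this
    rw [this]; ring
  rw [h1]
  have hlim : Tendsto (fun y : ℝ => y / (1 + y)) (𝓝[<] 1) (𝓝 (1 / 2)) := by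
    have : ContinuousAt (fun x : ℝ => x / (1 + x)) 1 := by
      refine ContinuousAt.div (by fun_prop) (by fun_prop) (by norm_num)
    have h := this.tendsto.mono_left (nhdsWithin_le_nhds (s := Set.Iio 1))
    have e : (1 : ℝ) / (1 + 1) = 1 / 2 := by norm_num
    rwa [e] at h
  have h2 := (continuousAt_H [a, a, a, a, b] (x := 1 / 2) (by rw [abs_of_pos] <;> norm_num)).tendsto.comp hlim
  refine tendsto_nhds_unique h2 ((tendsto_evZ _ (by decide)).congr' ?_)
  filter_upwards [Ioo_mem_left] with x hx
  exact (H_half _ (by decide) (by decide) hx).symm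

theorem log_two_eq : Real.log 2 = Z [c] := by
  have h : ∀ x ∈ Set.Ioo (0 : ℝ) 1, H [c] x = Real.log (1 + x) := by
    intro x hx
    refine eq_of_deriv (f := H [c]) (g := fun x => Real.log (1 + x)) (d := fun x => 1 / (1 + x))
      ?_ ?_ (tendsto_H_zero c []) ?_ hx
    · intro y hy
      refine (hasDerivAt_H' (l := c) (w := []) rfl hy).congr_deriv ?_
      rw [H_nil, mul_one]; rfl
    · intro y hy
      have := ((hasDerivAt_id y).const_add 1).log (sub_ne hy).2.1
      exact this
    · have : ContinuousAt (fun x : ℝ => Real.log (1 + x)) 0 :=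
        ContinuousAt.log (by fun_prop) (by norm_num)
      simpa using this.tendsto.mono_left nhdsWithin_le_nhds
  have hc : ContinuousAt (fun x : ℝ => Real.log (1 + x)) 1 :=
    ContinuousAt.log (by fun_prop) (by norm_num)
  have h1 := hc.tendsto.mono_left (nhdsWithin_le_nhds (s := Set.Iio 1))
  have e : (1 : ℝ) + 1 = 2 := by norm_num
  rw [e] at h1
  refine tendsto_nhds_unique h1 ((tendsto_Z (w := [c]) rfl).congr' ?_)
  filter_upwards [Ioo_mem_left] with x hx using h x hx

theorem zeta_four_eq : 5 * Z [a, a, a, b] = 2 * (Z [a, b] * Z [a, b]) := by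
  have h2 := zetaVal_eq 0
  have h4 := zetaVal_eq 2
  have e2 : List.replicate (0 + 1) a ++ [b] = [a, b] := rfl
  have e4 : List.replicate (2 + 1) a ++ [b] = [a, a, a, b] := rfl
  rw [e2] at h2
  rw [e4] at h4
  rw [← h2, ← h4]
  have z2 : zetaVal (0 + 2) = Real.pi ^ 2 / 6 := by
    have h := hasSum_zeta_two
    rw [← h.tsum_eq, h.summable.tsum_eq_zero_add]
    unfold zetaVal
    simp
  have z4 : zetaVal (2 + 2) = Real.pi ^ 4 / 90 := by
    have h := hasSum_zeta_four
    rw [← h.tsum_eq, h.summable.tsum_eq_zero_add]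
    unfold zetaVal
    simp
  rw [z2, z4]; ring

/-- harmonic numbers -/
noncomputable def hn (n : ℕ) : ℝ := genHarmonic n 1

theorem hn_zero : hn 0 = 0 := by simp [hn, genHarmonic]

theorem hn_succ (n : ℕ) : hn (n + 1) = hn n + 1 / ((n : ℝ) + 1) := by
  simp [hn, genHarmonic, Finset.sum_range_succ]

theorem hn_nonneg (n : ℕ) : 0 ≤ hn n := by
  unfold hn genHarmonic
  exact Finset.sum_nonneg fun i _ => by positivity

theorem coef_b (w : List Ltr) (n : ℕ) :
    coef (b :: w) (n + 1) = (∑ m ∈ Finset.range (n + 1), coef w m) / ((n : ℝ) + 1) := by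
  simp [coef, kap, tay]

theorem coef_a (w : List Ltr) (n : ℕ) :
    coef (a :: w) (n + 1) = coef w (n + 1) / ((n : ℝ) + 1) := by
  simp [coef, kap, tay]

theorem coef_b1 (n : ℕ) : coef [b] (n + 1) = 1 / ((n : ℝ) + 1) := by
  rw [coef_b]
  congr 1
  rw [Finset.sum_eq_single 0]
  · simp [coef]
  · intro m _ hm; simp [coef, hm]
  · simp

theorem sum_b (n : ℕ) : ∑ m ∈ Finset.range (n + 1), coef [b] m = hn n := by
  induction n with
  | zero => simp [coef_cons_zero, hn_zero]
  | succ n ih => rw [Finset.sum_range_succ, ih, coef_b1, hn_succ]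

theorem sum_2 (n : ℕ) :
    ∑ m ∈ Finset.range (n + 1), coef [a, b] m + 2 * ∑ m ∈ Finset.range (n + 1), coef [b, b] m = hn n ^ 2 := by
  induction n with
  | zero => simp [coef_cons_zero, hn_zero]
  | succ n ih =>
    rw [Finset.sum_range_succ _ (n + 1), Finset.sum_range_succ _ (n + 1), hn_succ, coef_a, coef_b1,
      coef_b, sum_b]
    have : (n : ℝ) + 1 ≠ 0 := by positivity
    have e : (hn n + 1 / ((n : ℝ) + 1)) ^ 2 = hn n ^ 2 + 1 / ((n : ℝ) + 1) / ((n : ℝ) + 1)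
      + 2 * (hn n / ((n : ℝ) + 1)) := by field_simp; ring
    rw [e, ← ih]; ring

/-- coefficient of the cubic kernel -/
noncomputable def kc (n : ℕ) : ℝ :=
  coef [a, a, b] n + 3 * coef [a, b, b] n + 3 * coef [b, a, b] n + 6 * coef [b, b, b] n

theorem sum_3 (n : ℕ) : ∑ m ∈ Finset.range (n + 1), kc m = hn n ^ 3 := by
  induction n with
  | zero => simp [kc, coef_cons_zero, hn_zero]
  | succ n ih =>
    rw [Finset.sum_range_succ, ih, kc, coef_a, coef_a, coef_b1, coef_a, coef_b, sum_b, coef_b, coef_b, hn_succ]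
    have : (n : ℝ) + 1 ≠ 0 := by positivity
    have e := sum_2 n
    set x := ∑ m ∈ Finset.range (n + 1), coef [a, b] m
    set y := ∑ m ∈ Finset.range (n + 1), coef [b, b] m
    have hx : x = hn n ^ 2 - 2 * y := by linarith
    rw [hx]
    field_simp
    ring

/-- Taylor coefficients of the generating function -/
noncomputable def gc (n : ℕ) : ℝ := hn n ^ 3 / n

theorem gc_nonneg (n : ℕ) : 0 ≤ gc n := by
  have := hn_nonneg n
  unfold gc; positivity

/-- the generating function as a combination of words -/
def GG : LC := pre [(1, a), (1, b)] [(1, [a, a, b]), (3, [a, b, b]), (3, [b, a, b]), (6, [b, b, b])]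

theorem hasSum_GL {y : ℝ} (hy : |y| < 1) : HasSum (fun n => gc n * y ^ n) (evH GG y) := by
  have h := ((hasSum_H [a, a, a, b] hy).mul_left 1).add
    (((hasSum_H [a, a, b, b] hy).mul_left 3).add (((hasSum_H [a, b, a, b] hy).mul_left 3).add
    (((hasSum_H [a, b, b, b] hy).mul_left 6).add (((hasSum_H [b, a, a, b] hy).mul_left 1).add
    (((hasSum_H [b, a, b, b] hy).mul_left 3).add (((hasSum_H [b, b, a, b] hy).mul_left 3).add
    ((hasSum_H [b, b, b, b] hy).mul_left 6)))))))
  have e : evH GG y = 1 * H [a, a, a, b] y + (3 * H [a, a, b, b] y + (3 * H [a, b, a, b] y +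
      (6 * H [a, b, b, b] y + (1 * H [b, a, a, b] y + (3 * H [b, a, b, b] y +
      (3 * H [b, b, a, b] y + 6 * H [b, b, b, b] y)))))) := by
    simp [evH, GG, pre]
  rw [e]
  refine h.congr_fun ?_
  intro n
  rcases n with _ | n
  · simp [gc, coef_cons_zero]
  · have e2 : gc (n + 1) = (∑ m ∈ Finset.range (n + 1), kc m + kc (n + 1)) / ((n : ℝ) + 1) := by
      rw [← Finset.sum_range_succ, sum_3, gc]; push_cast; rfl
    rw [e2]
    simp only [kc, Finset.sum_add_distrib, ← Finset.mul_sum, coef_a, coef_b]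
    ring

/-- the primitives of powers of `gap` -/
noncomputable def Ph : ℕ → ℝ → ℝ
  | 0, t => 4 * t / (1 + t)
  | k + 1, t => (((k : ℝ) + 1) * Ph k t - gap t ^ (k + 1) * ((1 - t) / (1 + t))) / ((k : ℝ) + 3 / 2)

theorem hasDerivAt_Ph (k : ℕ) {t : ℝ} (ht : t ∈ Set.Ioo (0 : ℝ) 1) :
    HasDerivAt (Ph k) (gap t ^ (k + 1) / t) t := by
  obtain ⟨h1, h2, h3, h4⟩ := sub_ne ht
  induction k with
  | zero =>
    have e : Ph 0 = fun t => 4 * t / (1 + t) := by funext t; rfl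
    rw [e]
    refine (((hasDerivAt_id t).const_mul 4).div ((hasDerivAt_id t).const_add 1) h2).congr_deriv ?_
    simp [gap]
    field_simp
    ring
  | succ k ih =>
    have e : Ph (k + 1) = fun t =>
      (((k : ℝ) + 1) * Ph k t - gap t ^ (k + 1) * ((1 - t) / (1 + t))) / ((k : ℝ) + 3 / 2) := by
      funext t; rfl
    rw [e]
    have hq : HasDerivAt (fun t : ℝ => (1 - t) / (1 + t)) (-2 / (1 + t) ^ 2) t := hasDerivAt_sg ht
    have hp := (hasDerivAt_gap ht).pow (k + 1)
    have hk : (k : ℝ) + 3 / 2 ≠ 0 := by positivity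
    refine (((ih.const_mul ((k : ℝ) + 1)).sub (hp.mul hq)).div_const ((k : ℝ) + 3 / 2)).congr_deriv ?_
    rw [div_eq_iff hk]
    simp only [Nat.add_sub_cancel, Pi.pow_apply]
    push_cast
    have hg : 4 * (1 - t) / (1 + t) ^ 3 = gap t * ((1 - t) / (t * (1 + t))) := by
      unfold gap; field_simp
    rw [hg]
    have e3 : gap t ^ (k + 1 + 1) = gap t ^ (k + 1) * (4 * t / (1 + t) ^ 2) := by
      rw [pow_succ]; rfl
    rw [e3]
    have e4 : gap t ^ (k + 1) = gap t ^ k * gap t := pow_succ _ _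
    rw [e4]
    set G := gap t ^ k
    set g := gap t
    field_simp
    ring

theorem Ph_zero (k : ℕ) : ContinuousAt (Ph k) 0 ∧ Ph k 0 = 0 := by
  have hg : ContinuousAt gap 0 := by
    unfold gap
    refine ContinuousAt.div (by fun_prop) (by fun_prop) (by norm_num)
  induction k with
  | zero =>
    constructor
    · have : ContinuousAt (fun t : ℝ => 4 * t / (1 + t)) 0 := ContinuousAt.div (by fun_prop) (by fun_prop) (by norm_num)
      exact this
    · simp [Ph]
  | succ k ih =>
    constructor
    · have hq : ContinuousAt (fun t : ℝ => (1 - t) / (1 + t)) 0 :=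
        ContinuousAt.div (by fun_prop) (by fun_prop) (by norm_num)
      have := ((ih.1.const_mul ((k : ℝ) + 1)).sub ((hg.pow (k + 1)).mul hq)).div_const ((k : ℝ) + 3 / 2)
      exact this
    · simp [Ph, ih.2, gap]

theorem Ph_one (k : ℕ) : ContinuousAt (Ph k) 1 ∧
    Ph k 1 = 4 ^ (k + 1) / (((k : ℝ) + 1) * (Nat.choose (2 * (k + 1)) (k + 1) : ℝ)) := by
  have hg : ContinuousAt gap 1 := by
    unfold gap
    refine ContinuousAt.div (by fun_prop) (by fun_prop) (by norm_num)
  induction k with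
  | zero =>
    constructor
    · have : ContinuousAt (fun t : ℝ => 4 * t / (1 + t)) 1 := ContinuousAt.div (by fun_prop) (by fun_prop) (by norm_num)
      exact this
    · simp [Ph]; norm_num
  | succ k ih =>
    constructor
    · have hq : ContinuousAt (fun t : ℝ => (1 - t) / (1 + t)) 1 :=
        ContinuousAt.div (by fun_prop) (by fun_prop) (by norm_num)
      have := ((ih.1.const_mul ((k : ℝ) + 1)).sub ((hg.pow (k + 1)).mul hq)).div_const ((k : ℝ) + 3 / 2)
      exact this
    · simp only [Ph, ih.2, sub_self, zero_div, mul_zero, sub_zero]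
      have hc := Nat.succ_mul_centralBinom_succ (k + 1)
      rw [Nat.centralBinom_eq_two_mul_choose, Nat.centralBinom_eq_two_mul_choose] at hc
      have hc' : ((k : ℝ) + 1 + 1) * (Nat.choose (2 * (k + 1 + 1)) (k + 1 + 1) : ℝ) =
          2 * (2 * ((k : ℝ) + 1) + 1) * (Nat.choose (2 * (k + 1)) (k + 1) : ℝ) := by
        exact_mod_cast hc
      push_cast
      rw [hc']
      have hpos : (0 : ℝ) < (Nat.choose (2 * (k + 1)) (k + 1) : ℝ) := by
        exact_mod_cast Nat.choose_pos (by omega)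
      have h3 : (k : ℝ) + 3 / 2 ≠ 0 := by positivity
      have h4 : 2 * ((k : ℝ) + 1) + 1 ≠ 0 := by positivity
      field_simp
      ring

theorem Ph_mono (k : ℕ) {t : ℝ} (ht : t ∈ Set.Ioo (0 : ℝ) 1) : 0 ≤ Ph k t ∧ Ph k t ≤ Ph k 1 := by
  have hmono : MonotoneOn (Ph k) (Set.Ioo (0 : ℝ) 1) := by
    refine monotoneOn_of_deriv_nonneg (convex_Ioo 0 1) ?_ ?_ ?_
    · intro z hz; exact (hasDerivAt_Ph k hz).continuousAt.continuousWithinAt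
    · rw [interior_Ioo]; intro z hz; exact (hasDerivAt_Ph k hz).differentiableAt.differentiableWithinAt
    · rw [interior_Ioo]; intro z hz; rw [(hasDerivAt_Ph k hz).deriv]
      have := (gap_mem hz).1
      have := hz.1
      positivity
  constructor
  · have h := (Ph_zero k).1.tendsto.mono_left (nhdsWithin_le_nhds (s := Set.Ioi 0))
    rw [(Ph_zero k).2] at h
    refine le_of_tendsto h ?_
    have : Set.Ioo (0 : ℝ) t ∈ 𝓝[>] (0 : ℝ) := Ioo_mem_nhdsGT ht.1
    filter_upwards [this] with z hz
    exact hmono ⟨hz.1, hz.2.trans ht.2⟩ ht hz.2.le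
  · have h := (Ph_one k).1.tendsto.mono_left (nhdsWithin_le_nhds (s := Set.Iio 1))
    refine ge_of_tendsto h ?_
    have : Set.Ioo t 1 ∈ 𝓝[<] (1 : ℝ) := Ioo_mem_nhdsLT ht.2
    filter_upwards [this] with z hz
    exact hmono ht ⟨ht.1.trans hz.1, hz.2⟩ hz.1.le

/-- substitution in a linear combination -/
def substL (φ : Ltr → List (ℤ × Ltr)) (L : LC) : LC :=
  L.flatMap fun p => (subst φ p.2).map fun q => (p.1 * q.1, q.2)

theorem evH_scale (k : ℤ) (L : LC) (x : ℝ) :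
    evH (L.map fun q => (k * q.1, q.2)) x = k * evH L x := by
  unfold evH
  rw [List.map_map, ← List.sum_map_mul_left]
  congr 1
  refine List.map_congr_left ?_
  intro q _
  simp [Function.comp]; ring

theorem evH_ap (L : LC) (h : ∀ p ∈ L, good p.2 = true ∧ isab p.2 = true) {x : ℝ}
    (hx : x ∈ Set.Ioo (0 : ℝ) 1) : evH L (gap x) = evH (substL φap L) x := by
  induction L with
  | nil => simp [evH, substL]
  | cons p L ih =>
    have h1 := h p (by simp)
    have e : substL φap (p :: L) = ((subst φap p.2).map fun q => (p.1 * q.1, q.2)) ++ substL φap L := by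
      simp [substL]
    rw [e, evH_append, evH_scale, evH_cons, ih (fun p' hp' => h p' (by simp [hp'])),
      H_ap p.2 h1.1 h1.2 hx]

/-- The words of the Apery-like series. -/
def SL : LC := pre [(1, a)] (substL φap GG)

theorem hasDerivAt_SL {t : ℝ} (ht : t ∈ Set.Ioo (0 : ℝ) 1) :
    HasDerivAt (evH SL) (1 / t * evH GG (gap t)) t := by
  rw [evH_ap GG (by decide) ht]
  refine (hasDerivAt_pre _ _ (by decide) ht).congr_deriv ?_
  simp [evF, form]

theorem tendsto_SL_zero : Tendsto (evH SL) (𝓝[>] 0) (𝓝 0) := tendsto_evH_zero _ (pre_ne _ _)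

theorem tendsto_SL_one : Tendsto (evH SL) (𝓝[<] 1) (𝓝 (evZ SL)) := tendsto_evZ _ (by decide)

theorem hasSum_GL_succ {y : ℝ} (hy : |y| < 1) :
    HasSum (fun k => gc (k + 1) * y ^ (k + 1)) (evH GG y) := by
  rw [hasSum_nat_add_iff (f := fun n => gc n * y ^ n) 1]
  simpa [gc] using hasSum_GL hy

theorem partial_le (N : ℕ) {t : ℝ} (ht : t ∈ Set.Ioo (0 : ℝ) 1) :
    ∑ k ∈ Finset.range N, gc (k + 1) * Ph k t ≤ evH SL t := by
  refine le_of_deriv_le (f := fun t => ∑ k ∈ Finset.range N, gc (k + 1) * Ph k t) (g := evH SL)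
    (f' := fun t => ∑ k ∈ Finset.range N, gc (k + 1) * (gap t ^ (k + 1) / t))
    ?_ (fun x hx => hasDerivAt_SL hx) ?_ ?_ tendsto_SL_zero ht
  · intro x hx
    exact HasDerivAt.fun_sum fun k _ => (hasDerivAt_Ph k hx).const_mul _
  · intro x hx
    have h := hasSum_GL_succ (abs_lt_of_mem (gap_mem hx))
    have h2 := sum_le_hasSum (Finset.range N) (fun k _ =>
      mul_nonneg (gc_nonneg (k + 1)) (pow_nonneg (gap_mem hx).1.le (k + 1))) h
    have hx0 := hx.1
    calc ∑ k ∈ Finset.range N, gc (k + 1) * (gap x ^ (k + 1) / x)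
        = 1 / x * ∑ k ∈ Finset.range N, gc (k + 1) * gap x ^ (k + 1) := by
          rw [Finset.mul_sum]
          refine Finset.sum_congr rfl ?_
          intro k _; ring
      _ ≤ 1 / x * evH GG (gap x) := mul_le_mul_of_nonneg_left h2 (by positivity)
  · have : ContinuousAt (fun t => ∑ k ∈ Finset.range N, gc (k + 1) * Ph k t) 0 :=
      tendsto_finsetSum _ fun k _ => (Ph_zero k).1.tendsto.const_mul _
    have h := this.tendsto.mono_left (nhdsWithin_le_nhds (s := Set.Ioi 0))
    simpa [(Ph_zero _).2] using h

theorem summable_Ph {t : ℝ} (ht : t ∈ Set.Ioo (0 : ℝ) 1) :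
    Summable (fun k => gc (k + 1) * Ph k t) ∧ ∑' k, gc (k + 1) * Ph k t ≤ evH SL t := by
  have hnn : ∀ k, 0 ≤ gc (k + 1) * Ph k t := fun k => mul_nonneg (gc_nonneg _) (Ph_mono k ht).1
  exact ⟨summable_of_sum_range_le hnn fun N => partial_le N ht,
    Real.tsum_le_of_sum_range_le hnn fun N => partial_le N ht⟩

theorem gap_mono {s r : ℝ} (hs : 0 < s) (hsr : s ≤ r) (hr : r < 1) : gap s ≤ gap r := by
  have hr0 : 0 < r := hs.trans_le hsr
  unfold gap
  rw [div_le_div_iff₀ (by positivity) (by positivity)]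
  nlinarith [mul_nonneg (sub_nonneg.2 hsr) (show 0 ≤ 1 - r * s by nlinarith)]

theorem SL_eq {t : ℝ} (ht : t ∈ Set.Ioo (0 : ℝ) 1) : ∑' k, gc (k + 1) * Ph k t = evH SL t := by
  refine eq_of_deriv (f := fun t => ∑' k, gc (k + 1) * Ph k t) (g := evH SL)
    (d := fun t => 1 / t * evH GG (gap t)) ?_ (fun x hx => hasDerivAt_SL hx) ?_ tendsto_SL_zero ht
  · intro x hx
    obtain ⟨r, hr1, hr2⟩ := exists_between hx.2
    have hr : r ∈ Set.Ioo (0 : ℝ) 1 := ⟨hx.1.trans hr1, hr2⟩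
    have hgr := (gap_mem hr).1
    have hu : Summable fun k : ℕ => gc (k + 1) * (4 * gap r ^ k) := by
      have := (hasSum_GL_succ (abs_lt_of_mem (gap_mem hr))).summable.mul_right (4 / gap r)
      refine this.congr ?_
      intro k
      rw [pow_succ]; field_simp
    have h := hasDerivAt_tsum_of_isPreconnected (𝕜 := ℝ) (g := fun k t => gc (k + 1) * Ph k t)
      (g' := fun k t => gc (k + 1) * (gap t ^ (k + 1) / t)) (t := Set.Ioo (0 : ℝ) r) hu isOpen_Ioo
      (convex_Ioo (0 : ℝ) r).isPreconnected (y₀ := x) (y := x) ?_ ?_ ⟨hx.1, hr1⟩ (summable_Ph hx).1 ⟨hx.1, hr1⟩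
    · refine h.congr_deriv ?_
      rw [← (hasSum_GL_succ (abs_lt_of_mem (gap_mem hx))).tsum_eq, ← tsum_mul_left]
      refine tsum_congr ?_
      intro k; ring
    · intro k y hy
      exact (hasDerivAt_Ph k ⟨hy.1, hy.2.trans hr2⟩).const_mul _
    · intro k y hy
      have hy' : y ∈ Set.Ioo (0 : ℝ) 1 := ⟨hy.1, hy.2.trans hr2⟩
      have hy0 := hy.1
      have hgy := (gap_mem hy').1
      have hg := gap_mono hy.1 hy.2.le hr2
      rw [Real.norm_eq_abs, abs_of_nonneg (mul_nonneg (gc_nonneg _) (by positivity))]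
      refine mul_le_mul_of_nonneg_left ?_ (gc_nonneg _)
      have h4 : gap y / y ≤ 4 := by
        unfold gap
        rw [div_div, div_le_iff₀ (by positivity)]
        have : 1 ≤ (1 + y) ^ 2 := by nlinarith
        nlinarith
      calc gap y ^ (k + 1) / y = gap y ^ k * (gap y / y) := by rw [pow_succ]; ring
        _ ≤ gap r ^ k * 4 := by
            refine mul_le_mul ?_ h4 (by positivity) (by positivity)
            exact pow_le_pow_left₀ hgy.le hg k
        _ = 4 * gap r ^ k := by ring
  · refine tendsto_of_tendsto_of_tendsto_of_le_of_le' tendsto_const_nhds tendsto_SL_zero ?_ ?_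
    · filter_upwards [Ioo_mem_right] with x hx
      exact tsum_nonneg fun k => mul_nonneg (gc_nonneg _) (Ph_mono k hx).1
    · filter_upwards [Ioo_mem_right] with x hx using (summable_Ph hx).2

theorem series_eq : ∑' k, gc (k + 1) * Ph k 1 = evZ SL := by
  have hnn1 : ∀ k, 0 ≤ Ph k 1 := by
    intro k
    have h := Ph_mono k (t := 1 / 2) (by norm_num)
    exact h.1.trans h.2
  have hnn : ∀ k, 0 ≤ gc (k + 1) * Ph k 1 := fun k => mul_nonneg (gc_nonneg _) (hnn1 k)
  have hle : ∀ N, ∑ k ∈ Finset.range N, gc (k + 1) * Ph k 1 ≤ evZ SL := by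
    intro N
    have : ContinuousAt (fun t => ∑ k ∈ Finset.range N, gc (k + 1) * Ph k t) 1 :=
      tendsto_finsetSum _ fun k _ => (Ph_one k).1.tendsto.const_mul _
    have h := this.tendsto.mono_left (nhdsWithin_le_nhds (s := Set.Iio 1))
    refine le_of_tendsto_of_tendsto h tendsto_SL_one ?_
    filter_upwards [Ioo_mem_left] with x hx using partial_le N hx
  have hsum := summable_of_sum_range_le hnn hle
  refine le_antisymm (Real.tsum_le_of_sum_range_le hnn hle) ?_
  refine le_of_tendsto tendsto_SL_one ?_
  filter_upwards [Ioo_mem_left] with x hx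
  rw [← SL_eq hx]
  exact (summable_Ph hx).1.tsum_le_tsum (fun k => mul_le_mul_of_nonneg_left (Ph_mono k hx).2 (gc_nonneg _)) hsum

theorem main_series : ∑' k : ℕ, (4 : ℝ) ^ (k + 1) * (genHarmonic (k + 1) 1) ^ 3 /
      ((k + 1 : ℝ) ^ 2 * (Nat.choose (2 * (k + 1)) (k + 1) : ℝ)) = evZ SL := by
  rw [← series_eq]
  refine tsum_congr ?_
  intro k
  rw [(Ph_one k).2, gc, hn]
  push_cast
  have h : (k : ℝ) + 1 ≠ 0 := by positivity
  have hpos : (Nat.choose (2 * (k + 1)) (k + 1) : ℝ) ≠ 0 := by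
    exact_mod_cast (Nat.choose_pos (by omega)).ne'
  field_simp

end Apery

open Ltr Filter Topology

namespace Apery

/-- Monomials in the values `Z w`. -/
abbrev Mono := List (List Ltr)

/-- Polynomials in the values `Z w`. -/
abbrev Poly := List (ℤ × Mono)

/-- value of a monomial -/
noncomputable def evM (m : Mono) : ℝ := (m.map Z).prod

/-- value of a polynomial -/
noncomputable def evP (P : Poly) : ℝ := (P.map fun p => (p.1 : ℝ) * evM p.2).sum

/-- scaling by a monomial with coefficient -/
def smul (k : ℤ) (m : Mono) (P : Poly) : Poly := P.map fun p => (k * p.1, m ++ p.2)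

/-- product -/
def pmul (P Q : Poly) : Poly := P.flatMap fun p => smul p.1 p.2 Q

/-- linear combinations of words as polynomials -/
def ofLC (L : LC) : Poly := L.map fun p => (p.1, [p.2])

theorem evM_append (m n : Mono) : evM (m ++ n) = evM m * evM n := by simp [evM]

theorem evP_append (P Q : Poly) : evP (P ++ Q) = evP P + evP Q := by simp [evP]

theorem evP_cons (p : ℤ × Mono) (Q : Poly) : evP (p :: Q) = p.1 * evM p.2 + evP Q := by simp [evP]

theorem evP_smul (k : ℤ) (m : Mono) (P : Poly) : evP (smul k m P) = k * evM m * evP P := by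
  induction P with
  | nil => simp [smul, evP]
  | cons p P ih =>
    have : smul k m (p :: P) = (k * p.1, m ++ p.2) :: smul k m P := rfl
    rw [this, evP_cons, evP_cons, ih, evM_append]; push_cast; ring

theorem evP_pmul (P Q : Poly) : evP (pmul P Q) = evP P * evP Q := by
  induction P with
  | nil => simp [pmul, evP]
  | cons p P ih =>
    have : pmul (p :: P) Q = smul p.1 p.2 Q ++ pmul P Q := rfl
    rw [this, evP_append, ih, evP_smul, evP_cons]; ring

theorem evP_ofLC (L : LC) : evP (ofLC L) = evZ L := by
  simp [evP, ofLC, evZ, evM, Function.comp_def]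

/-- all words converge -/
def convL (L : LC) : Bool := L.all fun p => conv p.2

theorem convL_iff {L : LC} (h : convL L = true) : ∀ p ∈ L, conv p.2 = true := List.all_eq_true.1 h

/-- signed combination of a list of index lists -/
def idxP (ts : List Idx) : Poly := ts.flatMap fun t => smul (sgn false t) [] (ofLC (subst φid (word false t)))

/-- validity for index lists -/
def idxV (ts : List Idx) : Bool := ts.all fun t => conv (word false t) && convL (subst φid (word false t))

theorem evP_idxP (ts : List Idx) (h : idxV ts = true) : evP (idxP ts) = evI ts := by
  induction ts with
  | nil => simp [idxP, evP, evI]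
  | cons t ts ih =>
    simp only [idxV, List.all_cons, Bool.and_eq_true] at h
    have e : idxP (t :: ts) = smul (sgn false t) [] (ofLC (subst φid (word false t))) ++ idxP ts := rfl
    rw [e, evP_append, ih h.2, evP_smul, evP_ofLC, ← Z_id _ h.1.1 (convL_iff h.1.2)]
    simp [evI, evM]

/-- The relations used. -/
inductive Rel
  | shf (u v : List Ltr)
  | dist (w : List Ltr)
  | stf (k : ℕ) (e : Bool) (v : Idx)
  | z4

/-- word in `a`, `b`, `c` expanded -/
def idW (w : List Ltr) : Poly := ofLC (subst φid w)

/-- polynomial of a relation -/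
def relP : Rel → Poly
  | .shf u v => (-1, [u, v]) :: (sh u v).map fun w => (1, [w])
  | .dist w => idW w ++ smul (-1) [] (ofLC (subst φsq w))
  | .stf k e v => idxP (ins ((k + 1, e) :: v)) ++ smul 1 [[c]] (idxP [(k + 1, e) :: v])
  | .z4 => smul 5 [] (idW [a, a, a, b]) ++ smul (-2) [] (pmul (idW [a, b]) (idW [a, b]))

/-- validity of a relation -/
def valid : Rel → Bool
  | .shf u v => conv u && conv v && (sh u v).all conv
  | .dist w => conv w && isab w && convL (subst φid w) && convL (subst φsq w)
  | .stf k e v => idxV (ins ((k + 1, e) :: v)) && idxV [(k + 1, e) :: v]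
  | .z4 => true

theorem evP_idW (w : List Ltr) (hw : conv w = true) (h : convL (subst φid w) = true) :
    evP (idW w) = Z w := by
  rw [idW, evP_ofLC, ← Z_id w hw (convL_iff h)]

theorem evP_words (ws : List (List Ltr)) : evP (ws.map fun w => (1, [w])) = (ws.map Z).sum := by
  simp [evP, evM, Function.comp_def]

theorem evP_relP (r : Rel) (h : valid r = true) : evP (relP r) = 0 := by
  cases r with
  | shf u v =>
    simp only [valid, Bool.and_eq_true, List.all_eq_true] at h
    rw [relP, evP_cons, evP_words, ← Z_shuffle u v h.1.1 h.1.2 h.2]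
    simp [evM]
  | dist w =>
    simp only [valid, Bool.and_eq_true] at h
    rw [relP, evP_append, evP_idW w h.1.1.1 h.1.2, evP_smul, evP_ofLC,
      ← Z_sq w h.1.1.1 h.1.1.2 (convL_iff h.2)]
    simp [evM]
  | stf k e v =>
    simp only [valid, Bool.and_eq_true] at h
    rw [relP, evP_append, evP_smul, evP_idxP _ h.1, evP_idxP _ h.2, ← Z_stuffle]
    simp [evM, evI]
  | z4 =>
    rw [relP, evP_append, evP_smul, evP_smul, evP_pmul, evP_idW _ (by decide) (by decide),
      evP_idW _ (by decide) (by decide)]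
    have := zeta_four_eq
    simp only [evM, List.map_nil, List.prod_nil]
    push_cast
    linarith

/-- code of letters -/
def lc : Ltr → ℕ
  | a => 0
  | b => 1
  | c => 2
  | B => 3

/-- code of words -/
def code : List Ltr → ℕ
  | [] => 1
  | l :: w => lc l + 4 * code w

/-- canonical representative up to duality -/
def canonW (w : List Ltr) : List Ltr :=
  if Nat.blt (code (dual w)) (code w) && (conv w && nob w && conv (dual w)) then dual w else w

theorem Z_canonW (w : List Ltr) : Z (canonW w) = Z w := by
  unfold canonW
  split_ifs with h
  · simp only [Bool.and_eq_true] at h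
    exact Z_dual w h.2.1.1 h.2.1.2 h.2.2
  · rfl

/-- insertion in a sorted list of words -/
def insW (w : List Ltr) : Mono → Mono
  | [] => [w]
  | v :: m => bif Nat.blt (code v) (code w) then v :: insW w m else w :: v :: m

theorem evM_cons (w : List Ltr) (m : Mono) : evM (w :: m) = Z w * evM m := by simp [evM]

theorem evM_insW (w : List Ltr) (m : Mono) : evM (insW w m) = Z w * evM m := by
  induction m with
  | nil => simp [insW, evM]
  | cons v m ih =>
    unfold insW
    cases Nat.blt (code v) (code w)
    · simp [evM]
    · simp only [cond_true, evM_cons, ih]; ring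

/-- canonical monomial -/
def canonM : Mono → Mono
  | [] => []
  | w :: m => insW (canonW w) (canonM m)

theorem evM_canonM (m : Mono) : evM (canonM m) = evM m := by
  induction m with
  | nil => rfl
  | cons w m ih => rw [canonM, evM_insW, ih, Z_canonW, evM_cons]

/-- code of monomials -/
def codeM : Mono → ℕ
  | [] => 1
  | w :: m => code w + 4096 * codeM m

/-- search trees -/
inductive Tr
  | lf
  | nd (l : Tr) (k : ℕ) (z : ℤ) (m : Mono) (r : Tr)

/-- value of a tree -/
noncomputable def evT : Tr → ℝ
  | .lf => 0
  | .nd l _ z m r => evT l + z * evM m + evT r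

/-- insertion in trees -/
def insT (k : ℕ) (z : ℤ) (m : Mono) : Tr → Tr
  | .lf => .nd .lf k z m .lf
  | .nd l k' z' m' r =>
    bif Nat.blt k k' then .nd (insT k z m l) k' z' m' r
    else bif Nat.blt k' k then .nd l k' z' m' (insT k z m r)
    else bif decide (m = m') then .nd l k' (z + z') m' r
    else .nd l k' z' m' (insT k z m r)

theorem evT_insT (k : ℕ) (z : ℤ) (m : Mono) (t : Tr) : evT (insT k z m t) = z * evM m + evT t := by
  induction t with
  | lf => simp [insT, evT]
  | nd l k' z' m' r ihl ihr =>
    unfold insT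
    cases Nat.blt k k'
    · cases Nat.blt k' k
      · by_cases h : m = m'
        · simp [h, evT]; ring
        · simp [h, evT, ihr]; ring
      · simp [evT, ihr]; ring
    · simp [evT, ihl]; ring

/-- insertion of a polynomial -/
def addT (t : Tr) : Poly → Tr
  | [] => t
  | p :: P => addT (insT (codeM (canonM p.2)) p.1 (canonM p.2) t) P

theorem evT_addT (P : Poly) (t : Tr) : evT (addT t P) = evP P + evT t := by
  induction P generalizing t with
  | nil => simp [addT, evP]
  | cons p P ih => rw [addT, ih, evT_insT, evP_cons, evM_canonM]; ring

/-- all coefficients vanish -/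
def zeroT : Tr → Bool
  | .lf => true
  | .nd l _ z _ r => decide (z = 0) && (zeroT l && zeroT r)

theorem evT_zero (t : Tr) (h : zeroT t = true) : evT t = 0 := by
  induction t with
  | lf => rfl
  | nd l k z m r ihl ihr =>
    simp only [zeroT, Bool.and_eq_true, decide_eq_true_eq] at h
    simp [evT, h.1, ihl h.2.1, ihr h.2.2]

theorem evP_zero (P : Poly) (h : zeroT (addT .lf P) = true) : evP P = 0 := by
  have h1 := evT_addT P .lf
  rw [evT_zero _ h] at h1
  simpa [evT] using h1.symm

/-- polynomial of a combination of relations -/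
def certP (C : List (ℤ × Mono × Rel)) : Poly := C.flatMap fun x => smul x.1 x.2.1 (relP x.2.2)

theorem evP_certP (C : List (ℤ × Mono × Rel)) (h : (C.all fun x => valid x.2.2) = true) :
    evP (certP C) = 0 := by
  induction C with
  | nil => simp [certP, evP]
  | cons x C ih =>
    simp only [List.all_cons, Bool.and_eq_true] at h
    have e : certP (x :: C) = smul x.1 x.2.1 (relP x.2.2) ++ certP C := rfl
    rw [e, evP_append, evP_smul, evP_relP _ h.1, ih h.2]; simp
def cert : List (ℤ × Mono × Rel) := [
  (10241075111904, [], .dist [a, a, a, b, b]),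
  (70445131403584, [], .shf [c, B] [c, B, B]),
  (-6017946371808, [], .dist [a, a, b, a, b]),
  (-9454831072736, [], .dist [a, b, a, a, b]),
  (-39213745006688, [[a, c]], .dist [a, a, b]),
  (2814103692512, [[a, B, B]], .dist [a, b]),
  (40457192086080, [], .stf 2 true []),
  (-70850622874080, [], .shf [c] [c, B, B, B]),
  (2258602158855, [], .dist [a, a, a, a, b]),
  (-70398662964000, [], .shf [a, c] [a, a, B]),
  (49540302026880, [], .shf [c] [a, a, a, B]),
  (-4118868885600, [[c]], .z4),
  (9599547644820, [[c]], .dist [a, a, a, b]),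
  (-18844299165840, [[a, B], [c]], .dist [a, b]),
  (16194220248000, [[a, c], [c]], .dist [a, b]),
  (-2371376847392, [], .shf [a, B] [a, a, B]),
  (33836861805600, [], .stf 2 false []),
  (289708300328160, [], .shf [c] [a, B, c, B]),
  (5954406618720, [], .shf [c] [c, a, B, B]),
  (-8320109562240, [], .shf [c] [c, a, a, B]),
  (39656612039520, [], .shf [c] [a, c, B, B]),
  (19979967899520, [[c]], .dist [a, a, b, b]),
  (27082036937040, [[c]], .shf [a, B] [a, B]),
  (12633476832000, [[c]], .dist [a, b, a, b]),
  (56820398515200, [[c]], .shf [a, c] [a, c]),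
  (-42834234360960, [], .stf 0 false [(0, true), (0, true)]),
  (5528413907520, [], .shf [c] [c, a, B, c]),
  (45584307961920, [], .shf [c] [c, c, c, B]),
  (15624792472800, [], .stf 1 false [(0, true)]),
  (-433369167759360, [[a, c]], .shf [c] [a, B]),
  (86228608502400, [[c]], .stf 1 false []),
  (-153073586635200, [[c]], .shf [c] [a, a, c]),
  (198046653624960, [[c]], .shf [c] [a, B, B]),
  (-344166574471440, [[a, c]], .stf 0 false []),
  (344166574471440, [[a, c]], .shf [c] [a, c]),
  (182046324870480, [[a, c]], .dist [a, b, b]),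
  (-34346837078400, [], .shf [c] [a, a, c, c]),
  (134102068040640, [], .shf [c] [a, a, B, B]),
  (29422797534480, [], .shf [a, B] [a, c, B]),
  (-47912537944320, [], .dist [a, a, b, b, b]),
  (65123262624000, [[c]], .stf 1 true []),
  (13661112212160, [], .shf [a, c] [a, B, B]),
  (13362831709920, [], .stf 1 true [(0, true)]),
  (-14723537404800, [], .dist [a, b, a, b, b]),
  (-391848649311840, [], .shf [a, B] [a, c, c]),
  (391848649311840, [[a, c, c]], .dist [a, b]),
  (82828429239360, [[c]], .stf 0 false [(0, false)]),
  (226639321406400, [[c]], .shf [c] [a, c, c]),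
  (114578100329280, [[c]], .stf 0 true [(0, false)]),
  (29806697007360, [[c]], .stf 0 true [(0, true)]),
  (-168777861470400, [[c]], .shf [c] [a, c, B]),
  (-99627159048480, [[c], [c]], .shf [c] [a, B]),
  (-99741940082400, [[c], [c]], .stf 0 false []),
  (100315845252000, [[c], [c]], .shf [c] [a, c]),
  (14494807941600, [[c], [c]], .dist [a, b, b]),
  (-14494807941600, [[c], [c]], .dist [a, a, b]),
  (-138856383429120, [[c]], .shf [c] [c, a, B]),
  (-14917986370560, [[c]], .dist [a, b, b, b]),
  (-29422797534480, [[a, c, B]], .dist [a, b]),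
  (-28864276338240, [], .stf 1 false [(0, false)]),
  (-290972556275520, [], .shf [c] [a, c, a, c]),
  (245388248313600, [], .shf [c, B] [c, c, B]),
  (23567213564160, [], .shf [a, c] [a, B, c]),
  (-79215226285440, [], .stf 0 false [(1, false)]),
  (44242124935680, [], .stf 0 true [(0, false), (0, true)]),
  (-24889592112000, [], .shf [c] [c, a, c, B]),
  (1526000757120, [], .dist [a, b, b, b, b]),
  (-36803125934400, [], .shf [c] [c, c, a, B]),
  (-27847887997440, [], .shf [c] [a, c, c, B]),
  (-38943273096000, [], .stf 0 true [(0, true), (0, false)]),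
  (24501414248640, [], .shf [c, B] [a, c, B]),
  (-54171019885920, [], .stf 0 true [(1, true)]),
  (147428374675680, [], .shf [c] [a, B, a, c]),
  (-34470184922880, [], .stf 1 true [(0, false)]),
  (-93257354789760, [], .stf 0 true [(1, false)]),
  (-62607239805600, [], .stf 0 false [(1, true)]),
  (-62951582907360, [], .shf [c] [a, B, a, B]),
  (13661112212160, [], .stf 0 false [(0, false), (0, false)]),
  (780746635200, [], .stf 0 true [(0, true), (0, true)]),
  (110681711280, [[a, B]], .dist [a, a, b]),
  (-1721715508800, [], .shf [c] [c, B, B, c]),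
  (1147810339200, [], .shf [c] [c, B, c, c]),
  (573905169600, [], .shf [c] [c, a, c, c]),
  (-344343101760, [], .shf [c, c] [c, c, c]),
  (344343101760, [[c], [c], [c]], .dist [a, b]),
  (-20769068779200, [], .stf 0 true [(0, false), (0, false)]),
  (573905169600, [[c]], .shf [c] [c, B, c]),
  (-114781033920, [[c, c]], .shf [c] [c, c]),
  (-57390516960, [[c], [c, c]], .shf [c] [c]),
  (-28695258480, [[c], [c], [c]], .shf [c] [c])]

theorem cert_valid : (cert.all fun x => valid x.2.2) = true := by decide +kernel

end Apery

open Ltr Filter Topology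

namespace Apery

/-- the common denominator -/
def DD : ℤ := 43042887720

/-- the claim, multiplied by the common denominator -/
def TP : Poly :=
  smul DD [] (ofLC SL) ++ (smul (155 * 5380360965) [] (idW [a, a, a, a, b]) ++
  (smul (-18 * DD) [] (pmul (idW [a, b]) (idW [a, a, b])) ++
  (smul (-80 * DD) [] (ofLC (subst φhalf [a, a, a, a, b])) ++
  (smul (-455 * 21521443860) [[c]] (idW [a, a, a, b]) ++
  (smul (-32 * 14347629240) [[c], [c], [c]] (idW [a, b]) ++
  [(2 * 14347629240, [[c], [c], [c], [c], [c]])])))))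


theorem TP_cert : zeroT (addT .lf (TP ++ smul (-1) [] (certP cert))) = true := by decide +kernel

theorem TP_zero : evP TP = 0 := by
  have h := evP_zero _ TP_cert
  rw [evP_append, evP_smul, evP_certP _ cert_valid] at h
  simpa using h

theorem TP_eval : evP TP = 43042887720 * evZ SL + 155 * 5380360965 * Z [a, a, a, a, b]
    - 18 * 43042887720 * (Z [a, b] * Z [a, a, b])
    - 80 * 43042887720 * evZ (subst φhalf [a, a, a, a, b])
    - 455 * 21521443860 * Z [c] * Z [a, a, a, b]
    - 32 * 14347629240 * Z [c] ^ 3 * Z [a, b] + 2 * 14347629240 * Z [c] ^ 5 := by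
  simp only [TP, DD, evP_append, evP_smul, evP_pmul, evP_ofLC, evP_cons]
  rw [evP_idW _ (by decide) (by decide), evP_idW _ (by decide) (by decide),
    evP_idW _ (by decide) (by decide), evP_idW _ (by decide) (by decide)]
  simp only [evM, evP, List.map_nil, List.map_cons, List.prod_nil, List.prod_cons, List.sum_nil]
  push_cast
  ring

end Apery

theorem stmt_5 :
    ∑' k : ℕ, (4 : ℝ) ^ (k + 1) * (genHarmonic (k + 1) 1) ^ 3 /
      ((k + 1 : ℝ) ^ 2 * (Nat.choose (2 * (k + 1)) (k + 1) : ℝ))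
    = -(155 / 8) * zetaVal 5 + 18 * zetaVal 2 * zetaVal 3 + 80 * polyLog 5 (1 / 2)
      + 455 / 2 * Real.log 2 * zetaVal 4 + 32 / 3 * Real.log 2 ^ 3 * zetaVal 2 - 2 / 3 * Real.log 2 ^ 5 := by

  have h := Apery.TP_zero
  rw [Apery.TP_eval] at h
  have z2 : zetaVal 2 = Apery.Z [Ltr.a, Ltr.b] := Apery.zetaVal_eq 0
  have z3 : zetaVal 3 = Apery.Z [Ltr.a, Ltr.a, Ltr.b] := Apery.zetaVal_eq 1
  have z4 : zetaVal 4 = Apery.Z [Ltr.a, Ltr.a, Ltr.a, Ltr.b] := Apery.zetaVal_eq 2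
  have z5 : zetaVal 5 = Apery.Z [Ltr.a, Ltr.a, Ltr.a, Ltr.a, Ltr.b] := Apery.zetaVal_eq 3
  rw [Apery.main_series, z2, z3, z4, z5, Apery.polyLog_eq, Apery.log_two_eq]
  linear_combination h / 43042887720
end

section
/- ∫_0^{π/2} x^2 cot(x) ln^2(cos(x)) dx = −(217/64)ζ(5) − (9/16)ζ(2)ζ(3) + 2 Li_5(1/2) + (79/16) ln(2) ζ(4) + (2/3) ln^3(2) ζ(2) − (1/60) ln^5(2). -/
open Real

open Set Filter Topology MeasureTheory

lemma ftc_nonneg {f f' : ℝ → ℝ} {a b fa fb : ℝ} (hab : a < b)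
    (hderiv : ∀ x ∈ Ioo a b, HasDerivAt f (f' x) x) (hpos : ∀ x ∈ Ioo a b, 0 ≤ f' x)
    (ha : Tendsto f (𝓝[>] a) (𝓝 fa)) (hb : Tendsto f (𝓝[<] b) (𝓝 fb)) :
    IntervalIntegrable f' volume a b ∧ ∫ y in a..b, f' y = fb - fa := by
  have hI : IntervalIntegrable f' volume a b := by
    set F : ℝ → ℝ := Function.update (Function.update f a fa) b fb
    have Fderiv : ∀ x ∈ Ioo a b, HasDerivAt F (f' x) x := by
      refine fun x hx => (hderiv x hx).congr_of_eventuallyEq ?_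
      filter_upwards [Ioo_mem_nhds hx.1 hx.2] with _ hy
      unfold F
      rw [Function.update_of_ne hy.2.ne, Function.update_of_ne hy.1.ne']
    have hcont : ContinuousOn F (Icc a b) := by
      rw [continuousOn_update_iff, continuousOn_update_iff, Icc_sdiff_right, Ico_sdiff_left]
      refine ⟨⟨fun z hz => (hderiv z hz).continuousAt.continuousWithinAt, ?_⟩, ?_⟩
      · exact fun _ => ha.mono_left (nhdsWithin_mono _ Ioo_subset_Ioi_self)
      · rintro -
        refine (hb.congr' ?_).mono_left (nhdsWithin_mono _ Ico_subset_Iio_self)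
        filter_upwards [Ioo_mem_nhdsLT hab] with _ hz using (Function.update_of_ne hz.1.ne' _ _).symm
    apply intervalIntegral.intervalIntegrable_deriv_of_nonneg (g := F)
    · rwa [uIcc_of_le hab.le]
    · rwa [min_eq_left hab.le, max_eq_right hab.le]
    · rwa [min_eq_left hab.le, max_eq_right hab.le]
  exact ⟨hI, intervalIntegral.integral_eq_sub_of_hasDerivAt_of_tendsto hab hderiv hI ha hb⟩

lemma pl_bd (m k : ℕ) {v : ℝ} (hv : 0 ≤ v) : ‖v ^ (k + 1) / (k + 1 : ℝ) ^ m‖ ≤ v ^ (k + 1) := by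
  have h1 : (1 : ℝ) ≤ (k + 1 : ℝ) ^ m := one_le_pow₀ (by linarith [Nat.cast_nonneg (α := ℝ) k])
  rw [Real.norm_of_nonneg (by positivity)]
  exact div_le_self (by positivity) h1

lemma pl_geom {v : ℝ} (hv : 0 ≤ v) (hv1 : v < 1) : HasSum (fun k : ℕ => v ^ (k + 1)) (v / (1 - v)) := by
  have := (hasSum_geometric_of_lt_one hv hv1).mul_left v
  simpa [pow_succ', div_eq_mul_inv] using this

lemma pl_summable (m : ℕ) {v : ℝ} (hv : 0 ≤ v) (hv1 : v < 1) :
    Summable (fun k : ℕ => v ^ (k + 1) / (k + 1 : ℝ) ^ m) :=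
  Summable.of_norm_bounded (pl_geom hv hv1).summable (fun k => pl_bd m k hv)

lemma pl_at_one (m : ℕ) : polyLog m 1 = zetaVal m := by
  simp [polyLog, zetaVal]

lemma pl_one {v : ℝ} (hv : 0 ≤ v) (hv1 : v < 1) : polyLog 1 v = - Real.log (1 - v) := by
  have := (Real.hasSum_pow_div_log_of_abs_lt_one (x := v) (by rw [abs_of_nonneg hv]; exact hv1)).tsum_eq
  simpa [polyLog] using this

lemma pl_deriv (m : ℕ) {v : ℝ} (hv : 0 < v) (hv1 : v < 1) :
    HasDerivAt (polyLog (m + 1)) (polyLog m v / v) v := by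
  obtain ⟨r, hr, hr1⟩ := exists_between hv1
  have hr0 : 0 < r := hv.trans hr
  have key := hasDerivAt_tsum_of_isPreconnected (𝕜 := ℝ) (u := fun k : ℕ => r ^ k)
    (g := fun (k : ℕ) (v : ℝ) => v ^ (k + 1) / (k + 1 : ℝ) ^ (m + 1))
    (g' := fun (k : ℕ) (v : ℝ) => v ^ k / (k + 1 : ℝ) ^ m) (t := Ioo 0 r) (y₀ := v) (y := v)
    (summable_geometric_of_lt_one hr0.le hr1) isOpen_Ioo isPreconnected_Ioo ?_ ?_ ⟨hv, hr⟩
    (pl_summable (m+1) hv.le hv1) ⟨hv, hr⟩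
  · have e : polyLog m v / v = ∑' k : ℕ, v ^ k / (k + 1 : ℝ) ^ m := by
      unfold polyLog
      rw [← tsum_div_const]
      congr 1; ext k
      rw [pow_succ]
      field_simp
    rw [e]
    exact key
  · intro k y hy
    have := (hasDerivAt_pow (k + 1) y).div_const ((k + 1 : ℝ) ^ (m + 1))
    refine this.congr_deriv ?_
    have : (k + 1 : ℝ) ≠ 0 := by positivity
    push_cast
    rw [pow_succ (k + 1 : ℝ) m]
    field_simp
  · intro k y hy
    have h1 : (1 : ℝ) ≤ (k + 1 : ℝ) ^ m := one_le_pow₀ (by linarith [Nat.cast_nonneg (α := ℝ) k])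
    have h0 : 0 < y := hy.1
    rw [Real.norm_of_nonneg (by positivity)]
    exact (div_le_self (by positivity) h1).trans (pow_le_pow_left₀ hy.1.le hy.2.le k)

lemma zv_summable {m : ℕ} (hm : 2 ≤ m) : Summable (fun k : ℕ => 1 / (k + 1 : ℝ) ^ m) := by
  have := (summable_nat_add_iff 1).2 (Real.summable_one_div_nat_pow.2 (show 1 < m by omega))
  simpa using this

lemma pl_cont {m : ℕ} (hm : 2 ≤ m) : ContinuousOn (polyLog m) (Icc 0 1) := by
  refine continuousOn_tsum (fun k => by fun_prop) (zv_summable hm) ?_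
  intro k v hv
  have h0 : 0 ≤ v := hv.1
  rw [Real.norm_of_nonneg (by positivity)]
  gcongr
  exact pow_le_one₀ hv.1 hv.2

lemma pl_lt {m : ℕ} (hm : 2 ≤ m) : Tendsto (polyLog m) (𝓝[<] 1) (𝓝 (zetaVal m)) := by
  have h := (pl_cont hm 1 (by simp)).tendsto
  rw [pl_at_one] at h
  exact h.mono_left (nhdsWithin_le_of_mem (mem_of_superset (Ioo_mem_nhdsLT zero_lt_one) Ioo_subset_Icc_self))

lemma pl_small (m : ℕ) {v : ℝ} (hv : 0 ≤ v) (hv1 : v ≤ 1 / 2) : |polyLog m v| ≤ 2 * v := by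
  have h1 := tsum_of_norm_bounded (pl_geom hv (by linarith)) (fun k => pl_bd m k hv)
  refine h1.trans ?_
  rw [div_le_iff₀ (by linarith)]
  nlinarith

lemma mul_log_pow (p : ℕ) : Tendsto (fun u : ℝ => u * Real.log u ^ p) (𝓝[>] 0) (𝓝 0) := by
  rcases Nat.eq_zero_or_pos p with rfl | hp
  · simpa using (tendsto_nhdsWithin_of_tendsto_nhds tendsto_id : Tendsto (fun u : ℝ => u) (𝓝[>] 0) (𝓝 0))
  · have h := (tendsto_log_mul_rpow_nhdsGT_zero (r := 1 / (p : ℝ)) (by positivity)).pow p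
    rw [zero_pow hp.ne'] at h
    refine h.congr' ?_
    filter_upwards [self_mem_nhdsWithin] with u hu
    have hu : 0 < u := hu
    rw [mul_pow, ← Real.rpow_natCast (u ^ (1 / (p : ℝ))), ← Real.rpow_mul hu.le]
    rw [one_div_mul_cancel (by positivity), Real.rpow_one, mul_comm]

lemma pl_lim0 (m p : ℕ) {a : ℝ} (ha : 0 < a) :
    Tendsto (fun u : ℝ => polyLog m (a * u) * Real.log u ^ p) (𝓝[>] 0) (𝓝 0) := by
  have h := ((mul_log_pow p).abs.const_mul (2 * a))
  simp only [abs_zero, mul_zero] at h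
  refine squeeze_zero_norm' ?_ h
  filter_upwards [Ioo_mem_nhdsGT (show (0:ℝ) < 1 / (2 * a) by positivity)] with u hu
  have hu0 := hu.1
  have h2 : a * u ≤ 1 / 2 := by
    have := hu.2.le
    rw [le_div_iff₀ (by positivity)] at this
    linarith
  rw [norm_mul, Real.norm_eq_abs, Real.norm_eq_abs, abs_mul, abs_of_pos hu0]
  have := pl_small m (mul_nonneg ha.le hu0.le) h2
  nlinarith [abs_nonneg (Real.log u ^ p)]


lemma pl_zero {v : ℝ} (hv : 0 ≤ v) (hv1 : v < 1) : polyLog 0 v = v / (1 - v) := by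
  simpa [polyLog] using (pl_geom hv hv1).tsum_eq

lemma van {g φ : ℝ → ℝ} {a : ℝ} {l : Filter ℝ} (hl : l ≤ 𝓝 a) (hg : DifferentiableAt ℝ g a)
    (hga : g a = 0) (hφ : Tendsto φ l (𝓝[<] 1)) (hφ0 : ∀ᶠ u in l, 0 ≤ φ u)
    (hO : (fun u => u - a) =O[l] (fun u => 1 - φ u)) :
    Tendsto (fun u => g u * polyLog 1 (φ u)) l (𝓝 0) := by
  have h1 : g =O[l] (fun u => u - a) := by
    have := hg.isBigO_sub.mono hl
    simpa [hga] using this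
  have h2 := h1.trans hO
  have h3 : Tendsto (fun u => 1 - φ u) l (𝓝[>] 0) := by
    rw [tendsto_nhdsWithin_iff] at hφ ⊢
    refine ⟨by simpa using hφ.1.const_sub 1, ?_⟩
    filter_upwards [hφ.2] with u hu
    have : φ u < 1 := hu
    simpa using this
  have h4 := (mul_log_pow 1).comp h3
  have h5 : (fun u => g u * polyLog 1 (φ u)) =O[l] ((fun u : ℝ => u * Real.log u ^ 1) ∘ fun u => 1 - φ u) := by
    have := h2.mul (Asymptotics.isBigO_refl (fun u => Real.log (1 - φ u)) l)
    have e : (fun u => g u * polyLog 1 (φ u)) =ᶠ[l] fun u => -(g u * Real.log (1 - φ u)) := by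
      filter_upwards [hφ0, (tendsto_nhdsWithin_iff.1 hφ).2] with u h0 h1
      rw [pl_one h0 h1]; ring
    refine e.trans_isBigO ?_
    simpa [Function.comp_def] using this
  exact h5.trans_tendsto h4

noncomputable def antiA (u : ℝ) : ℝ :=
  Real.log u ^ 4 * polyLog 1 u - 4 * Real.log u ^ 3 * polyLog 2 u + 12 * Real.log u ^ 2 * polyLog 3 u
    - 24 * Real.log u * polyLog 4 u + 24 * polyLog 5 u

lemma antiA_deriv {u : ℝ} (hu : 0 < u) (hu1 : u < 1) :
    HasDerivAt antiA (Real.log u ^ 4 / (1 - u)) u := by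
  have hL := Real.hasDerivAt_log hu.ne'
  have d1 := pl_deriv 0 hu hu1
  have d2 := pl_deriv 1 hu hu1
  have d3 := pl_deriv 2 hu hu1
  have d4 := pl_deriv 3 hu hu1
  have d5 := pl_deriv 4 hu hu1
  rw [pl_zero hu.le hu1] at d1
  have := (((((hL.pow 4).mul d1).sub (((hL.pow 3).const_mul 4).mul d2)).add
    (((hL.pow 2).const_mul 12).mul d3)).sub ((hL.const_mul 24).mul d4)).add (d5.const_mul 24)
  refine this.congr_deriv ?_
  have : 1 - u ≠ 0 := by linarith
  simp only [Pi.pow_apply, zero_add, Nat.reduceAdd]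
  field_simp
  norm_num
  ring

lemma antiA_zero : Tendsto antiA (𝓝[>] 0) (𝓝 0) := by
  have h := fun m p => pl_lim0 m p (a := 1) one_pos
  simp only [one_mul] at h
  have := ((((h 1 4).sub ((h 2 3).const_mul 4)).add ((h 3 2).const_mul 12)).sub
    ((h 4 1).const_mul 24)).add ((h 5 0).const_mul 24)
  simp only [mul_zero, sub_zero, add_zero] at this
  refine this.congr (fun u => ?_)
  unfold antiA; ring

lemma antiA_one : Tendsto antiA (𝓝[<] 1) (𝓝 (24 * zetaVal 5)) := by
  have hl : Tendsto Real.log (𝓝[<] 1) (𝓝 0) := by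
    have := (Real.continuousAt_log one_ne_zero).tendsto
    rw [Real.log_one] at this
    exact this.mono_left nhdsWithin_le_nhds
  have h1 : Tendsto (fun u => Real.log u ^ 4 * polyLog 1 u) (𝓝[<] 1) (𝓝 0) := by
    refine van (a := 1) (φ := fun u => u) nhdsWithin_le_nhds ?_ (by simp) tendsto_id ?_ ?_
    · exact (Real.differentiableAt_log one_ne_zero).pow 4
    · filter_upwards [Ioo_mem_nhdsLT zero_lt_one] with u hu using hu.1.le
    · refine ((Asymptotics.isBigO_refl (fun u : ℝ => 1 - u) _).neg_left).congr_left (fun u => by ring)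
  have := (((h1.sub (((hl.pow 3).const_mul 4).mul (pl_lt (m := 2) le_rfl))).add
    (((hl.pow 2).const_mul 12).mul (pl_lt (m := 3) (by norm_num)))).sub
    ((hl.const_mul 24).mul (pl_lt (m := 4) (by norm_num)))).add ((pl_lt (m := 5) (by norm_num)).const_mul 24)
  have e : (0 - 4 * 0 ^ 3 * zetaVal 2 + 12 * 0 ^ 2 * zetaVal 3 - 24 * 0 * zetaVal 4
    + 24 * zetaVal 5) = 24 * zetaVal 5 := by ring
  rw [e] at this
  exact this

lemma int_A : IntervalIntegrable (fun u => Real.log u ^ 4 / (1 - u)) volume 0 1 ∧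
    ∫ u in (0:ℝ)..1, Real.log u ^ 4 / (1 - u) = 24 * zetaVal 5 := by
  have := ftc_nonneg zero_lt_one (fun u hu => antiA_deriv hu.1 hu.2) (fun u hu => by
    have : 0 < 1 - u := by linarith [hu.2]
    positivity) antiA_zero antiA_one
  simpa using this

lemma int_cot_log : IntervalIntegrable (fun x => Real.cos x / Real.sin x * Real.log (Real.cos x) ^ 4) volume 0 (π / 2) ∧
    ∫ x in (0:ℝ)..(π / 2), Real.cos x / Real.sin x * Real.log (Real.cos x) ^ 4 = 3 / 4 * zetaVal 5 := by
  have hc : ∀ x ∈ Ioo 0 (π / 2), 0 < Real.cos x := fun x hx =>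
    Real.cos_pos_of_mem_Ioo ⟨by linarith [hx.1, Real.pi_pos], hx.2⟩
  have hs : ∀ x ∈ Ioo 0 (π / 2), 0 < Real.sin x := fun x hx =>
    Real.sin_pos_of_mem_Ioo ⟨hx.1, by linarith [hx.2, Real.pi_pos]⟩
  have hc1 : ∀ x ∈ Ioo 0 (π / 2), Real.cos x ^ 2 < 1 := fun x hx => by
    nlinarith [Real.sin_sq_add_cos_sq x, hs x hx]
  have := ftc_nonneg (f := fun x => -(1 / 32) * antiA (Real.cos x ^ 2))
    (f' := fun x => Real.cos x / Real.sin x * Real.log (Real.cos x) ^ 4) (a := 0) (b := π / 2)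
    (fa := -(1 / 32) * (24 * zetaVal 5)) (fb := -(1 / 32) * 0) (by positivity) ?_ ?_ ?_ ?_
  · refine ⟨this.1, this.2.trans (by ring)⟩
  · intro x hx
    have hcx := hc x hx
    have hsx := hs x hx
    have h1 := (antiA_deriv (u := Real.cos x ^ 2) (by positivity) (hc1 x hx)).comp x
      ((Real.hasDerivAt_cos x).pow 2)
    have h2 := h1.const_mul (-(1 / 32) : ℝ)
    refine h2.congr_deriv ?_
    have h3 : 1 - Real.cos x ^ 2 = Real.sin x ^ 2 := by linarith [Real.sin_sq_add_cos_sq x]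
    rw [h3, Real.log_pow]
    push_cast
    field_simp
    norm_num
  · intro x hx
    have := hc x hx
    have := hs x hx
    positivity
  · refine (antiA_one.comp ?_).const_mul _
    rw [tendsto_nhdsWithin_iff]
    refine ⟨?_, ?_⟩
    · have : Continuous (fun x => Real.cos x ^ 2) := by fun_prop
      have := this.tendsto 0
      simp only [Real.cos_zero, one_pow] at this
      exact this.mono_left nhdsWithin_le_nhds
    · filter_upwards [Ioo_mem_nhdsGT (show (0:ℝ) < π / 2 by positivity)] with x hx using hc1 x hx
  · refine (antiA_zero.comp ?_).const_mul _
    rw [tendsto_nhdsWithin_iff]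
    refine ⟨?_, ?_⟩
    · have : Continuous (fun x => Real.cos x ^ 2) := by fun_prop
      have := this.tendsto (π / 2)
      simp only [Real.cos_pi_div_two, zero_pow two_ne_zero] at this
      exact this.mono_left nhdsWithin_le_nhds
    · filter_upwards [Ioo_mem_nhdsLT (show (0:ℝ) < π / 2 by positivity)] with x hx
      have := hc x hx
      have : 0 < Real.cos x ^ 2 := by positivity
      exact this


noncomputable def antiB (u : ℝ) : ℝ :=
  -(1 / 2) * ((Real.log u ^ 4 - Real.log 2 ^ 4) * polyLog 1 (2 * u) - 4 * Real.log u ^ 3 * polyLog 2 (2 * u)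
    + 12 * Real.log u ^ 2 * polyLog 3 (2 * u) - 24 * Real.log u * polyLog 4 (2 * u) + 24 * polyLog 5 (2 * u))

noncomputable def antiC (u : ℝ) : ℝ :=
  (1 / 2) * (Real.log u ^ 5 / 5 - Real.log 2 ^ 4 * Real.log u
    - ((Real.log u ^ 4 - Real.log 2 ^ 4) * polyLog 1 (1 / (2 * u)) + 4 * Real.log u ^ 3 * polyLog 2 (1 / (2 * u))
    + 12 * Real.log u ^ 2 * polyLog 3 (1 / (2 * u)) + 24 * Real.log u * polyLog 4 (1 / (2 * u))
    + 24 * polyLog 5 (1 / (2 * u))))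

lemma antiB_deriv {u : ℝ} (hu : 0 < u) (hu1 : u < 1 / 2) :
    HasDerivAt antiB ((Real.log u ^ 4 - Real.log 2 ^ 4) / (2 * u - 1)) u := by
  have hL := Real.hasDerivAt_log hu.ne'
  have hv : 0 < 2 * u := by linarith
  have hv1 : 2 * u < 1 := by linarith
  have hm : HasDerivAt (fun u : ℝ => 2 * u) 2 u := by simpa using (hasDerivAt_id u).const_mul (2 : ℝ)
  have d1 := (pl_deriv 0 hv hv1).comp u hm
  have d2 := (pl_deriv 1 hv hv1).comp u hm
  have d3 := (pl_deriv 2 hv hv1).comp u hm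
  have d4 := (pl_deriv 3 hv hv1).comp u hm
  have d5 := (pl_deriv 4 hv hv1).comp u hm
  rw [pl_zero hv.le hv1] at d1
  have := ((((((hL.pow 4).sub_const (Real.log 2 ^ 4)).mul d1).sub (((hL.pow 3).const_mul 4).mul d2)).add
    (((hL.pow 2).const_mul 12).mul d3)).sub ((hL.const_mul 24).mul d4)).add (d5.const_mul 24) |>.const_mul (-(1 / 2) : ℝ)
  refine this.congr_deriv ?_
  have h1 : 1 - 2 * u ≠ 0 := by linarith
  have h2 : 2 * u - 1 ≠ 0 := by intro h; apply h1; linarith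
  simp only [Pi.pow_apply, Function.comp_apply, zero_add, Nat.reduceAdd]
  rw [show 1 - 2 * u = -(2 * u - 1) by ring]
  field_simp
  norm_num
  ring

lemma antiC_deriv {u : ℝ} (hu : 1 / 2 < u) :
    HasDerivAt antiC ((Real.log u ^ 4 - Real.log 2 ^ 4) / (2 * u - 1)) u := by
  have hu0 : 0 < u := by linarith
  have hL := Real.hasDerivAt_log hu0.ne'
  have hv : 0 < 1 / (2 * u) := by positivity
  have hv1 : 1 / (2 * u) < 1 := by rw [div_lt_one (by positivity)]; linarith
  have hm : HasDerivAt (fun u : ℝ => 1 / (2 * u)) (-(1 / (2 * u)) / u) u := by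
    have h2 : HasDerivAt (fun u : ℝ => 2 * u) 2 u := by simpa using (hasDerivAt_id u).const_mul (2 : ℝ)
    have := h2.inv (by positivity)
    simp only [one_div]
    refine this.congr_deriv ?_
    field_simp
    try norm_num
  have d1 := (pl_deriv 0 hv hv1).comp u hm
  have d2 := (pl_deriv 1 hv hv1).comp u hm
  have d3 := (pl_deriv 2 hv hv1).comp u hm
  have d4 := (pl_deriv 3 hv hv1).comp u hm
  have d5 := (pl_deriv 4 hv hv1).comp u hm
  rw [pl_zero hv.le hv1] at d1
  have := ((((hL.pow 5).div_const 5).sub (hL.const_mul (Real.log 2 ^ 4))).sub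
    ((((((hL.pow 4).sub_const (Real.log 2 ^ 4)).mul d1).add (((hL.pow 3).const_mul 4).mul d2)).add
    (((hL.pow 2).const_mul 12).mul d3)).add ((hL.const_mul 24).mul d4) |>.add (d5.const_mul 24))).const_mul (1 / 2 : ℝ)
  refine this.congr_deriv ?_
  have h2 : 2 * u - 1 ≠ 0 := by linarith
  simp only [Pi.pow_apply, Function.comp_apply, zero_add, Nat.reduceAdd]
  have h3 : 1 - 1 / (2 * u) = (2 * u - 1) / (2 * u) := by field_simp
  rw [h3]
  generalize polyLog 1 (1 / (2 * u)) = p1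
  generalize polyLog 2 (1 / (2 * u)) = p2
  generalize polyLog 3 (1 / (2 * u)) = p3
  generalize polyLog 4 (1 / (2 * u)) = p4
  field_simp
  norm_num
  ring

lemma antiB_zero : Tendsto antiB (𝓝[>] 0) (𝓝 0) := by
  have h := fun m p => pl_lim0 m p (a := 2) two_pos
  have := ((((((h 1 4).sub ((h 1 0).const_mul (Real.log 2 ^ 4))).sub ((h 2 3).const_mul 4)).add ((h 3 2).const_mul 12)).sub
    ((h 4 1).const_mul 24)).add ((h 5 0).const_mul 24)).const_mul (-(1 / 2) : ℝ)
  simp only [mul_zero, sub_zero, add_zero] at this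
  refine this.congr (fun u => ?_)
  unfold antiB; ring

lemma log_half : Real.log (1 / 2) = - Real.log 2 := by
  rw [one_div, Real.log_inv]

lemma q_diff : DifferentiableAt ℝ (fun u => Real.log u ^ 4 - Real.log 2 ^ 4) (1 / 2) := by
  exact ((Real.differentiableAt_log (by norm_num)).pow 4).sub_const _

lemma q_zero : (fun u => Real.log u ^ 4 - Real.log 2 ^ 4) (1 / 2) = 0 := by
  simp only [log_half]; ring

lemma log_lim_half {l : Filter ℝ} (hl : l ≤ 𝓝 (1 / 2)) : Tendsto Real.log l (𝓝 (- Real.log 2)) := by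
  have := (Real.continuousAt_log (x := 1 / 2) (by norm_num)).tendsto
  rw [log_half] at this
  exact this.mono_left hl

lemma antiB_half : Tendsto antiB (𝓝[<] (1 / 2)) (𝓝 (-(1 / 2) * (4 * Real.log 2 ^ 3 * zetaVal 2
    + 12 * Real.log 2 ^ 2 * zetaVal 3 + 24 * Real.log 2 * zetaVal 4 + 24 * zetaVal 5))) := by
  have hl := log_lim_half (l := 𝓝[<] (1 / 2)) nhdsWithin_le_nhds
  have hφ : Tendsto (fun u : ℝ => 2 * u) (𝓝[<] (1 / 2)) (𝓝[<] 1) := by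
    rw [tendsto_nhdsWithin_iff]
    refine ⟨?_, ?_⟩
    · have : Continuous (fun u : ℝ => 2 * u) := by fun_prop
      have := this.tendsto (1 / 2)
      norm_num at this
      refine Tendsto.mono_left ?_ nhdsWithin_le_nhds
      simpa using this
    · filter_upwards [self_mem_nhdsWithin] with u hu
      have hu : u < 1 / 2 := hu
      show 2 * u < 1
      linarith
  have h1 : Tendsto (fun u => (Real.log u ^ 4 - Real.log 2 ^ 4) * polyLog 1 (2 * u)) (𝓝[<] (1 / 2)) (𝓝 0) := by
    refine van (a := 1 / 2) nhdsWithin_le_nhds q_diff q_zero hφ ?_ ?_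
    · filter_upwards [Ioo_mem_nhdsLT (show (0:ℝ) < 1 / 2 by norm_num)] with u hu
      linarith [hu.1]
    · refine (((Asymptotics.isBigO_refl (fun u : ℝ => 1 - 2 * u) _).const_mul_left (-(1 / 2)))).congr_left (fun u => by ring)
  have := ((((h1.sub (((hl.pow 3).const_mul 4).mul ((pl_lt (m := 2) le_rfl).comp hφ))).add
    (((hl.pow 2).const_mul 12).mul ((pl_lt (m := 3) (by norm_num)).comp hφ))).sub
    ((hl.const_mul 24).mul ((pl_lt (m := 4) (by norm_num)).comp hφ))).add
    (((pl_lt (m := 5) (by norm_num)).comp hφ).const_mul 24)).const_mul (-(1 / 2) : ℝ)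
  refine (this.congr (fun u => ?_)).trans_eq ?_
  · simp [antiB]
  · congr 1; ring

lemma antiC_half : Tendsto antiC (𝓝[>] (1 / 2)) (𝓝 ((1 / 2) * (-Real.log 2 ^ 5 / 5 + Real.log 2 ^ 5
    - (-4 * Real.log 2 ^ 3 * zetaVal 2
    + 12 * Real.log 2 ^ 2 * zetaVal 3 - 24 * Real.log 2 * zetaVal 4 + 24 * zetaVal 5)))) := by
  have hl := log_lim_half (l := 𝓝[>] (1 / 2)) nhdsWithin_le_nhds
  have hφ : Tendsto (fun u : ℝ => 1 / (2 * u)) (𝓝[>] (1 / 2)) (𝓝[<] 1) := by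
    rw [tendsto_nhdsWithin_iff]
    refine ⟨?_, ?_⟩
    · have : ContinuousAt (fun u : ℝ => 1 / (2 * u)) (1 / 2) :=
        ContinuousAt.div (by fun_prop) (by fun_prop) (by norm_num)
      have := this.tendsto
      rw [show (1 : ℝ) / (2 * (1 / 2)) = 1 by norm_num] at this
      exact Tendsto.mono_left this nhdsWithin_le_nhds
    · filter_upwards [self_mem_nhdsWithin] with u hu
      have hu : 1 / 2 < u := hu
      show 1 / (2 * u) < 1
      rw [div_lt_one (by linarith)]
      linarith
  have h1 : Tendsto (fun u => (Real.log u ^ 4 - Real.log 2 ^ 4) * polyLog 1 (1 / (2 * u))) (𝓝[>] (1 / 2)) (𝓝 0) := by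
    refine van (a := 1 / 2) nhdsWithin_le_nhds q_diff q_zero hφ ?_ ?_
    · filter_upwards [self_mem_nhdsWithin] with u hu
      have hu : 1 / 2 < u := hu
      have : 0 < u := by linarith
      positivity
    · refine Asymptotics.IsBigO.of_bound 1 ?_
      filter_upwards [Ioo_mem_nhdsGT (show (1 / 2:ℝ) < 1 by norm_num)] with u hu
      have h0 : 0 < u := by linarith [hu.1]
      have h3 : 1 - 1 / (2 * u) = (u - 1 / 2) / u := by field_simp
      rw [h3, norm_div, one_mul, Real.norm_of_nonneg h0.le]
      rw [le_div_iff₀ h0]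
      nlinarith [norm_nonneg (u - 1 / 2), hu.2]
  have := ((((hl.pow 5).div_const 5).sub (hl.const_mul (Real.log 2 ^ 4))).sub
    ((((h1.add (((hl.pow 3).const_mul 4).mul ((pl_lt (m := 2) le_rfl).comp hφ))).add
    (((hl.pow 2).const_mul 12).mul ((pl_lt (m := 3) (by norm_num)).comp hφ))).add
    ((hl.const_mul 24).mul ((pl_lt (m := 4) (by norm_num)).comp hφ))).add
    (((pl_lt (m := 5) (by norm_num)).comp hφ).const_mul 24))).const_mul (1 / 2 : ℝ)
  refine (this.congr (fun u => ?_)).trans_eq ?_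
  · simp [antiC]
  · congr 1; ring

lemma antiC_one : antiC 1 = (1 / 2) * (Real.log 2 ^ 5 - 24 * polyLog 5 (1 / 2)) := by
  unfold antiC
  rw [Real.log_one, mul_one, pl_one (by norm_num) (by norm_num)]
  rw [show (1 : ℝ) - 1 / 2 = 1 / 2 by norm_num, log_half]
  ring

lemma q_neg {u : ℝ} (h0 : 1 / 2 < u) (h1 : u < 1) : Real.log u ^ 4 ≤ Real.log 2 ^ 4 := by
  have : |Real.log u| ≤ Real.log 2 := by
    rw [abs_le]
    constructor
    · rw [← log_half]; exact Real.log_le_log (by norm_num) h0.le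
    · exact (Real.log_nonpos (by linarith) h1.le).trans (Real.log_nonneg (by norm_num))
  calc Real.log u ^ 4 = |Real.log u| ^ 4 := by rw [Even.pow_abs (by decide)]
    _ ≤ _ := by gcongr

lemma q_pos {u : ℝ} (h0 : 0 < u) (h1 : u < 1 / 2) : Real.log 2 ^ 4 ≤ Real.log u ^ 4 := by
  have : Real.log 2 ≤ |Real.log u| := by
    rw [le_abs]; right
    have := Real.log_le_log h0 h1.le
    rw [log_half] at this; linarith
  have h2 : 0 ≤ Real.log 2 := Real.log_nonneg (by norm_num)
  calc Real.log u ^ 4 = |Real.log u| ^ 4 := by rw [Even.pow_abs (by decide)]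
    _ ≥ _ := by gcongr

lemma int_B : IntervalIntegrable (fun u => (Real.log u ^ 4 - Real.log 2 ^ 4) / (2 * u - 1)) volume 0 (1 / 2) ∧
    ∫ u in (0:ℝ)..(1 / 2), (Real.log u ^ 4 - Real.log 2 ^ 4) / (2 * u - 1) = -(1 / 2) * (4 * Real.log 2 ^ 3 * zetaVal 2
    + 12 * Real.log 2 ^ 2 * zetaVal 3 + 24 * Real.log 2 * zetaVal 4 + 24 * zetaVal 5) := by
  have := ftc_nonneg (f := fun u => - antiB u) (f' := fun u => -((Real.log u ^ 4 - Real.log 2 ^ 4) / (2 * u - 1)))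
    (show (0:ℝ) < 1 / 2 by norm_num) (fun u hu => (antiB_deriv hu.1 hu.2).neg)
    (fun u hu => by
      rw [← div_neg]
      exact div_nonneg (by linarith [q_pos hu.1 hu.2]) (by linarith [hu.2])) antiB_zero.neg antiB_half.neg
  refine ⟨by simpa only [Pi.neg_def, neg_neg] using this.1.neg, ?_⟩
  have h := this.2
  rw [intervalIntegral.integral_neg] at h
  linarith

lemma int_C : IntervalIntegrable (fun u => (Real.log u ^ 4 - Real.log 2 ^ 4) / (2 * u - 1)) volume (1 / 2) 1 ∧
    ∫ u in (1 / 2 : ℝ)..1, (Real.log u ^ 4 - Real.log 2 ^ 4) / (2 * u - 1) =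
    (1 / 2) * (Real.log 2 ^ 5 / 5 - 24 * polyLog 5 (1 / 2)
    - 4 * Real.log 2 ^ 3 * zetaVal 2
    + 12 * Real.log 2 ^ 2 * zetaVal 3 - 24 * Real.log 2 * zetaVal 4 + 24 * zetaVal 5) := by
  have hb : Tendsto antiC (𝓝[<] 1) (𝓝 (antiC 1)) :=
    (antiC_deriv (u := 1) (by norm_num)).continuousAt.tendsto.mono_left nhdsWithin_le_nhds
  have := ftc_nonneg (f := fun u => - antiC u) (f' := fun u => -((Real.log u ^ 4 - Real.log 2 ^ 4) / (2 * u - 1)))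
    (show (1 / 2:ℝ) < 1 by norm_num) (fun u hu => (antiC_deriv hu.1).neg)
    (fun u hu => by
      rw [← neg_div]
      exact div_nonneg (by linarith [q_neg hu.1 hu.2]) (by linarith [hu.1])) antiC_half.neg hb.neg
  refine ⟨by simpa only [Pi.neg_def, neg_neg] using this.1.neg, ?_⟩
  have h := this.2
  rw [intervalIntegral.integral_neg, antiC_one] at h
  linarith

lemma int_F : IntervalIntegrable (fun u => Real.log u ^ 4 / (1 - u) + (Real.log u ^ 4 - Real.log 2 ^ 4) / (2 * u - 1)) volume 0 1 ∧
    ∫ u in (0:ℝ)..1, (Real.log u ^ 4 / (1 - u) + (Real.log u ^ 4 - Real.log 2 ^ 4) / (2 * u - 1)) =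
    24 * zetaVal 5 + Real.log 2 ^ 5 / 10 - 4 * Real.log 2 ^ 3 * zetaVal 2 - 24 * Real.log 2 * zetaVal 4
      - 12 * polyLog 5 (1 / 2) := by
  refine ⟨int_A.1.add (int_B.1.trans int_C.1), ?_⟩
  rw [intervalIntegral.integral_add int_A.1 (int_B.1.trans int_C.1),
    ← intervalIntegral.integral_add_adjacent_intervals int_B.1 int_C.1, int_A.2, int_B.2, int_C.2]
  ring


noncomputable def fC (z : ℂ) : ℂ := Complex.log z ^ 4

noncomputable def FC (z : ℂ) : ℂ := -(dslope fC 1 z) + (1 / 2) * dslope fC (1 / 2) z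

lemma fC_one : fC 1 = 0 := by simp [fC]

lemma fC_real {t : ℝ} (ht : 0 ≤ t) : fC t = ((Real.log t ^ 4 : ℝ) : ℂ) := by
  simp [fC, ← Complex.ofReal_log ht]

lemma fC_half : fC (1 / 2) = ((Real.log 2 ^ 4 : ℝ) : ℂ) := by
  have := fC_real (t := 1 / 2) (by norm_num)
  rw [log_half] at this
  push_cast at this ⊢
  rw [this]; ring

lemma ball_re {z : ℂ} (hz : z ∈ Metric.ball (1 : ℂ) 1) : 0 < z.re := by
  rw [Metric.mem_ball, dist_eq_norm] at hz
  have := (abs_le.1 (Complex.abs_re_le_norm (z - 1))).1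
  simp at this
  linarith

lemma fC_diff : DifferentiableOn ℂ fC (Metric.ball 1 1) := by
  intro z hz
  exact ((Complex.differentiableAt_log (Or.inl (ball_re hz))).pow 4).differentiableWithinAt

lemma FC_diff : DifferentiableOn ℂ FC (Metric.ball 1 1) := by
  have h1 : DifferentiableOn ℂ (dslope fC 1) (Metric.ball 1 1) :=
    (Complex.differentiableOn_dslope (Metric.isOpen_ball.mem_nhds (by simp))).2 fC_diff
  have h2 : DifferentiableOn ℂ (dslope fC (1 / 2)) (Metric.ball 1 1) := by
    refine (Complex.differentiableOn_dslope (Metric.isOpen_ball.mem_nhds ?_)).2 fC_diff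
    rw [Metric.mem_ball, dist_eq_norm]; norm_num
  exact h1.neg.add (h2.const_mul _)

lemma FC_eq {z : ℂ} (h1 : z ≠ 1) (h2 : z ≠ 1 / 2) :
    FC z = fC z / (1 - z) + (fC z - ((Real.log 2 ^ 4 : ℝ) : ℂ)) / (2 * z - 1) := by
  unfold FC
  rw [dslope_of_ne _ h1, dslope_of_ne _ h2, slope_def_field, slope_def_field, fC_one, fC_half]
  have h3 : 1 - z ≠ 0 := sub_ne_zero.2 h1.symm
  have h4 : z - 1 ≠ 0 := sub_ne_zero.2 h1
  have h5 : z - 1 / 2 ≠ 0 := sub_ne_zero.2 h2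
  rw [show 1 - z = -(z - 1) by ring, show 2 * z - 1 = 2 * (z - 1 / 2) by ring]
  generalize z - 1 / 2 = b at *
  generalize z - 1 = a at *
  field_simp
  ring

lemma exG : ∃ G : ℂ → ℂ, ∀ z ∈ Metric.ball (1 : ℂ) 1, HasDerivAt G (FC z) z :=
  FC_diff.isExactOn_ball

noncomputable def Freal (u : ℝ) : ℝ :=
  Real.log u ^ 4 / (1 - u) + (Real.log u ^ 4 - Real.log 2 ^ 4) / (2 * u - 1)

lemma FC_real {t : ℝ} (ht : 0 ≤ t) (h1 : t ≠ 1) (h2 : t ≠ 1 / 2) : FC t = (Freal t : ℂ) := by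
  rw [FC_eq (by exact_mod_cast h1) (by
    intro h; apply h2
    have : (t : ℂ) = ((1 / 2 : ℝ) : ℂ) := by rw [h]; push_cast; rfl
    exact_mod_cast this), fC_real ht]
  unfold Freal
  push_cast
  rfl

lemma real_mem {t : ℝ} (h0 : 0 < t) (h1 : t ≤ 1) : (t : ℂ) ∈ Metric.ball (1 : ℂ) 1 := by
  rw [Metric.mem_ball, dist_eq_norm]
  rw [show (t : ℂ) - 1 = ((t - 1 : ℝ) : ℂ) by push_cast; rfl, Complex.norm_real, Real.norm_eq_abs, abs_lt]
  constructor <;> linarith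

lemma G_real_lim {G : ℂ → ℂ} (hG : ∀ z ∈ Metric.ball (1 : ℂ) 1, HasDerivAt G (FC z) z) :
    Tendsto (fun t : ℝ => (G t).re) (𝓝[>] 0) (𝓝 ((G 1).re - ∫ u in (0:ℝ)..1, Freal u)) := by
  have hI : IntervalIntegrable Freal volume 0 1 := int_F.1
  have hd : ∀ t : ℝ, 0 < t → t ≤ 1 → HasDerivAt (fun t : ℝ => (G t).re) (FC t).re t := by
    intro t h0 h1
    exact (hG t (real_mem h0 h1)).real_of_complex
  have key : ∀ t ∈ Ioo (0:ℝ) 1, (G t).re = (G 1).re - ∫ u in t..1, Freal u := by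
    intro t ht
    have := integral_eq_of_hasDerivAt_off_countable_of_le (fun t : ℝ => (G t).re) Freal ht.2.le
      (countable_singleton (1 / 2 : ℝ)) (fun x hx => (hd x (by linarith [hx.1, ht.1]) hx.2).continuousAt.continuousWithinAt)
      (fun x hx => by
        have h0 : 0 < x := by linarith [hx.1.1, ht.1]
        have := hd x h0 hx.1.2.le
        rw [FC_real h0.le hx.1.2.ne (by simpa using hx.2)] at this
        simpa using this)
      (hI.mono_set (by
        rw [uIcc_of_le ht.2.le, uIcc_of_le zero_le_one]
        exact Icc_subset_Icc ht.1.le le_rfl))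
    rw [this]; simp
  have hc : ContinuousOn (fun t => ∫ u in t..1, Freal u) (uIcc 0 1) := by
    apply intervalIntegral.continuousOn_primitive_interval_left
    rw [uIcc_of_le zero_le_one]
    exact (intervalIntegrable_iff_integrableOn_Icc_of_le zero_le_one).1 hI
  have h2 := (hc 0 (by simp)).tendsto
  have h3 : Tendsto (fun t => ∫ u in t..1, Freal u) (𝓝[>] 0) (𝓝 (∫ u in (0:ℝ)..1, Freal u)) := by
    refine h2.mono_left (nhdsWithin_le_of_mem ?_)
    rw [uIcc_of_le zero_le_one]
    exact mem_of_superset (Ioo_mem_nhdsGT zero_lt_one) Ioo_subset_Icc_self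
  refine (h3.const_sub (G 1).re).congr' ?_
  filter_upwards [Ioo_mem_nhdsGT zero_lt_one] with t ht using (key t ht).symm

noncomputable def zp (x : ℝ) : ℂ := Real.cos x * Complex.exp (x * Complex.I)

lemma zp_re (x : ℝ) : (zp x).re = Real.cos x ^ 2 := by
  simp [zp, Complex.exp_re, Complex.cos_ofReal_re, sq]

lemma zp_im (x : ℝ) : (zp x).im = Real.cos x * Real.sin x := by
  simp [zp, Complex.exp_im, Complex.cos_ofReal_re]

lemma zp_eq (x : ℝ) : zp x = (1 + Complex.exp (2 * x * Complex.I)) / 2 := by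
  unfold zp
  rw [Complex.ofReal_cos, Complex.cos]
  have : Complex.exp (2 * x * Complex.I) = Complex.exp (x * Complex.I) * Complex.exp (x * Complex.I) := by
    rw [← Complex.exp_add]; ring_nf
  rw [this]
  have h : Complex.exp (-x * Complex.I) * Complex.exp (x * Complex.I) = 1 := by
    rw [← Complex.exp_add]; simp
  linear_combination h / 2

lemma zp_deriv (x : ℝ) : HasDerivAt zp (Complex.I * Complex.exp (2 * x * Complex.I)) x := by
  have e : zp = fun x : ℝ => (1 + Complex.exp (2 * x * Complex.I)) / 2 := funext zp_eq
  rw [e]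
  have h0 : HasDerivAt (fun x : ℝ => (x : ℂ)) 1 x := Complex.ofRealCLM.hasDerivAt
  have h1 := ((((h0.const_mul (2:ℂ)).mul_const Complex.I).cexp).const_add 1).div_const 2
  refine h1.congr_deriv ?_
  ring

lemma vert_mem {c s : ℝ} (hc : 0 < c) (hcs : s ^ 2 + c ^ 2 = 1) {w : ℂ} (hre : w.re = c ^ 2)
    (him : w.im ∈ Icc 0 (c * s)) : w ∈ Metric.ball (1 : ℂ) 1 := by
  rw [Metric.mem_ball, dist_eq_norm]
  have h : ‖w - 1‖ ^ 2 < 1 := by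
    rw [Complex.sq_norm, Complex.normSq_apply]
    simp only [Complex.sub_re, Complex.sub_im, Complex.one_re, Complex.one_im, sub_zero, hre]
    have : w.im * w.im ≤ (c * s) * (c * s) := mul_self_le_mul_self him.1 him.2
    have : (c * s) * (c * s) = c ^ 2 * (1 - c ^ 2) := by rw [← hcs]; ring
    nlinarith [sq_pos_of_pos hc]
  by_contra h2
  push Not at h2
  nlinarith

lemma FC_bound {c s : ℝ} (hc : 0 < c) (hc1 : c ≤ 1 / 2) (hs : 0 ≤ s) (hcs : s ^ 2 + c ^ 2 = 1) {w : ℂ}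
    (hre : w.re = c ^ 2) (him : w.im ∈ Icc 0 (c * s)) : ‖FC w‖ ≤ 6 * (π - 2 * Real.log c) ^ 4 := by
  have hb := vert_mem hc hcs hre him
  have hc2 : c ^ 2 ≤ 1 / 4 := by nlinarith
  have hw0 : c ^ 2 ≤ ‖w‖ := by
    rw [← hre]; exact (le_abs_self _).trans (Complex.abs_re_le_norm w)
  have hs1 : s ≤ 1 := by nlinarith
  have hw1 : ‖w‖ ≤ 1 := by
    refine (Complex.norm_le_abs_re_add_abs_im w).trans ?_
    rw [hre, abs_of_nonneg him.1, abs_of_nonneg (by positivity)]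
    nlinarith [him.2]
  have hlc : Real.log (c ^ 2) = 2 * Real.log c := by rw [Real.log_pow]; norm_num
  have hl : ‖Complex.log w‖ ≤ π - 2 * Real.log c := by
    refine (Complex.norm_le_abs_re_add_abs_im _).trans ?_
    rw [Complex.log_re, Complex.log_im]
    have h1 := Complex.abs_arg_le_pi w
    have h2 : |Real.log ‖w‖| ≤ - (2 * Real.log c) := by
      rw [abs_of_nonpos (Real.log_nonpos (norm_nonneg _) hw1), ← hlc]
      exact neg_le_neg (Real.log_le_log (by positivity) hw0)
    linarith
  set M := π - 2 * Real.log c with hM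
  have hl2 : 0 ≤ Real.log 2 := Real.log_nonneg (by norm_num)
  have hl2M : Real.log 2 ≤ M := by
    have : Real.log c ≤ 0 := Real.log_nonpos hc.le (by linarith)
    have := Real.log_two_lt_d9
    have := Real.pi_gt_three
    linarith
  have hne1 : w ≠ 1 := by
    intro h; rw [h] at hre; simp at hre; linarith
  have hne2 : w ≠ 1 / 2 := by
    intro h; rw [h] at hre; norm_num at hre; linarith
  rw [FC_eq hne1 hne2]
  have hf : ‖fC w‖ ≤ M ^ 4 := by
    unfold fC; rw [norm_pow]; gcongr
  have d1 : 3 / 4 ≤ ‖1 - w‖ := by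
    refine le_trans ?_ ((le_abs_self _).trans (Complex.abs_re_le_norm (1 - w)))
    simp [hre]; linarith
  have d2 : 1 / 2 ≤ ‖2 * w - 1‖ := by
    refine le_trans ?_ ((neg_le_abs _).trans (Complex.abs_re_le_norm (2 * w - 1)))
    simp [hre]; linarith
  have n2 : ‖fC w - ((Real.log 2 ^ 4 : ℝ) : ℂ)‖ ≤ 2 * M ^ 4 := by
    refine (norm_sub_le _ _).trans ?_
    rw [Complex.norm_real, Real.norm_of_nonneg (by positivity)]
    have : Real.log 2 ^ 4 ≤ M ^ 4 := by gcongr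
    linarith
  refine (norm_add_le _ _).trans ?_
  rw [norm_div, norm_div]
  have hM4 : 0 ≤ M ^ 4 := by positivity
  have t1 : ‖fC w‖ / ‖1 - w‖ ≤ 2 * M ^ 4 := by
    rw [div_le_iff₀ (by linarith)]; nlinarith
  have t2 : ‖fC w - ((Real.log 2 ^ 4 : ℝ) : ℂ)‖ / ‖2 * w - 1‖ ≤ 4 * M ^ 4 := by
    rw [div_le_iff₀ (by linarith)]; nlinarith
  linarith

lemma G_diff {G : ℂ → ℂ} (hG : ∀ z ∈ Metric.ball (1 : ℂ) 1, HasDerivAt G (FC z) z) {x : ℝ}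
    (hc : 0 < Real.cos x) (hs : 0 ≤ Real.sin x) (hc1 : Real.cos x ≤ 1 / 2) :
    ‖G (zp x) - G ((Real.cos x ^ 2 : ℝ) : ℂ)‖ ≤ 6 * (Real.cos x * (π - 2 * Real.log (Real.cos x)) ^ 4) := by
  set c := Real.cos x
  set s := Real.sin x
  have hcs : s ^ 2 + c ^ 2 = 1 := Real.sin_sq_add_cos_sq x
  have hcv : Convex ℝ (Complex.re ⁻¹' {c ^ 2} ∩ Complex.im ⁻¹' (Icc 0 (c * s))) :=
    ((convex_singleton (c ^ 2)).linear_preimage Complex.reLm).inter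
      ((convex_Icc 0 (c * s)).linear_preimage Complex.imLm)
  have := hcv.norm_image_sub_le_of_norm_hasDerivWithin_le (f := G) (f' := FC)
    (C := 6 * (π - 2 * Real.log c) ^ 4) (x := ((c ^ 2 : ℝ) : ℂ)) (y := zp x)
    (fun w hw => (hG w (vert_mem hc hcs hw.1 hw.2)).hasDerivWithinAt)
    (fun w hw => FC_bound hc hc1 hs hcs hw.1 hw.2)
    ⟨Complex.ofReal_re _, by rw [mem_preimage, Complex.ofReal_im]; exact ⟨le_rfl, by positivity⟩⟩ ⟨by simp [zp_re, c], by simp only [mem_preimage, zp_im, mem_Icc, c, s]; exact ⟨by positivity, le_rfl⟩⟩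
  refine this.trans ?_
  have hn : ‖zp x - ((c ^ 2 : ℝ) : ℂ)‖ ≤ c := by
    refine (Complex.norm_le_abs_re_add_abs_im _).trans ?_
    rw [Complex.sub_re, Complex.sub_im, zp_re, zp_im, Complex.ofReal_re, Complex.ofReal_im]
    have : s ≤ 1 := Real.sin_le_one x
    rw [sub_self, abs_zero, zero_add, sub_zero, abs_of_nonneg (by positivity)]
    change c * s ≤ c
    nlinarith
  have hp : 0 ≤ (π - 2 * Real.log c) ^ 4 := by positivity
  nlinarith

lemma c_lim : Tendsto (fun c : ℝ => 6 * (c * (π - 2 * Real.log c) ^ 4)) (𝓝[>] 0) (𝓝 0) := by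
  have := (((((mul_log_pow 0).const_mul (6 * π ^ 4)).add ((mul_log_pow 1).const_mul (-48 * π ^ 3))).add
    ((mul_log_pow 2).const_mul (144 * π ^ 2))).add ((mul_log_pow 3).const_mul (-192 * π))).add
    ((mul_log_pow 4).const_mul 96)
  simp only [mul_zero, add_zero] at this
  refine this.congr (fun c => ?_)
  ring

lemma cos_lim : Tendsto Real.cos (𝓝[<] (π / 2)) (𝓝[>] 0) := by
  rw [tendsto_nhdsWithin_iff]
  constructor
  · have := Real.continuous_cos.tendsto (π / 2)
    rw [Real.cos_pi_div_two] at this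
    exact this.mono_left nhdsWithin_le_nhds
  · filter_upwards [Ioo_mem_nhdsLT (show (0:ℝ) < π / 2 by positivity)] with x hx
    exact Real.cos_pos_of_mem_Ioo ⟨by linarith [hx.1, Real.pi_pos], hx.2⟩

lemma G_path_lim {G : ℂ → ℂ} (hG : ∀ z ∈ Metric.ball (1 : ℂ) 1, HasDerivAt G (FC z) z) :
    Tendsto (fun x : ℝ => (G (zp x)).re) (𝓝[<] (π / 2)) (𝓝 ((G 1).re - ∫ u in (0:ℝ)..1, Freal u)) := by
  have hsq : Tendsto (fun x => Real.cos x ^ 2) (𝓝[<] (π / 2)) (𝓝[>] 0) := by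
    rw [tendsto_nhdsWithin_iff]
    have h := tendsto_nhdsWithin_iff.1 cos_lim
    refine ⟨by simpa using h.1.pow 2, ?_⟩
    filter_upwards [h.2] with x hx
    have : 0 < Real.cos x := hx
    exact pow_pos this 2
  have h1 := (G_real_lim hG).comp hsq
  have h2 : Tendsto (fun x : ℝ => (G (zp x)).re - (G ((Real.cos x ^ 2 : ℝ) : ℂ)).re) (𝓝[<] (π / 2)) (𝓝 0) := by
    refine squeeze_zero_norm' ?_ (c_lim.comp cos_lim)
    have h3 := cos_lim.eventually (Ioo_mem_nhdsGT (show (0:ℝ) < 1 / 2 by norm_num))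
    filter_upwards [Ioo_mem_nhdsLT (show (0:ℝ) < π / 2 by positivity), h3] with x hx hx3
    have hs : 0 ≤ Real.sin x := Real.sin_nonneg_of_nonneg_of_le_pi hx.1.le (by linarith [hx.2, Real.pi_pos])
    refine le_trans ?_ (G_diff hG hx3.1 hs hx3.2.le)
    rw [← Complex.sub_re]
    exact Complex.abs_re_le_norm _
  have := h2.add h1
  simpa using this

lemma zp_mem {x : ℝ} (hx : x ∈ Ico 0 (π / 2)) : zp x ∈ Metric.ball (1 : ℂ) 1 := by
  have hc : 0 < Real.cos x := Real.cos_pos_of_mem_Ioo ⟨by linarith [hx.1, Real.pi_pos], hx.2⟩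
  have hs : 0 ≤ Real.sin x := Real.sin_nonneg_of_nonneg_of_le_pi hx.1 (by linarith [hx.2, Real.pi_pos])
  exact vert_mem hc (Real.sin_sq_add_cos_sq x) (zp_re x) (by
    rw [zp_im]; exact ⟨by positivity, le_rfl⟩)

lemma path_deriv {G : ℂ → ℂ} (hG : ∀ z ∈ Metric.ball (1 : ℂ) 1, HasDerivAt G (FC z) z) {x : ℝ}
    (hx : x ∈ Ioo 0 (π / 2)) : HasDerivAt (fun x : ℝ => (G (zp x)).re)
    (-(Real.cos x / Real.sin x * (Real.log (Real.cos x) ^ 4 - 6 * Real.log (Real.cos x) ^ 2 * x ^ 2 + x ^ 4))) x := by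
  have hc : 0 < Real.cos x := Real.cos_pos_of_mem_Ioo ⟨by linarith [hx.1, Real.pi_pos], hx.2⟩
  have hs : 0 < Real.sin x := Real.sin_pos_of_mem_Ioo ⟨hx.1, by linarith [hx.2, Real.pi_pos]⟩
  have h1 : HasDerivAt (fun x : ℝ => G (zp x)) (FC (zp x) * (Complex.I * Complex.exp (2 * x * Complex.I))) x :=
    (hG _ (zp_mem ⟨hx.1.le, hx.2⟩)).comp x (zp_deriv x)
  have h2 : HasDerivAt (fun x : ℝ => (G (zp x)).re) (FC (zp x) * (Complex.I * Complex.exp (2 * x * Complex.I))).re x :=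
    (Complex.reCLM.hasFDerivAt.comp_hasDerivAt x h1)
  refine h2.congr_deriv ?_
  have hf : fC (zp x) = (Real.log (Real.cos x) + x * Complex.I) ^ 4 := by
    unfold fC zp
    rw [Complex.log_ofReal_mul hc (Complex.exp_ne_zero _), Complex.log_exp]
    · simp; linarith [hx.1, Real.pi_pos]
    · simp; linarith [hx.2, Real.pi_pos]
  have hne1 : zp x ≠ 1 := by
    intro h
    have := congrArg Complex.im h
    rw [zp_im] at this
    simp [hc.ne', hs.ne'] at this
  have hne2 : zp x ≠ 1 / 2 := by
    intro h
    have := congrArg Complex.im h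
    rw [zp_im] at this
    simp [hc.ne', hs.ne'] at this
  have hw : Complex.exp (2 * x * Complex.I) = 2 * zp x - 1 := by rw [zp_eq]; ring
  have e1 : 1 - zp x = -(Complex.I * Real.sin x * Complex.exp (x * Complex.I)) := by
    apply Complex.ext
    · rw [Complex.sub_re, zp_re]
      simp [Complex.exp_re, Complex.exp_im, Complex.cos_ofReal_re, Complex.sin_ofReal_re]
      nlinarith [Real.sin_sq_add_cos_sq x]
    · rw [Complex.sub_im, zp_im]
      simp [Complex.exp_re, Complex.exp_im, Complex.cos_ofReal_re, Complex.sin_ofReal_re]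
      ring
  have hne3 : 2 * zp x - 1 ≠ 0 := by rw [← hw]; exact Complex.exp_ne_zero _
  have hne4 : 1 - zp x ≠ 0 := sub_ne_zero.2 hne1.symm
  have hsC : (Real.sin x : ℂ) ≠ 0 := by exact_mod_cast hs.ne'
  have hzz : zp x / (1 - zp x) = Complex.I * (Real.cos x / Real.sin x : ℝ) := by
    rw [e1, zp]
    have := Complex.exp_ne_zero (x * Complex.I)
    push_cast at hsC ⊢
    field_simp
    rw [Complex.I_sq]; ring
  have tot : FC (zp x) * (Complex.I * Complex.exp (2 * x * Complex.I))
      = -((Real.cos x / Real.sin x : ℝ) : ℂ) * (Real.log (Real.cos x) + x * Complex.I) ^ 4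
        - Complex.I * ((Real.log 2 ^ 4 : ℝ) : ℂ) := by
    rw [FC_eq hne1 hne2, hw, hf]
    generalize ((Real.log 2 ^ 4 : ℝ) : ℂ) = l4
    generalize ((Real.log (Real.cos x) : ℂ) + x * Complex.I) ^ 4 = f4
    have h5 : (2 * zp x - 1) / (1 - zp x) = zp x / (1 - zp x) - 1 := by
      field_simp; ring
    have : (f4 / (1 - zp x) + (f4 - l4) / (2 * zp x - 1)) * (Complex.I * (2 * zp x - 1))
      = Complex.I * (f4 * ((2 * zp x - 1) / (1 - zp x)) + (f4 - l4)) := by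
      have gen : ∀ a b f l : ℂ, a ≠ 0 → b ≠ 0 →
        (f / a + (f - l) / b) * (Complex.I * b) = Complex.I * (f * (b / a) + (f - l)) := by
        intro a b f l ha hb
        field_simp
      exact gen _ _ _ _ hne4 hne3
    rw [this, h5, hzz]
    linear_combination f4 * ((Real.cos x / Real.sin x : ℝ) : ℂ) * Complex.I_sq
  rw [tot]
  generalize Real.cos x / Real.sin x = ct
  generalize Real.log (Real.cos x) = ll
  have e4 : ((ll : ℂ) + x * Complex.I) ^ 4 = ((ll ^ 4 - 6 * ll ^ 2 * x ^ 2 + x ^ 4 : ℝ) : ℂ)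
     + ((4 * ll ^ 3 * x - 4 * ll * x ^ 3 : ℝ) : ℂ) * Complex.I := by
    push_cast
    have i3 : Complex.I ^ 3 = -Complex.I := Complex.I_pow_three
    have i4 : Complex.I ^ 4 = 1 := Complex.I_pow_four
    linear_combination (6 * (ll:ℂ) ^ 2 * x ^ 2) * Complex.I_sq + 4 * (ll:ℂ) * x ^ 3 * i3 + (x:ℂ) ^ 4 * i4
  rw [e4, ← Complex.ofReal_neg]
  simp only [Complex.sub_re, Complex.add_re, Complex.ofReal_re, Complex.mul_re, Complex.I_re, Complex.I_im, Complex.ofReal_im]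
  ring

lemma contour (hI : IntervalIntegrable (fun x => Real.cos x / Real.sin x *
      (Real.log (Real.cos x) ^ 4 - 6 * Real.log (Real.cos x) ^ 2 * x ^ 2 + x ^ 4)) volume 0 (π / 2)) :
    ∫ x in (0:ℝ)..(π / 2), Real.cos x / Real.sin x *
      (Real.log (Real.cos x) ^ 4 - 6 * Real.log (Real.cos x) ^ 2 * x ^ 2 + x ^ 4) = ∫ u in (0:ℝ)..1, Freal u := by
  obtain ⟨G, hG⟩ := exG
  have h0 : Tendsto (fun x : ℝ => (G (zp x)).re) (𝓝[>] 0) (𝓝 (G 1).re) := by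
    have h1 : zp 0 = 1 := by simp [zp]
    have h2 : ContinuousAt G (zp 0) := (hG _ (by rw [h1]; simp)).continuousAt
    have h3 : ContinuousAt (fun x : ℝ => (G (zp x)).re) 0 :=
      Complex.continuous_re.continuousAt.comp (h2.comp (zp_deriv 0).continuousAt)
    have := h3.tendsto
    rw [h1] at this
    exact this.mono_left nhdsWithin_le_nhds
  have := intervalIntegral.integral_eq_sub_of_hasDerivAt_of_tendsto (show (0:ℝ) < π / 2 by positivity)
    (fun x hx => path_deriv hG hx) hI.neg h0 (G_path_lim hG)
  rw [intervalIntegral.integral_neg] at this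
  linarith


lemma alt_log : Tendsto (fun N => ∑ n ∈ Finset.range N, (-1 : ℝ) ^ n / (n + 1 : ℝ)) atTop (𝓝 (Real.log 2)) := by
  have hanti : Antitone (fun n : ℕ => 1 / (n + 1 : ℝ)) := fun a b hab => by
    have : (a : ℝ) ≤ b := by exact_mod_cast hab
    apply one_div_le_one_div_of_le (by positivity); linarith
  obtain ⟨l, hl⟩ := hanti.tendsto_alternating_series_of_tendsto_zero tendsto_one_div_add_atTop_nhds_zero_nat
  have hl' : Tendsto (fun N => ∑ n ∈ Finset.range N, (-1 : ℝ) ^ n / (n + 1 : ℝ)) atTop (𝓝 l) := by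
    refine hl.congr (fun N => Finset.sum_congr rfl fun n _ => by ring)
  have h1 := Real.tendsto_tsum_powerSeries_nhdsWithin_lt hl'
  have h2 : Tendsto (fun z : ℝ => Real.log (1 + z) / z) (𝓝[<] 1) (𝓝 (Real.log 2)) := by
    have : ContinuousAt (fun z : ℝ => Real.log (1 + z) / z) 1 := by
      refine ContinuousAt.div (ContinuousAt.log (by fun_prop) (by norm_num)) (by fun_prop) (by norm_num)
    have := this.tendsto
    norm_num at this
    exact this.mono_left nhdsWithin_le_nhds
  have h3 : (fun z : ℝ => Real.log (1 + z) / z) =ᶠ[𝓝[<] 1] fun z => ∑' n : ℕ, (-1 : ℝ) ^ n / (n + 1 : ℝ) * z ^ n := by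
    filter_upwards [Ioo_mem_nhdsLT zero_lt_one] with z hz
    have := (Real.hasSum_pow_div_log_of_abs_lt_one (x := -z) (by rw [abs_neg, abs_of_pos hz.1]; exact hz.2))
    have h4 := (this.div_const (-z)).tsum_eq
    rw [sub_neg_eq_add, neg_div_neg_eq] at h4
    rw [← h4]
    congr 1; ext n
    have := hz.1.ne'
    rw [neg_pow z, pow_succ (-1 : ℝ), pow_succ z]
    field_simp
  rw [tendsto_nhds_unique (h2.congr' h3) h1]
  exact hl'

lemma eta_sum {k : ℕ} (hk : 2 ≤ k) : HasSum (fun n : ℕ => (-1 : ℝ) ^ n / (n + 1 : ℝ) ^ k) ((1 - 2 / 2 ^ k) * zetaVal k) := by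
  have hz := (zv_summable hk).hasSum
  change HasSum _ (zetaVal k) at hz
  have h1 : HasSum (fun n : ℕ => ((-1 : ℝ) ^ n - 1) / (n + 1 : ℝ) ^ k) (0 + -2 / 2 ^ k * zetaVal k) := by
    refine HasSum.even_add_odd ?_ ?_
    · convert hasSum_zero (α := ℝ) using 1
      ext n; simp
    · refine (hz.mul_left (-2 / 2 ^ k)).congr_fun ?_
      intro n
      rw [pow_succ, pow_mul]
      push_cast
      rw [show (2 * (n:ℝ) + 1 + 1) = 2 * (n + 1) by ring, mul_pow]
      field_simp
      norm_num
  have := h1.add hz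
  convert this using 1
  · ext n; rw [← add_div]; congr 1; ring
  · ring

lemma x4_sin (m : ℕ) (hm : 0 < m) : ∫ x in (0:ℝ)..(π / 2), x ^ 4 * (2 * Real.sin (2 * m * x)) =
    -(π ^ 4 / 16) * ((-1) ^ m / m) + 3 / 4 * π ^ 2 * ((-1) ^ m / m ^ 3) + 3 / 2 * ((1 - (-1) ^ m) / m ^ 5) := by
  have hm' : (m : ℝ) ≠ 0 := by positivity
  have hd : ∀ x ∈ uIcc 0 (π / 2), HasDerivAt (fun x : ℝ => 2 * (-x ^ 4 * Real.cos (2 * m * x) / (2 * m)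
      + 4 * x ^ 3 * Real.sin (2 * m * x) / (2 * m) ^ 2 + 12 * x ^ 2 * Real.cos (2 * m * x) / (2 * m) ^ 3
      - 24 * x * Real.sin (2 * m * x) / (2 * m) ^ 4 - 24 * Real.cos (2 * m * x) / (2 * m) ^ 5))
      (x ^ 4 * (2 * Real.sin (2 * m * x))) x := by
    intro x _
    have hmx : HasDerivAt (fun x : ℝ => 2 * m * x) (2 * m) x := by
      simpa using (hasDerivAt_id x).const_mul (2 * m : ℝ)
    have hs := hmx.sin
    have hc := hmx.cos
    have p := fun k : ℕ => hasDerivAt_pow k x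
    have := (((((((p 4).neg.mul hc).div_const (2 * m : ℝ)).add ((((p 3).const_mul 4).mul hs).div_const ((2 * m : ℝ) ^ 2))).add
      ((((p 2).const_mul 12).mul hc).div_const ((2 * m : ℝ) ^ 3))).sub
      (((((hasDerivAt_id x).const_mul 24).mul hs)).div_const ((2 * m : ℝ) ^ 4))).sub
      ((hc.const_mul 24).div_const ((2 * m : ℝ) ^ 5))).const_mul 2
    refine this.congr_deriv ?_
    simp only [id]
    field_simp
    norm_num
    ring
  rw [intervalIntegral.integral_eq_sub_of_hasDerivAt hd ((by fun_prop : Continuous _).intervalIntegrable _ _)]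
  have e : 2 * (m : ℝ) * (π / 2) = m * π := by ring
  rw [e, Real.sin_nat_mul_pi, Real.cos_nat_mul_pi]
  simp
  field_simp
  ring

lemma dirichlet (N : ℕ) (x : ℝ) : Real.cos x = (∑ n ∈ Finset.range N, 2 * Real.sin (2 * (n + 1 : ℕ) * x)) * Real.sin x
    + Real.cos ((2 * N + 1) * x) := by
  induction N with
  | zero => simp
  | succ N ih =>
    rw [Finset.sum_range_succ, add_mul]
    have : 2 * Real.sin (2 * (N + 1 : ℕ) * x) * Real.sin x = Real.cos ((2 * N + 1) * x) - Real.cos ((2 * (N + 1 : ℕ) + 1) * x) := by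
      rw [show (2 * (N:ℝ) + 1) * x = 2 * (N + 1 : ℕ) * x - x by push_cast; ring,
        show (2 * ((N + 1 : ℕ) : ℝ) + 1) * x = 2 * (N + 1 : ℕ) * x + x by ring, Real.cos_sub, Real.cos_add]
      ring
    rw [this]; linarith

lemma h_cont : ContinuousOn (fun x : ℝ => x ^ 4 / Real.sin x) (Icc 0 (π / 2)) := by
  have : ContinuousOn (fun x : ℝ => x ^ 3 / Real.sinc x) (Icc 0 (π / 2)) := by
    refine ContinuousOn.div (by fun_prop) Real.continuous_sinc.continuousOn ?_
    intro x hx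
    rcases eq_or_lt_of_le hx.1 with h | h
    · rw [← h]; simp
    · rw [Real.sinc_of_ne_zero h.ne']
      have := Real.sin_pos_of_mem_Ioo ⟨h, by linarith [hx.2, Real.pi_pos]⟩
      positivity
  refine this.congr ?_
  intro x hx
  rcases eq_or_ne x 0 with h | h
  · simp [h]
  · simp only [Real.sinc_of_ne_zero h]
    field_simp

lemma RL : Tendsto (fun N : ℕ => ∫ x in (0:ℝ)..(π / 2), Real.cos ((2 * N + 1) * x) * (x ^ 4 / Real.sin x)) atTop (𝓝 0) := by
  set h : ℝ → ℂ := (Ioc 0 (π / 2)).indicator (fun x : ℝ => ((x ^ 4 / Real.sin x : ℝ) : ℂ)) with hh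
  have h1 := Real.tendsto_integral_exp_smul_cocompact h
  have h2 : Tendsto (fun N : ℕ => (2 * (N : ℝ) + 1) / (2 * π)) atTop (cocompact ℝ) := by
    refine Tendsto.mono_right ?_ atTop_le_cocompact
    refine Tendsto.atTop_div_const (by positivity) ?_
    exact tendsto_atTop_add_const_right _ _ (tendsto_natCast_atTop_atTop.const_mul_atTop two_pos)
  have h3 := (Complex.continuous_re.tendsto 0).comp (h1.comp h2)
  rw [Complex.zero_re] at h3
  refine h3.congr (fun N => ?_)
  simp only [Function.comp_apply]
  have hI : IntegrableOn (fun v : ℝ => Complex.exp (((-((2 * N + 1) * v) : ℝ) : ℂ) * Complex.I) * ((v ^ 4 / Real.sin v : ℝ) : ℂ)) (Ioc 0 (π / 2)) := by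
    refine IntegrableOn.mono_set ?_ Ioc_subset_Icc_self
    refine ContinuousOn.integrableOn_Icc ?_
    exact ContinuousOn.mul (by fun_prop) (Complex.continuous_ofReal.comp_continuousOn h_cont)
  have e : ∀ v : ℝ, (Real.fourierChar (-(v * ((2 * (N : ℝ) + 1) / (2 * π)))) • h v : ℂ)
      = (Ioc 0 (π / 2)).indicator (fun v : ℝ => Complex.exp (((-((2 * N + 1) * v) : ℝ) : ℂ) * Complex.I) * ((v ^ 4 / Real.sin v : ℝ) : ℂ)) v := by
    intro v
    rw [Circle.smul_def, Real.fourierChar_apply, hh]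
    by_cases hv : v ∈ Ioc 0 (π / 2)
    · rw [indicator_of_mem hv, indicator_of_mem hv, smul_eq_mul]
      congr 4
      field_simp
    · rw [indicator_of_notMem hv, indicator_of_notMem hv, smul_zero]
  simp_rw [e]
  rw [integral_indicator measurableSet_Ioc, intervalIntegral.integral_of_le (by positivity)]
  have := (integral_re (𝕜 := ℂ) hI)
  simp only [RCLike.re_to_complex] at this
  rw [← this]
  refine integral_congr_ae (Eventually.of_forall fun v => ?_)
  simp only
  rw [Complex.mul_re, Complex.ofReal_re, Complex.ofReal_im, Complex.exp_ofReal_mul_I_re, Real.cos_neg]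
  ring

lemma cot_x4_int : IntervalIntegrable (fun x => Real.cos x / Real.sin x * x ^ 4) volume 0 (π / 2) := by
  have : ContinuousOn (fun x : ℝ => Real.cos x * (x ^ 4 / Real.sin x)) (Icc 0 (π / 2)) :=
    ContinuousOn.mul (by fun_prop) h_cont
  have h2 := this.intervalIntegrable_of_Icc (μ := volume) (show (0:ℝ) ≤ π / 2 by positivity)
  refine h2.congr (fun x _ => by ring)

lemma cot_x4 : ∫ x in (0:ℝ)..(π / 2), Real.cos x / Real.sin x * x ^ 4 =
    π ^ 4 / 16 * Real.log 2 - 9 / 16 * π ^ 2 * zetaVal 3 + 93 / 32 * zetaVal 5 := by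
  set Q := ∫ x in (0:ℝ)..(π / 2), Real.cos x / Real.sin x * x ^ 4 with hQ
  have step : ∀ N : ℕ, ∑ n ∈ Finset.range N, (π ^ 4 / 16 * ((-1 : ℝ) ^ n / (n + 1 : ℝ)) - 3 / 4 * π ^ 2 * ((-1 : ℝ) ^ n / (n + 1 : ℝ) ^ 3)
      + 3 / 2 * (1 / (n + 1 : ℝ) ^ 5 + (-1 : ℝ) ^ n / (n + 1 : ℝ) ^ 5))
      = Q - ∫ x in (0:ℝ)..(π / 2), Real.cos ((2 * N + 1) * x) * (x ^ 4 / Real.sin x) := by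
    intro N
    have hi : IntervalIntegrable (fun x : ℝ => Real.cos ((2 * N + 1) * x) * (x ^ 4 / Real.sin x)) volume 0 (π / 2) := by
      refine ContinuousOn.intervalIntegrable_of_Icc (by positivity) (ContinuousOn.mul (by fun_prop) h_cont)
    rw [hQ, ← intervalIntegral.integral_sub cot_x4_int hi]
    have : ∀ x ∈ uIoc 0 (π / 2), Real.cos x / Real.sin x * x ^ 4 - Real.cos ((2 * N + 1) * x) * (x ^ 4 / Real.sin x)
        = ∑ n ∈ Finset.range N, x ^ 4 * (2 * Real.sin (2 * (n + 1 : ℕ) * x)) := by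
      intro x hx
      rw [uIoc_of_le (by positivity)] at hx
      have hs := Real.sin_pos_of_mem_Ioo ⟨hx.1, by linarith [hx.2, Real.pi_pos]⟩
      rw [← Finset.mul_sum]
      have hd := dirichlet N x
      field_simp
      rw [hd]; ring
    rw [intervalIntegral.integral_congr_ae (Eventually.of_forall this), intervalIntegral.integral_finsetSum]
    · refine Finset.sum_congr rfl fun n _ => ?_
      rw [x4_sin (n + 1) (by omega)]
      push_cast
      rw [pow_succ]
      ring
    · intro n _
      exact (by fun_prop : Continuous _).intervalIntegrable _ _
  have l1 : Tendsto (fun N : ℕ => Q - ∫ x in (0:ℝ)..(π / 2), Real.cos ((2 * N + 1) * x) * (x ^ 4 / Real.sin x)) atTop (𝓝 (Q - 0)) :=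
    RL.const_sub Q
  have z5 : HasSum (fun n : ℕ => 1 / (n + 1 : ℝ) ^ 5) (zetaVal 5) := (zv_summable (by norm_num)).hasSum
  have l2 := ((alt_log.const_mul (π ^ 4 / 16)).sub ((eta_sum (k := 3) (by norm_num)).tendsto_sum_nat.const_mul (3 / 4 * π ^ 2))).add
    ((z5.tendsto_sum_nat.add (eta_sum (k := 5) (by norm_num)).tendsto_sum_nat).const_mul (3 / 2))
  have l3 := l1.congr (fun N => (step N).symm)
  have := tendsto_nhds_unique l3 (l2.congr (fun N => by
    rw [Finset.mul_sum, Finset.mul_sum, ← Finset.sum_add_distrib, Finset.mul_sum, ← Finset.sum_sub_distrib, ← Finset.sum_add_distrib]))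
  rw [sub_zero] at this
  rw [this]; ring

lemma zv2 : zetaVal 2 = π ^ 2 / 6 := by
  have h := (hasSum_nat_add_iff' 1).2 hasSum_zeta_two
  simpa [zetaVal] using h.tsum_eq

lemma zv4 : zetaVal 4 = π ^ 4 / 90 := by
  have h := (hasSum_nat_add_iff' 1).2 hasSum_zeta_four
  simpa [zetaVal] using h.tsum_eq

lemma main_int : IntervalIntegrable (fun x => x ^ 2 * (Real.cos x / Real.sin x) * (Real.log (Real.cos x)) ^ 2) volume 0 (π / 2) := by
  refine (int_cot_log.1.add cot_x4_int).mono_fun' ?_ ?_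
  · exact Measurable.aestronglyMeasurable (by fun_prop)
  · refine (ae_restrict_iff' measurableSet_uIoc).2 (Eventually.of_forall fun x hx => ?_)
    rw [uIoc_of_le (by positivity)] at hx
    have hs := Real.sin_pos_of_mem_Ioo ⟨hx.1, by linarith [hx.2, Real.pi_pos]⟩
    have hc : 0 ≤ Real.cos x := Real.cos_nonneg_of_mem_Icc ⟨by linarith [hx.1, Real.pi_pos], hx.2⟩
    have hct : 0 ≤ Real.cos x / Real.sin x := by positivity
    beta_reduce
    rw [Real.norm_of_nonneg (by positivity)]
    generalize Real.cos x / Real.sin x = ct at *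
    generalize Real.log (Real.cos x) = l
    have : x ^ 2 * l ^ 2 ≤ l ^ 4 + x ^ 4 := by nlinarith [sq_nonneg (x ^ 2 - l ^ 2), sq_nonneg (x ^ 2), sq_nonneg (l ^ 2)]
    nlinarith

theorem stmt_6 :
    ∫ x in (0 : ℝ)..(π / 2), x ^ 2 * (Real.cos x / Real.sin x) * (Real.log (Real.cos x)) ^ 2
    = -(217 / 64) * zetaVal 5 - 9 / 16 * zetaVal 2 * zetaVal 3 + 2 * polyLog 5 (1 / 2)
      + 79 / 16 * Real.log 2 * zetaVal 4 + 2 / 3 * Real.log 2 ^ 3 * zetaVal 2 - 1 / 60 * Real.log 2 ^ 5 := by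
  have e : (fun x : ℝ => Real.cos x / Real.sin x *
      (Real.log (Real.cos x) ^ 4 - 6 * Real.log (Real.cos x) ^ 2 * x ^ 2 + x ^ 4)) =
      fun x => (Real.cos x / Real.sin x * Real.log (Real.cos x) ^ 4 + Real.cos x / Real.sin x * x ^ 4)
        - 6 * (x ^ 2 * (Real.cos x / Real.sin x) * (Real.log (Real.cos x)) ^ 2) := by
    ext x; ring
  have h0 := contour (by
    rw [e]; exact (int_cot_log.1.add cot_x4_int).sub (main_int.const_mul 6))
  rw [e, intervalIntegral.integral_sub (int_cot_log.1.add cot_x4_int) (main_int.const_mul 6),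
    intervalIntegral.integral_add int_cot_log.1 cot_x4_int, intervalIntegral.integral_const_mul,
    int_cot_log.2, cot_x4] at h0
  have h1 : ∫ u in (0:ℝ)..1, Freal u = _ := int_F.2
  rw [h1] at h0
  have z2 := zv2
  have z4 := zv4
  have p2 : π ^ 2 = 6 * zetaVal 2 := by rw [z2]; ring
  have p4 : π ^ 4 = 90 * zetaVal 4 := by rw [z4]; ring
  rw [p2, p4] at h0
  linarith
end
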